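/- Let X be a nonempty metric space that is locally compact, geodesic, isometrically homogeneous, and admits a dilation of factor λ > 1. Then X is homeomorphic to ℝⁿ for some natural number n. -/

import Mathlib

/-- `X` is isometrically homogeneous: for all `p q` there is a surjective
isometry sending `p` to `q`. -/
def IsometricallyHomogeneous (X : Type*) [MetricSpace X] : Prop :=
  ∀ p q : X, ∃ f : X → X, Isometry f ∧ Function.Surjective f ∧ f p = q

/-- `X` is a geodesic metric space: any two points are joined by an isometric
image of a real interval `[0, T]`. -/
def IsGeodesicSpace (X : Type*) [MetricSpace X] : Prop :=
  ∀ p q : X, ∃ T : ℝ, 0 ≤ T ∧ ∃ ι : ℝ → X,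
    (∀ s ∈ Set.Icc (0 : ℝ) T, ∀ t ∈ Set.Icc (0 : ℝ) T,
      dist (ι s) (ι t) = dist s t) ∧ ι 0 = p ∧ ι T = q

/-- `f` is a dilation of factor `λ` on `X`: a homeomorphism multiplying all
distances by `λ`. -/
def IsDilation {X : Type*} [MetricSpace X] (f : X ≃ₜ X) (lam : ℝ) : Prop :=
  ∀ p q : X, dist (f p) (f q) = lam * dist p q


set_option linter.all false
set_option linter.deprecated false
namespace CarnotHomeo
open Filter Topology Set

theorem gelfand_bound {A : Type*} [NormedRing A] [NormedAlgebra ℂ A] [CompleteSpace A]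
    (a : A) (r : ℝ) (hr : 0 < r) (h : ∀ k ∈ spectrum ℂ a, ‖k‖ < r) :
    ∃ α, 0 < α ∧ α < r ∧ ∃ C, 0 < C ∧ ∀ n : ℕ, ‖a ^ n‖ ≤ C * α ^ n := by
  rcases subsingleton_or_nontrivial A with hA | hA
  · refine ⟨r / 2, by positivity, by linarith, 1, one_pos, fun n => ?_⟩
    rw [Subsingleton.elim (a ^ n) 0, norm_zero]; positivity
  · have h1 : spectralRadius ℂ a < (r.toNNReal : NNReal) := by
      apply spectrum.spectralRadius_lt_of_forall_lt
      intro z hz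
      rw [← NNReal.coe_lt_coe, Real.coe_toNNReal _ hr.le]
      exact h z hz
    obtain ⟨q, hq1, hq2⟩ := exists_between h1
    have hqtop : q ≠ ⊤ := (hq2.trans ENNReal.coe_lt_top).ne
    lift q to NNReal using hqtop
    have hq0 : (0 : ℝ) < q := by
      have : (0 : ENNReal) < q := lt_of_le_of_lt bot_le hq1
      exact_mod_cast this
    have hqr : (q : ℝ) < r := by
      have : q < r.toNNReal := by exact_mod_cast hq2
      rw [← NNReal.coe_lt_coe, Real.coe_toNNReal _ hr.le] at this
      exact this
    have h2 := (spectrum.pow_nnnorm_pow_one_div_tendsto_nhds_spectralRadius a).eventually_lt_const hq1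
    obtain ⟨N, hN⟩ := eventually_atTop.1 h2
    have h3 : ∀ n ≥ N + 1, ‖a ^ n‖ ≤ (q : ℝ) ^ n := by
      intro n hn
      have h4 := hN n (by omega)
      have hn0 : (0 : ℝ) < n := by exact_mod_cast (by omega : 0 < n)
      have h5 : (‖a ^ n‖₊ : ENNReal) ≤ (q : ENNReal) ^ (n : ℝ) := by
        have := ENNReal.rpow_le_rpow h4.le hn0.le
        rwa [← ENNReal.rpow_mul, one_div, inv_mul_cancel₀ hn0.ne', ENNReal.rpow_one] at this
      rw [ENNReal.rpow_natCast] at h5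
      exact_mod_cast h5
    refine ⟨q, hq0, hqr, 1 + ∑ i ∈ Finset.range (N + 1), ‖a ^ i‖ / (q : ℝ) ^ i, ?_, fun n => ?_⟩
    · have : 0 ≤ ∑ i ∈ Finset.range (N + 1), ‖a ^ i‖ / (q : ℝ) ^ i :=
        Finset.sum_nonneg fun i _ => by positivity
      linarith
    · have hs : 0 ≤ ∑ i ∈ Finset.range (N + 1), ‖a ^ i‖ / (q : ℝ) ^ i :=
        Finset.sum_nonneg fun i _ => by positivity
      by_cases hn : N + 1 ≤ n
      · calc ‖a ^ n‖ ≤ 1 * (q : ℝ) ^ n := by rw [one_mul]; exact h3 n hn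
          _ ≤ _ := by gcongr; linarith
      · have : ‖a ^ n‖ / (q : ℝ) ^ n ≤ ∑ i ∈ Finset.range (N + 1), ‖a ^ i‖ / (q : ℝ) ^ i :=
          Finset.single_le_sum (f := fun i => ‖a ^ i‖ / (q : ℝ) ^ i) (fun i _ => by positivity)
            (Finset.mem_range.2 (by omega))
        rw [← div_le_iff₀ (by positivity)]
        linarith

section spectral
variable {B : Type*} [NormedAddCommGroup B] [NormedSpace ℂ B]

def SpecP (M : B →L[ℂ] B) (β : ℝ) (V : Submodule ℂ B) : Prop :=
  FiniteDimensional ℂ V ∧ (∀ x ∈ V, M x ∈ V) ∧ ∀ x ∈ V, x ≠ 0 → ∀ k : ℂ, M x = k • x → β ≤ ‖k‖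

theorem spec_extend (M : B →L[ℂ] B) (β : ℝ) (V : Submodule ℂ B) (hV : SpecP M β V)
    (x : B) (hx : x ∉ V) (k : ℂ) (hk : β ≤ ‖k‖) (hxk : M x - k • x ∈ V) :
    ∃ V', SpecP M β V' ∧ V < V' ∧ ∃ k : ℂ, β ≤ ‖k‖ ∧ ∀ y ∈ V', M y - k • y ∈ V := by
  obtain ⟨h1, h2, h3⟩ := hV
  have key : ∀ y ∈ V ⊔ ℂ ∙ x, M y - k • y ∈ V := by
    intro y hy
    obtain ⟨v, hv, w, hw, rfl⟩ := Submodule.mem_sup.1 hy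
    obtain ⟨c, rfl⟩ := Submodule.mem_span_singleton.1 hw
    have : M (v + c • x) - k • (v + c • x) = (M v - k • v) + c • (M x - k • x) := by
      simp only [map_add, map_smul, smul_add, smul_sub, smul_comm k c]; abel
    rw [this]
    exact V.add_mem (V.sub_mem (h2 v hv) (V.smul_mem _ hv)) (V.smul_mem _ hxk)
  have hlt : V < V ⊔ ℂ ∙ x := by
    refine lt_of_le_of_ne le_sup_left fun h => hx ?_
    rw [h]; exact Submodule.mem_sup_right (Submodule.mem_span_singleton_self x)
  refine ⟨V ⊔ ℂ ∙ x, ⟨inferInstance, ?_, ?_⟩, hlt, k, hk, key⟩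
  · intro y hy
    have := (V ⊔ ℂ ∙ x).add_mem (hlt.le (key y hy)) ((V ⊔ ℂ ∙ x).smul_mem k hy)
    simpa using this
  · intro y hy hy0 k' hk'
    by_cases hyV : y ∈ V
    · exact h3 y hyV hy0 k' hk'
    · have := key y hy
      rw [hk', ← sub_smul] at this
      have hkk : k' - k = 0 := by
        by_contra h0
        exact hyV ((V.smul_mem_iff h0).1 this)
      rw [sub_eq_zero.1 hkk]; exact hk

theorem spec_maximal (M : B →L[ℂ] B) (hM : IsCompactOperator M) (β : ℝ) (hβ : 0 < β) :
    ∃ V, SpecP M β V ∧ ∀ x ∉ V, ∀ k : ℂ, β ≤ ‖k‖ → M x - k • x ∉ V := by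
  by_contra! hcon
  have h1 : ∀ V : {V // SpecP M β V}, ∃ V' : {V // SpecP M β V}, V.1 < V'.1 ∧
      ∃ k : ℂ, β ≤ ‖k‖ ∧ ∀ y ∈ V'.1, M y - k • y ∈ V.1 := by
    intro V
    obtain ⟨x, hx, k, hk, hxk⟩ := hcon V.1 V.2
    obtain ⟨V', a, b, c⟩ := spec_extend M β V.1 V.2 x hx k hk hxk
    exact ⟨⟨V', a⟩, b, c⟩
  choose nxt hlt k hk hkV using h1
  have h0 : SpecP M β ⊥ := by
    refine ⟨inferInstance, ?_, ?_⟩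
    · intro x hx; rw [Submodule.mem_bot] at *; simp [hx]
    · intro x hx hx0; exact absurd ((Submodule.mem_bot ℂ).1 hx) hx0
  let S : ℕ → {V // SpecP M β V} := fun n => nxt^[n] ⟨⊥, h0⟩
  have hS : ∀ n, S (n + 1) = nxt (S n) := fun n => Function.iterate_succ_apply' _ _ _
  have hmono : Monotone fun n => (S n).1 := monotone_nat_of_le_succ fun n => by
    rw [hS]; exact (hlt _).le
  have hx : ∀ n, ∃ x ∈ (S (n + 1)).1, ‖x‖ = 1 ∧ ∀ y ∈ (S n).1, (1 / 2 : ℝ) ≤ ‖x - y‖ := by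
    intro n
    have hl : (S n).1 < (S (n + 1)).1 := by rw [hS]; exact hlt _
    obtain ⟨z, hz1, hz2⟩ := SetLike.exists_of_lt hl
    haveI := (S n).2.1
    have hcl : IsClosed ((S n).1.comap (S (n + 1)).1.subtype : Set (S (n + 1)).1) := by
      have := (S n).1.closed_of_finiteDimensional
      exact this.preimage continuous_subtype_val
    obtain ⟨x, -, hx1, hx2⟩ := riesz_lemma_of_lt_one (𝕜 := ℂ) hcl ⟨⟨z, hz1⟩, hz2⟩
      (r := 1 / 2) (by norm_num)
    exact ⟨x, x.2, hx1, fun y hy => hx2 ⟨y, hmono (Nat.le_succ n) hy⟩ hy⟩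
  choose x hxS hx1 hx2 using hx
  have hsep : ∀ i j, i < j → β / 2 ≤ ‖M (x j) - M (x i)‖ := by
    intro i j hij
    have hkj : M (x j) - k (S j) • x j ∈ (S j).1 := hkV (S j) (x j) (by rw [← hS]; exact hxS j)
    have hMi : M (x i) ∈ (S j).1 := (S j).2.2.1 _ (hmono hij (hxS i))
    have hk0 : k (S j) ≠ 0 := norm_pos_iff.1 (hβ.trans_le (hk _))
    have e : M (x j) - M (x i) =
        k (S j) • (x j - (k (S j))⁻¹ • (M (x i) - (M (x j) - k (S j) • x j))) := by
      rw [smul_sub, smul_inv_smul₀ hk0]; abel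
    rw [e, norm_smul]
    have := hx2 j _ ((S j).1.smul_mem (k (S j))⁻¹ ((S j).1.sub_mem hMi hkj))
    have := hk (S j)
    nlinarith
  obtain ⟨K, hK, hKs⟩ := hM.image_closedBall_subset_compact (f := (M : B →ₗ[ℂ] B)) 1
  have hmem : ∀ n, M (x n) ∈ K := fun n => hKs ⟨x n, by simp [hx1 n], rfl⟩
  obtain ⟨a, -, φ, hφ, hlim⟩ := hK.tendsto_subseq hmem
  have hc := hlim.cauchySeq
  obtain ⟨N, hN⟩ := Metric.cauchySeq_iff.1 hc (β / 2) (by positivity)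
  have h5 := hN (N + 1) (by omega) N le_rfl
  rw [dist_eq_norm] at h5
  exact absurd (hsep (φ N) (φ (N + 1)) (hφ (Nat.lt_succ_self N))) (not_le.2 h5)


set_option maxHeartbeats 400000 in
theorem spec_quot [CompleteSpace B] (M : B →L[ℂ] B) (hM : IsCompactOperator M)
    (β₀ : ℝ) (hβ : 0 < β₀) (V : Submodule ℂ B) (hfin : FiniteDimensional ℂ V)
    (hinv : ∀ x ∈ V, M x ∈ V)
    (hmax : ∀ x ∉ V, ∀ k : ℂ, β₀ ≤ ‖k‖ → M x - k • x ∉ V) :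
    ∃ α C : ℝ, 0 < α ∧ α < β₀ ∧ 0 < C ∧
      (∀ (n : ℕ) (u : B), ∃ v ∈ V, ‖(M ^ n) u - v‖ ≤ C * α ^ n * ‖u‖) := by
  have hcl : IsClosed (V : Set B) := V.closed_of_finiteDimensional
  -- quotient operator
  let Mq : (B ⧸ V) →L[ℂ] (B ⧸ V) := V.liftQL (V.mkQL.comp M) (by
    intro x hx
    simp only [ContinuousLinearMap.coe_comp, LinearMap.mem_ker, LinearMap.comp_apply]
    exact (Submodule.Quotient.mk_eq_zero V).2 (hinv x hx))
  have hMq : ∀ x, Mq (V.mkQL x) = V.mkQL (M x) := fun x => rfl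
  have hMqn : ∀ (n : ℕ) x, (Mq ^ n) (V.mkQL x) = V.mkQL ((M ^ n) x) := by
    intro n
    induction n with
    | zero => intro x; simp
    | succ n ih => intro x; rw [pow_succ, pow_succ, ContinuousLinearMap.mul_apply, hMq, ih]; rfl
  have hMqc : IsCompactOperator Mq := by
    obtain ⟨K, hK, hKn⟩ := hM
    refine ⟨V.mkQL '' K, hK.image V.mkQL.continuous, ?_⟩
    have h1 := V.isOpenQuotientMap_mkQL.isOpenMap.image_mem_nhds hKn
    rw [map_zero] at h1
    refine mem_of_superset h1 ?_
    rintro _ ⟨x, hx, rfl⟩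
    exact ⟨M x, hx, (hMq x).symm⟩
  have hspec : ∀ k ∈ spectrum ℂ Mq, ‖k‖ < β₀ := by
    intro k hk
    by_contra! hlt
    have hk0 : k ≠ 0 := norm_pos_iff.1 (hβ.trans_le hlt)
    obtain ⟨y, hy1, hy2⟩ := ((hMqc.hasEigenvalue_iff_mem_spectrum hk0).2 hk).exists_hasEigenvector
    obtain ⟨x, rfl⟩ := Submodule.mkQ_surjective V y
    have hy3 := Module.End.mem_eigenspace_iff.1 hy1
    refine hmax x (fun hx => hy2 ((Submodule.Quotient.mk_eq_zero V).2 hx)) k hlt ?_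
    rw [← Submodule.Quotient.mk_eq_zero V]
    have : Mq (V.mkQL x) = k • V.mkQL x := hy3
    rw [hMq] at this
    have h4 : V.mkQL (M x - k • x) = 0 := by rw [map_sub, this, map_smul, sub_self]
    exact h4
  obtain ⟨α, hα0, hαβ, C1, hC1, hbound1⟩ := gelfand_bound Mq β₀ hβ hspec
  refine ⟨α, C1 + 1, hα0, hαβ, by positivity, ?_⟩
  intro n w
  by_cases hw : w = 0
  · exact ⟨0, V.zero_mem, by simp [hw]⟩
  have hw0 : 0 < ‖w‖ := norm_pos_iff.2 hw
  have h1 : ‖V.mkQL ((M ^ n) w)‖ ≤ C1 * α ^ n * ‖w‖ := by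
    rw [← hMqn]
    refine ((Mq ^ n).le_opNorm _).trans ?_
    have : ‖V.mkQL w‖ ≤ ‖w‖ := Submodule.Quotient.norm_mk_le V w
    have := hbound1 n
    gcongr
  obtain ⟨m, hm1, hm2⟩ := Submodule.Quotient.norm_mk_lt (V.mkQL ((M ^ n) w))
    (show 0 < α ^ n * ‖w‖ by positivity)
  refine ⟨(M ^ n) w - m, ?_, ?_⟩
  · rw [← Submodule.Quotient.mk_eq_zero, Submodule.Quotient.mk_sub, hm1]
    exact sub_self _
  · rw [sub_sub_cancel]
    calc ‖m‖ ≤ (C1 + 1) * α ^ n * ‖w‖ := by linarith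
      _ = _ := rfl


theorem unit_inv_bound {A : Type*} [NormedRing A] [NormedAlgebra ℂ A] [CompleteSpace A]
    (u : Aˣ) (β₀ β : ℝ) (hβ0 : 0 < β) (hββ : β < β₀)
    (h : ∀ k : ℂ, ‖k‖ < β₀ → IsUnit ((u : A) - k • (1 : A))) :
    ∃ C, 0 < C ∧ ∀ n : ℕ, ‖((u⁻¹ : Aˣ) : A) ^ n‖ ≤ C * (β⁻¹) ^ n := by
  have hspecinv : ∀ k ∈ spectrum ℂ ((u⁻¹ : Aˣ) : A), ‖k‖ < β⁻¹ := by
    intro k hk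
    by_contra! hlt
    have hk0 : k ≠ 0 := norm_pos_iff.1 ((inv_pos.2 hβ0).trans_le hlt)
    refine hk ?_
    have h1 : ‖k⁻¹‖ < β₀ := by
      rw [norm_inv]
      exact lt_of_le_of_lt (inv_le_of_inv_le₀ hβ0 hlt) hββ
    have h2 := h k⁻¹ h1
    rw [← Algebra.algebraMap_eq_smul_one] at h2
    have e : algebraMap ℂ A k - ((u⁻¹ : Aˣ) : A)
        = algebraMap ℂ A k * (((u⁻¹ : Aˣ) : A) * ((u : A) - algebraMap ℂ A k⁻¹)) := by
      rw [mul_sub, Units.inv_mul, mul_sub, mul_one]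
      rw [← Algebra.commutes k⁻¹, ← mul_assoc, ← map_mul, mul_inv_cancel₀ hk0, map_one, one_mul]
    show IsUnit _
    rw [e]
    exact ((IsUnit.mk0 k hk0).map (algebraMap ℂ A)).mul ((Units.isUnit _).mul h2)
  obtain ⟨γ, hγ0, hγβ, C2, hC2, hbound2⟩ := gelfand_bound _ β⁻¹ (inv_pos.2 hβ0) hspecinv
  refine ⟨C2, hC2, fun n => (hbound2 n).trans ?_⟩
  gcongr

theorem spec_restr_unit (M : B →L[ℂ] B)
    (β₀ : ℝ) (V : Submodule ℂ B)
    (hfin : FiniteDimensional ℂ V) (hinv : ∀ x ∈ V, M x ∈ V)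
    (heig : ∀ x ∈ V, x ≠ 0 → ∀ k : ℂ, M x = k • x → β₀ ≤ ‖k‖)
    (Mv : V →L[ℂ] V) (hMv : ∀ x : V, (Mv x : B) = M x) (k : ℂ) (hk : ‖k‖ < β₀) :
    IsUnit (Mv - k • (1 : V →L[ℂ] V)) := by
  have halg : ∀ x : V, (Mv - k • (1 : V →L[ℂ] V)) x = Mv x - k • x := fun x => rfl
  generalize Mv - k • (1 : V →L[ℂ] V) = T at halg
  have hinj : Function.Injective T := by
    rw [injective_iff_map_eq_zero]
    intro x hx
    by_contra hx0
    refine absurd (heig x x.2 (by simpa using hx0) k ?_) (not_le.2 hk)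
    rw [halg] at hx
    have := congrArg (Subtype.val) (sub_eq_zero.1 hx)
    rw [hMv] at this
    exact this
  have hsurj : Function.Surjective T := LinearMap.surjective_of_injective (f := T.toLinearMap) hinj
  haveI : CompleteSpace V := FiniteDimensional.complete ℂ V
  exact ContinuousLinearMap.isUnit_iff_bijective.2 ⟨hinj, hsurj⟩

theorem spec_restr (M : B →L[ℂ] B)
    (β₀ β : ℝ) (hβ : 0 < β₀) (hβ0 : 0 < β) (hββ : β < β₀) (V : Submodule ℂ B)
    (hfin : FiniteDimensional ℂ V) (hinv : ∀ x ∈ V, M x ∈ V)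
    (heig : ∀ x ∈ V, x ≠ 0 → ∀ k : ℂ, M x = k • x → β₀ ≤ ‖k‖) :
    ∃ C : ℝ, 0 < C ∧
      (∀ (n : ℕ), ∀ u ∈ V, ∃ v ∈ V, (M ^ n) v = u ∧ ‖v‖ ≤ C * (β⁻¹) ^ n * ‖u‖) := by
  obtain ⟨Mv, hMv⟩ : ∃ Mv : V →L[ℂ] V, ∀ x : V, (Mv x : B) = M x :=
    ⟨LinearMap.toContinuousLinearMap ((M : B →ₗ[ℂ] B).restrict hinv), fun x => rfl⟩
  have hspecv := spec_restr_unit M β₀ V hfin hinv heig Mv hMv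
  haveI : CompleteSpace V := FiniteDimensional.complete ℂ V
  have hu : IsUnit Mv := by
    have := hspecv 0 (by simpa using hβ)
    have e : Mv - (0 : ℂ) • (1 : V →L[ℂ] V) = Mv := by
      refine ContinuousLinearMap.ext fun x => ?_
      show Mv x - (0 : ℂ) • x = Mv x
      rw [zero_smul, sub_zero]
    rwa [e] at this
  obtain ⟨u, rfl⟩ := hu
  obtain ⟨C, hC, hb⟩ := unit_inv_bound (A := V →L[ℂ] V) u β₀ β hβ0 hββ hspecv
  have h1 : ∀ (n : ℕ) (x : V), (M ^ n) (x : B) = (((u : V →L[ℂ] V) ^ n) x : V) := by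
    intro n
    induction n with
    | zero => intro x; rfl
    | succ n ih =>
      intro x
      rw [pow_succ, pow_succ]
      show (M ^ n) (M x) = (((u : V →L[ℂ] V) ^ n) (u.1 x) : V)
      rw [← hMv, ih]
  have h2 : ∀ (n : ℕ) (x : V), ((u : V →L[ℂ] V) ^ n) ((((u⁻¹ : (V →L[ℂ] V)ˣ) : V →L[ℂ] V) ^ n) x) = x := by
    intro n x
    have e : ((u : V →L[ℂ] V) ^ n) * (((u⁻¹ : (V →L[ℂ] V)ˣ) : V →L[ℂ] V) ^ n) = 1 := by
      rw [← Units.val_pow_eq_pow_val, ← Units.val_pow_eq_pow_val, ← Units.val_mul, inv_pow,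
        mul_inv_cancel, Units.val_one]
    exact congrArg (fun T : V →L[ℂ] V => T x) e
  refine ⟨C, hC, fun n w hw => ?_⟩
  have hb' := hb n
  have h2' := h2 n ⟨w, hw⟩
  generalize ((u⁻¹ : (V →L[ℂ] V)ˣ) : V →L[ℂ] V) ^ n = N at hb' h2'
  refine ⟨N ⟨w, hw⟩, Subtype.mem _, ?_, ?_⟩
  · rw [h1, h2']
  · calc ‖(N ⟨w, hw⟩ : B)‖ = ‖N ⟨w, hw⟩‖ := rfl
      _ ≤ ‖N‖ * ‖(⟨w, hw⟩ : V)‖ := N.le_opNorm _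
      _ ≤ C * (β⁻¹) ^ n * ‖w‖ := mul_le_mul_of_nonneg_right hb' (norm_nonneg _)

theorem spectral_lemma [CompleteSpace B] (M : B →L[ℂ] B) (hM : IsCompactOperator M)
    (β₀ : ℝ) (hβ : 0 < β₀) :
    ∃ V : Submodule ℂ B, FiniteDimensional ℂ V ∧ (∀ x ∈ V, M x ∈ V) ∧
      ∃ α β C : ℝ, 0 < α ∧ α < β ∧ β < β₀ ∧ 0 < C ∧
      (∀ (n : ℕ) (u : B), ∃ v ∈ V, ‖(M ^ n) u - v‖ ≤ C * α ^ n * ‖u‖) ∧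
      (∀ (n : ℕ), ∀ u ∈ V, ∃ v ∈ V, (M ^ n) v = u ∧ ‖v‖ ≤ C * (β⁻¹) ^ n * ‖u‖) := by
  obtain ⟨V, ⟨hfin, hinv, heig⟩, hmax⟩ := spec_maximal M hM β₀ hβ
  obtain ⟨α, C1, hα0, hαβ, hC1, h1⟩ := spec_quot M hM β₀ hβ V hfin hinv hmax
  obtain ⟨β, hαβ1, hββ⟩ := exists_between hαβ
  have hβ0 : 0 < β := hα0.trans hαβ1
  obtain ⟨C2, hC2, h2⟩ := spec_restr M β₀ β hβ hβ0 hββ V hfin hinv heig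
  refine ⟨V, hfin, hinv, α, β, max C1 C2, hα0, hαβ1, hββ, by positivity, ?_, ?_⟩
  · intro n w
    obtain ⟨v, hv, h⟩ := h1 n w
    exact ⟨v, hv, h.trans (by gcongr; exact le_max_left _ _)⟩
  · intro n w hw
    obtain ⟨v, hv, h, h'⟩ := h2 n w hw
    exact ⟨v, hv, h, h'.trans (by gcongr; exact le_max_right _ _)⟩
end spectral
end CarnotHomeo

set_option linter.all false
set_option linter.deprecated false
namespace CarnotHomeo
open Filter Topology Set BoundedContinuousFunction

theorem compact_criterion {X : Type*} [TopologicalSpace X]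
    (T : (X →ᵇ ℂ) →L[ℂ] (X →ᵇ ℂ))
    (h1 : ∀ x : X, ∀ ε > 0, ∃ U ∈ 𝓝 x, ∀ x' ∈ U, ∀ b : X →ᵇ ℂ, ‖T b x' - T b x‖ ≤ ε * ‖b‖)
    (h2 : ∀ ε > 0, ∃ K : Set X, IsCompact K ∧ ∀ x ∉ K, ∀ b : X →ᵇ ℂ, ‖T b x‖ ≤ ε * ‖b‖) :
    IsCompactOperator T := by
  refine (isCompactOperator_iff_isCompact_closure_image_closedBall
    (T : (X →ᵇ ℂ) →ₗ[ℂ] (X →ᵇ ℂ)) one_pos).2 ?_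
  refine isCompact_iff_totallyBounded_isComplete.2 ⟨TotallyBounded.closure ?_, isClosed_closure.isComplete⟩
  apply Metric.totallyBounded_of_finite_discretization
  intro ε hε
  obtain ⟨K, hK, hK2⟩ := h2 (ε / 8) (by positivity)
  choose U hU hU2 using fun x => h1 x (ε / 8) (by positivity)
  obtain ⟨t, -, ht⟩ := hK.elim_nhds_subcover U (fun x _ => hU x)
  have htb : TotallyBounded (Metric.closedBall (0 : t → ℂ) ‖T‖) :=
    (isCompact_closedBall _ _).totallyBounded
  obtain ⟨N, hN, hNc⟩ := Metric.totallyBounded_iff.1 htb (ε / 8) (by positivity)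
  have hF : ∀ y : (⇑(T : (X →ᵇ ℂ) →ₗ[ℂ] (X →ᵇ ℂ)) '' Metric.closedBall 0 1 : Set _),
      ∃ z : N, dist (fun i : t => y.1 i) z.1 < ε / 8 := by
    rintro ⟨_, b, hb, rfl⟩
    have : (fun i : t => T b i) ∈ Metric.closedBall (0 : t → ℂ) ‖T‖ := by
      rw [mem_closedBall_zero_iff, pi_norm_le_iff_of_nonneg (norm_nonneg _)]
      intro i
      have h3 := (T b).norm_coe_le_norm i
      have h4 := T.le_opNorm b
      have h5 : ‖b‖ ≤ 1 := by simpa using hb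
      have := norm_nonneg T
      nlinarith
    have := hNc this
    simp only [mem_iUnion] at this
    obtain ⟨z, hz, hz2⟩ := this
    exact ⟨⟨z, hz⟩, hz2⟩
  choose F hF using hF
  refine ⟨N, hN.fintype, F, ?_⟩
  rintro ⟨_, b, hb, rfl⟩ ⟨_, b', hb', rfl⟩ heq
  have e1 := hF ⟨_, b, hb, rfl⟩
  have e2 := hF ⟨_, b', hb', rfl⟩
  rw [← heq] at e2
  have hb1 : ‖b‖ ≤ 1 := by simpa using hb
  have hb2 : ‖b'‖ ≤ 1 := by simpa using hb'
  have e3 := dist_triangle_right (fun i : t => T b i) (fun i : t => T b' i) (F ⟨_, b, hb, rfl⟩).1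
  have e4 : dist (fun i : t => T b i) (fun i : t => T b' i) ≤ ε / 4 := by
    refine e3.trans ?_
    have : dist (fun i : t => T b i) (F ⟨_, b, hb, rfl⟩).1 < ε / 8 := e1
    have : dist (fun i : t => T b' i) (F ⟨_, b, hb, rfl⟩).1 < ε / 8 := e2
    linarith
  have e5 : ∀ i : t, ‖T b i - T b' i‖ ≤ ε / 4 := fun i => by
    rw [← dist_eq_norm]; exact (dist_le_pi_dist _ _ i).trans e4
  have key : dist (T b) (T b') ≤ ε / 2 := by
    rw [BoundedContinuousFunction.dist_le (by positivity)]
    intro x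
    rw [dist_eq_norm]
    have hm1 : ε / 8 * ‖b‖ ≤ ε / 8 := by nlinarith
    have hm2 : ε / 8 * ‖b'‖ ≤ ε / 8 := by nlinarith
    by_cases hx : x ∈ K
    · have := ht hx
      simp only [mem_iUnion] at this
      obtain ⟨i, hi, hxi⟩ := this
      have a1 := hU2 i x hxi b
      have a2 := hU2 i x hxi b'
      have a3 := e5 ⟨i, hi⟩
      calc ‖T b x - T b' x‖ = ‖(T b x - T b i) + (T b i - T b' i) - (T b' x - T b' i)‖ := by
            congr 1; ring
        _ ≤ ‖T b x - T b i‖ + ‖T b i - T b' i‖ + ‖T b' x - T b' i‖ :=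
            (norm_sub_le _ _).trans (by gcongr; exact norm_add_le _ _)
        _ ≤ ε / 2 := by simp only at a3; linarith
    · have a1 := hK2 x hx b
      have a2 := hK2 x hx b'
      calc ‖T b x - T b' x‖ ≤ ‖T b x‖ + ‖T b' x‖ := norm_sub_le _ _
        _ ≤ ε / 2 := by linarith
  show dist (T b) (T b') < ε
  linarith
end CarnotHomeo

set_option linter.all false
set_option linter.deprecated false
namespace CarnotHomeo
open Filter Topology Set Metric

/-- the working context: base point, contraction fixing it, transitivity -/
structure Ctx (X : Type*) [MetricSpace X] where
  o : X
  lam : ℝ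
  hlam : 1 < lam
  σ : X ≃ₜ X
  hσ : ∀ x y, dist (σ x) (σ y) = lam⁻¹ * dist x y
  hσo : σ o = o
  tr : ∀ p q : X, ∃ g : X ≃ᵢ X, g p = q

variable {X : Type*} [MetricSpace X]

namespace Ctx
variable (c : Ctx X)

theorem lam_pos : 0 < c.lam := one_pos.trans c.hlam

theorem hσs (x y : X) : dist (c.σ.symm x) (c.σ.symm y) = c.lam * dist x y := by
  have := c.hσ (c.σ.symm x) (c.σ.symm y)
  rw [c.σ.apply_symm_apply, c.σ.apply_symm_apply] at this
  rw [this, ← mul_assoc, mul_inv_cancel₀ c.lam_pos.ne', one_mul]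

theorem hσso : c.σ.symm c.o = c.o := by
  rw [Homeomorph.symm_apply_eq, c.hσo]

theorem dist_iter (n : ℕ) (x y : X) : dist (c.σ^[n] x) (c.σ^[n] y) = (c.lam⁻¹) ^ n * dist x y := by
  induction n generalizing x y with
  | zero => simp
  | succ n ih => rw [Function.iterate_succ_apply, Function.iterate_succ_apply, ih, c.hσ]; ring

theorem iter_o (n : ℕ) : c.σ^[n] c.o = c.o := Function.iterate_fixed c.hσo n

theorem iter_o' (n : ℕ) : c.σ.symm^[n] c.o = c.o := Function.iterate_fixed c.hσso n

theorem dist_iter_o (n : ℕ) (x : X) : dist (c.σ^[n] x) c.o = (c.lam⁻¹) ^ n * dist x c.o := by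
  conv_lhs => rw [← c.iter_o n]
  exact c.dist_iter n x c.o

theorem iter_symm (n : ℕ) (x : X) : c.σ^[n] (c.σ.symm^[n] x) = x :=
  (Function.LeftInverse.iterate (fun x => c.σ.apply_symm_apply x) n) x

theorem iter_symm' (n : ℕ) (x : X) : c.σ.symm^[n] (c.σ^[n] x) = x :=
  (Function.LeftInverse.iterate (fun x => c.σ.symm_apply_apply x) n) x

theorem iter_cont (n : ℕ) : Continuous (c.σ^[n]) := c.σ.continuous.iterate n

theorem tendsto_lam : Tendsto (fun n : ℕ => (c.lam⁻¹) ^ n) atTop (𝓝 0) :=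
  tendsto_pow_atTop_nhds_zero_of_lt_one (inv_nonneg.2 c.lam_pos.le) (inv_lt_one_of_one_lt₀ c.hlam)

theorem tendsto_iter (x : X) : Tendsto (fun n : ℕ => c.σ^[n] x) atTop (𝓝 c.o) := by
  rw [tendsto_iff_dist_tendsto_zero]
  simp_rw [c.dist_iter_o]
  simpa using c.tendsto_lam.mul_const (dist x c.o)

/-- conjugation `σ g σ⁻¹` -/
noncomputable def th (g : X ≃ᵢ X) : X ≃ᵢ X :=
  IsometryEquiv.mk' (fun x => c.σ (g (c.σ.symm x))) (fun x => c.σ (g.symm (c.σ.symm x)))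
    (fun x => by simp) (Isometry.of_dist_eq fun x y => by
      rw [c.hσ, g.dist_eq, c.hσs, ← mul_assoc, inv_mul_cancel₀ c.lam_pos.ne', one_mul])

noncomputable def ti (g : X ≃ᵢ X) : X ≃ᵢ X :=
  IsometryEquiv.mk' (fun x => c.σ.symm (g (c.σ x))) (fun x => c.σ.symm (g.symm (c.σ x)))
    (fun x => by simp) (Isometry.of_dist_eq fun x y => by
      rw [c.hσs, g.dist_eq, c.hσ, ← mul_assoc, mul_inv_cancel₀ c.lam_pos.ne', one_mul])

theorem th_apply (g : X ≃ᵢ X) (x : X) : c.th g x = c.σ (g (c.σ.symm x)) := rfl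
theorem ti_apply (g : X ≃ᵢ X) (x : X) : c.ti g x = c.σ.symm (g (c.σ x)) := rfl

theorem th_σ (g : X ≃ᵢ X) (x : X) : c.th g (c.σ x) = c.σ (g x) := by simp [th_apply]
theorem σ_ti (g : X ≃ᵢ X) (x : X) : c.σ (c.ti g x) = g (c.σ x) := by simp [ti_apply]

theorem th_ti (g : X ≃ᵢ X) : c.th (c.ti g) = g := by ext x; simp [th_apply, ti_apply]
theorem ti_th (g : X ≃ᵢ X) : c.ti (c.th g) = g := by ext x; simp [th_apply, ti_apply]

theorem th_o (g : X ≃ᵢ X) : dist (c.th g c.o) c.o = c.lam⁻¹ * dist (g c.o) c.o := by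
  conv_lhs => rw [← c.hσo, c.th_σ, c.hσ]
  
theorem th_iter_o (n : ℕ) (g : X ≃ᵢ X) :
    dist ((c.th)^[n] g c.o) c.o = (c.lam⁻¹) ^ n * dist (g c.o) c.o := by
  induction n generalizing g with
  | zero => simp
  | succ n ih => rw [Function.iterate_succ_apply, ih, c.th_o]; ring

theorem th_iter_σ (n : ℕ) (g : X ≃ᵢ X) (x : X) : (c.th)^[n] g (c.σ^[n] x) = c.σ^[n] (g x) := by
  induction n generalizing g x with
  | zero => simp
  | succ n ih => rw [Function.iterate_succ_apply, Function.iterate_succ_apply, ih, c.th_σ,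
      Function.iterate_succ_apply]

/-- compactness of isometries -/
theorem lim [ProperSpace X] {ι : Type*} (U : Ultrafilter ι) (g : ι → X ≃ᵢ X) (r : ℝ)
    (h : ∀ᶠ i in (U : Filter ι), dist (g i c.o) c.o ≤ r) :
    ∃ G : X ≃ᵢ X, (∀ y, Tendsto (fun i => g i y) U (𝓝 (G y))) ∧
      ∀ R κ : ℝ, 0 < κ → ∀ᶠ i in (U : Filter ι), ∀ y ∈ closedBall c.o R, dist (g i y) (G y) < κ := by
  have key : ∀ g : ι → X ≃ᵢ X, (∀ᶠ i in (U : Filter ι), dist (g i c.o) c.o ≤ r) →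
      ∀ y, ∃ z, Tendsto (fun i => g i y) U (𝓝 z) := by
    intro g h y
    have h1 : ∀ᶠ i in (U : Filter ι), g i y ∈ closedBall c.o (dist y c.o + r) := by
      filter_upwards [h] with i hi
      rw [mem_closedBall]
      calc dist (g i y) c.o ≤ dist (g i y) (g i c.o) + dist (g i c.o) c.o := dist_triangle _ _ _
        _ ≤ _ := by rw [(g i).dist_eq]; gcongr
    obtain ⟨z, -, hz⟩ := (isCompact_closedBall c.o (dist y c.o + r)).ultrafilter_le_nhds
      (U.map fun i => g i y) (by rw [le_principal_iff]; exact h1)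
    exact ⟨z, hz⟩
  choose G hG using key g h
  choose H hH using key (fun i => (g i).symm) (by
    filter_upwards [h] with i hi
    rw [← (g i).dist_eq, (g i).apply_symm_apply, dist_comm]; exact hi)
  have iso : Isometry G := Isometry.of_dist_eq fun x y => by
    refine tendsto_nhds_unique ((hG x).dist (hG y)) ?_
    simp_rw [(g _).dist_eq]
    exact tendsto_const_nhds
  have hGH : ∀ y, G (H y) = y := fun y => by
    refine tendsto_nhds_unique (hG (H y)) ?_
    rw [tendsto_iff_dist_tendsto_zero]
    have h2 := tendsto_iff_dist_tendsto_zero.1 (hH y)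
    refine h2.congr fun i => ?_
    rw [← (g i).dist_eq, (g i).apply_symm_apply, dist_comm]
  refine ⟨IsometryEquiv.mk' G H hGH iso, hG, fun R κ hκ => ?_⟩
  obtain ⟨t, htf, ht⟩ := Metric.totallyBounded_iff.1 (isCompact_closedBall c.o R).totallyBounded
    (κ / 3) (by positivity)
  have h3 : ∀ᶠ i in (U : Filter ι), ∀ y ∈ t, dist (g i y) (G y) < κ / 3 :=
    (eventually_all_finite htf).2 fun y _ => (hG y).eventually (Metric.ball_mem_nhds _ (by positivity))
  filter_upwards [h3] with i hi y hy
  have := ht hy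
  simp only [mem_iUnion, mem_ball] at this
  obtain ⟨z, hz, hyz⟩ := this
  have e := hi z hz
  show dist (g i y) (G y) < κ
  calc dist (g i y) (G y) ≤ dist (g i y) (g i z) + dist (g i z) (G z) + dist (G z) (G y) :=
        dist_triangle4 _ _ _ _
    _ = dist y z + dist (g i z) (G z) + dist y z := by
        rw [(g i).dist_eq, iso.dist_eq, dist_comm z y]
    _ < κ := by linarith

theorem om [ProperSpace X] (R κ : ℝ) (hκ : 0 < κ) : ∀ᶠ x in 𝓝 c.o, ∃ u : X ≃ᵢ X, u c.o = x ∧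
    ∀ z ∈ closedBall c.o R, dist (u z) z < κ := by
  by_contra hcon
  rw [not_eventually] at hcon
  obtain ⟨U, hU⟩ := Ultrafilter.exists_le (f := 𝓝 c.o ⊓ 𝓟 {x | ¬ ∃ u : X ≃ᵢ X, u c.o = x ∧
    ∀ z ∈ closedBall c.o R, dist (u z) z < κ}) (h := frequently_mem_iff_neBot.1 hcon)
  have hU1 : (U : Filter X) ≤ 𝓝 c.o := hU.trans inf_le_left
  have hU2 := le_principal_iff.1 (hU.trans inf_le_right)
  choose g hg using c.tr c.o
  obtain ⟨G, hG, hunif⟩ := c.lim U g 1 (by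
    have : ∀ᶠ x in 𝓝 c.o, dist x c.o ≤ 1 := closedBall_mem_nhds _ one_pos
    filter_upwards [hU1 this] with x hx
    rw [hg]; exact hx)
  have hGo : G c.o = c.o := by
    refine tendsto_nhds_unique (hG c.o) ?_
    simp_rw [hg]
    exact hU1
  obtain ⟨x, hx1, hx2⟩ := ((hunif R κ hκ).and hU2).exists
  refine hx2 ⟨g x * G⁻¹, ?_, fun z hz => ?_⟩
  · have : G⁻¹ c.o = c.o := by
      conv_lhs => rw [← hGo]
      exact G.symm_apply_apply c.o
    rw [IsometryEquiv.mul_apply, this, hg]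
  · have h1 := hx1 (G⁻¹ z) (by
      rw [mem_closedBall, ← G.dist_eq, hGo]
      have : G (G⁻¹ z) = z := G.apply_symm_apply z
      rw [this]; exact hz)
    have : G (G⁻¹ z) = z := G.apply_symm_apply z
    rwa [this] at h1

theorem om' [ProperSpace X] (R κ : ℝ) (hκ : 0 < κ) : ∃ ρ > 0, ∀ x, dist x c.o < ρ →
    ∃ u : X ≃ᵢ X, u c.o = x ∧ ∀ z ∈ closedBall c.o R, dist (u z) z < κ := by
  obtain ⟨ρ, h, h'⟩ := Metric.eventually_nhds_iff.1 (c.om R κ hκ)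
  exact ⟨ρ, h, fun x hx => h' hx⟩

end Ctx

theorem proper_of (X : Type*) [MetricSpace X] [Nonempty X] [LocallyCompactSpace X]
    (hhom : ∀ p q : X, ∃ g : X ≃ᵢ X, g p = q)
    (lam : ℝ) (hlam : 1 < lam) (f : X ≃ₜ X) (hf : ∀ p q : X, dist (f p) (f q) = lam * dist p q) :
    ProperSpace X := by
  obtain ⟨p⟩ := ‹Nonempty X›
  obtain ⟨K, hK, hKp⟩ := exists_compact_mem_nhds p
  obtain ⟨ε, hε, hεK⟩ := (Metric.nhds_basis_closedBall (x := p)).mem_iff.1 hKp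
  have h1 : ∀ x : X, IsCompact (closedBall (x : X) ε) := by
    intro x
    obtain ⟨g, rfl⟩ := hhom p x
    rw [← g.image_closedBall]
    exact (hK.of_isClosed_subset isClosed_closedBall hεK).image g.continuous
  have h2 : ∀ n : ℕ, ∀ x : X, IsCompact (closedBall x (lam ^ n * ε)) := by
    intro n
    induction n with
    | zero => simpa using h1
    | succ n ih =>
      intro x
      refine ((ih (f.symm x)).image f.continuous).of_isClosed_subset isClosed_closedBall ?_
      intro y hy
      refine ⟨f.symm y, ?_, f.apply_symm_apply y⟩
      rw [mem_closedBall] at *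
      have := hf (f.symm y) (f.symm x)
      rw [f.apply_symm_apply, f.apply_symm_apply] at this
      rw [this, pow_succ', mul_assoc] at hy
      exact le_of_mul_le_mul_left hy (by linarith)
  refine ⟨fun x r => ?_⟩
  obtain ⟨n, hn⟩ := pow_unbounded_of_one_lt (r / ε) hlam
  refine (h2 n x).of_isClosed_subset isClosed_closedBall (closedBall_subset_closedBall ?_)
  rw [div_lt_iff₀ hε] at hn
  exact hn.le

theorem exists_ctx (X : Type*) [MetricSpace X] [Nonempty X] [CompleteSpace X]
    (hhom : ∀ p q : X, ∃ g : X ≃ᵢ X, g p = q)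
    (lam : ℝ) (hlam : 1 < lam) (f : X ≃ₜ X) (hf : ∀ p q : X, dist (f p) (f q) = lam * dist p q) :
    Nonempty (Ctx X) := by
  have h0 : 0 < lam := by linarith
  have hs : ∀ x y, dist (f.symm x) (f.symm y) = lam⁻¹ * dist x y := by
    intro x y
    have := hf (f.symm x) (f.symm y)
    rw [f.apply_symm_apply, f.apply_symm_apply] at this
    rw [this, ← mul_assoc, inv_mul_cancel₀ h0.ne', one_mul]
  have hc : ContractingWith (lam⁻¹).toNNReal f.symm := by
    refine ⟨?_, LipschitzWith.of_dist_le_mul fun x y => ?_⟩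
    · rw [Real.toNNReal_lt_one]; exact inv_lt_one_of_one_lt₀ hlam
    · rw [hs, Real.coe_toNNReal _ (inv_nonneg.2 h0.le)]
  exact ⟨⟨ContractingWith.fixedPoint f.symm hc, lam, hlam, f.symm, hs, hc.fixedPoint_isFixedPt, hhom⟩⟩
end CarnotHomeo

set_option linter.all false
set_option linter.deprecated false
namespace CarnotHomeo
open Filter Topology Set Metric MeasureTheory TopologicalSpace
open scoped NNReal ENNReal

variable {X : Type*} [MetricSpace X]

/-- covering number by balls of radius `r` -/
noncomputable def covNum (K : Set X) (r : ℝ) : ℕ :=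
  sInf {n | ∃ t : Finset X, t.card = n ∧ K ⊆ ⋃ x ∈ t, ball x r}

theorem covNum_spec {K : Set X} (hK : IsCompact K) {r : ℝ} (hr : 0 < r) :
    ∃ t : Finset X, t.card = covNum K r ∧ K ⊆ ⋃ x ∈ t, ball x r := by
  apply Nat.sInf_mem (s := {n | ∃ t : Finset X, t.card = n ∧ K ⊆ ⋃ x ∈ t, ball x r})
  obtain ⟨t, -, ht⟩ := hK.elim_nhds_subcover (fun x => ball x r) (fun x _ => ball_mem_nhds x hr)
  exact ⟨_, t, rfl, ht⟩

theorem covNum_le {K : Set X} {r : ℝ} (t : Finset X) (ht : K ⊆ ⋃ x ∈ t, ball x r) :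
    covNum K r ≤ t.card := Nat.sInf_le ⟨t, rfl, ht⟩

theorem covNum_mono {K L : Set X} (hL : IsCompact L) (h : K ⊆ L) {r : ℝ} (hr : 0 < r) :
    covNum K r ≤ covNum L r := by
  obtain ⟨t, ht, ht'⟩ := covNum_spec hL hr
  rw [← ht]; exact covNum_le t (h.trans ht')

open Classical in
theorem covNum_union {K L : Set X} (hK : IsCompact K) (hL : IsCompact L) {r : ℝ} (hr : 0 < r) :
    covNum (K ∪ L) r ≤ covNum K r + covNum L r := by
  obtain ⟨t, ht, ht'⟩ := covNum_spec hK hr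
  obtain ⟨s, hs, hs'⟩ := covNum_spec hL hr
  rw [← ht, ← hs]
  refine (covNum_le (t ∪ s) ?_).trans (Finset.card_union_le _ _)
  rw [Finset.set_biUnion_union]
  exact union_subset_union ht' hs'

open Classical in
theorem covNum_disj {K L : Set X} (hK : IsCompact K) (hL : IsCompact L) {r : ℝ} (hr : 0 < r)
    (hd : ∀ x ∈ K, ∀ y ∈ L, 2 * r ≤ dist x y) :
    covNum K r + covNum L r ≤ covNum (K ∪ L) r := by
  obtain ⟨t, ht, ht'⟩ := covNum_spec (hK.union hL) hr
  rw [← ht]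
  have h1 := covNum_le (K := K) (r := r) (t.filter fun x => (ball x r ∩ K).Nonempty) (by
    intro y hy
    have := ht' (Or.inl hy)
    simp only [mem_iUnion] at this ⊢
    obtain ⟨x, hx, hyx⟩ := this
    exact ⟨x, Finset.mem_filter.2 ⟨hx, y, hyx, hy⟩, hyx⟩)
  have h2 := covNum_le (K := L) (r := r) (t.filter fun x => ¬ (ball x r ∩ K).Nonempty) (by
    intro y hy
    have := ht' (Or.inr hy)
    simp only [mem_iUnion] at this ⊢
    obtain ⟨x, hx, hyx⟩ := this
    refine ⟨x, Finset.mem_filter.2 ⟨hx, ?_⟩, hyx⟩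
    rintro ⟨z, hz, hzK⟩
    have := hd z hzK y hy
    rw [mem_ball] at hz hyx
    have := dist_triangle_right z y x
    linarith)
  rw [← Finset.card_filter_add_card_filter_not (s := t) (fun x => (ball x r ∩ K).Nonempty)]
  exact add_le_add h1 h2

open Classical in
theorem covNum_image {K : Set X} (hK : IsCompact K) {r : ℝ} (hr : 0 < r) (g : X ≃ᵢ X) :
    covNum (g '' K) r ≤ covNum K r := by
  obtain ⟨t, ht, ht'⟩ := covNum_spec hK hr
  rw [← ht]
  refine (covNum_le (t.image g) ?_).trans Finset.card_image_le
  rintro _ ⟨y, hy, rfl⟩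
  have := ht' hy
  simp only [mem_iUnion] at this ⊢
  obtain ⟨x, hx, hyx⟩ := this
  exact ⟨g x, Finset.mem_image_of_mem _ hx, by rw [mem_ball, g.dist_eq]; exact hyx⟩

theorem covNum_image_eq {K : Set X} (hK : IsCompact K) {r : ℝ} (hr : 0 < r) (g : X ≃ᵢ X) :
    covNum (g '' K) r = covNum K r := by
  refine le_antisymm (covNum_image hK hr g) ?_
  have := covNum_image (hK.image g.continuous) hr g.symm
  rwa [← image_comp, show (g.symm ∘ g : X → X) = id from by ext; simp, image_id] at this

namespace Ctx
variable (c : Ctx X) [ProperSpace X]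

theorem covNum_pos {r : ℝ} (hr : 0 < r) : 0 < covNum (closedBall c.o 1) r := by
  obtain ⟨t, ht, ht'⟩ := covNum_spec (isCompact_closedBall c.o 1) hr
  rw [← ht, Finset.card_pos]
  have := ht' (mem_closedBall_self zero_le_one)
  simp only [mem_iUnion] at this
  obtain ⟨x, hx, _⟩ := this
  exact ⟨x, hx⟩

theorem covNum_bound {K : Set X} (hK : IsCompact K) : ∃ N : ℕ, ∀ r > 0,
    covNum K r ≤ N * covNum (closedBall c.o 1) r := by
  classical
  obtain ⟨t, -, ht⟩ := hK.elim_nhds_subcover (fun x => closedBall x 1)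
    (fun x _ => closedBall_mem_nhds x one_pos)
  refine ⟨t.card, fun r hr => ?_⟩
  have key : ∀ t : Finset X, covNum (⋃ x ∈ t, closedBall x 1) r ≤ t.card * covNum (closedBall c.o 1) r := by
    intro t
    induction t using Finset.induction_on with
    | empty => simpa using covNum_le (K := (∅ : Set X)) (r := r) ∅ (by simp)
    | insert a s ha ih =>
      rw [Finset.set_biUnion_insert, Finset.card_insert_of_notMem ha]
      refine (covNum_union (isCompact_closedBall a 1)
        (s.isCompact_biUnion fun x _ => isCompact_closedBall x 1) hr).trans ?_
      obtain ⟨g, rfl⟩ := c.tr c.o a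
      have : covNum (closedBall (g c.o) 1) r = covNum (closedBall c.o 1) r := by
        rw [← g.image_closedBall, covNum_image_eq (isCompact_closedBall _ _) hr]
      rw [this]
      linarith
  exact (covNum_mono (t.isCompact_biUnion fun x _ => isCompact_closedBall x 1) ht hr).trans (key t)

noncomputable def ratio (K : Set X) (r : ℝ) : ℝ≥0 :=
  (covNum K r : ℝ≥0) / covNum (closedBall c.o 1) r

noncomputable def uf : Ultrafilter ℝ := Ultrafilter.of (𝓝[>] (0 : ℝ))

theorem uf_pos : ∀ᶠ r in (uf : Filter ℝ), 0 < r :=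
  Ultrafilter.of_le (𝓝[>] (0 : ℝ)) self_mem_nhdsWithin

theorem uf_lt {ε : ℝ} (hε : 0 < ε) : ∀ᶠ r in (uf : Filter ℝ), r < ε :=
  Ultrafilter.of_le (𝓝[>] (0 : ℝ)) (mem_nhdsWithin_of_mem_nhds (Iio_mem_nhds hε))

theorem exists_lim (K : Compacts X) : ∃ a : ℝ≥0, Tendsto (c.ratio K) uf (𝓝 a) := by
  obtain ⟨N, hN⟩ := c.covNum_bound K.isCompact
  obtain ⟨z, -, hz⟩ := (isCompact_Icc (a := (0 : ℝ≥0)) (b := N)).ultrafilter_le_nhds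
      (uf.map (c.ratio K)) (by
        rw [le_principal_iff]
        show ∀ᶠ r in (uf : Filter ℝ), c.ratio K r ∈ Icc (0 : ℝ≥0) N
        filter_upwards [uf_pos] with r hr
        refine ⟨zero_le, ?_⟩
        have : (0 : ℝ≥0) < covNum (closedBall c.o 1) r := by exact_mod_cast c.covNum_pos hr
        rw [ratio, div_le_iff₀ this]
        exact_mod_cast hN r hr)
  exact ⟨z, hz⟩

noncomputable def hh (K : Compacts X) : ℝ≥0 := (c.exists_lim K).choose

theorem hh_spec (K : Compacts X) : Tendsto (c.ratio K) uf (𝓝 (c.hh K)) := (c.exists_lim K).choose_spec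

noncomputable def content : Content X where
  toFun := c.hh
  mono' K L h := by
    refine le_of_tendsto_of_tendsto (c.hh_spec K) (c.hh_spec L) ?_
    filter_upwards [uf_pos] with r hr
    unfold ratio
    gcongr
    exact covNum_mono L.isCompact h hr
  sup_disjoint' K L hd _ _ := by
    refine tendsto_nhds_unique (c.hh_spec (K ⊔ L)) ?_
    refine ((c.hh_spec K).add (c.hh_spec L)).congr' ?_
    obtain ⟨ε, hε, h⟩ : ∃ ε > 0, ∀ x ∈ (K : Set X), ∀ y ∈ (L : Set X), ε ≤ dist x y := by
      rcases (K : Set X).eq_empty_or_nonempty with h0 | h0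
      · exact ⟨1, one_pos, by simp [h0]⟩
      obtain ⟨δ, hδ, h⟩ := hd.exists_cthickenings K.isCompact L.isCompact.isClosed
      refine ⟨δ, hδ, fun x hx y hy => ?_⟩
      by_contra! hlt
      refine disjoint_left.1 h (mem_cthickening_of_dist_le y x δ _ hx (by rw [dist_comm]; exact hlt.le))
        (self_subset_cthickening _ hy)
    filter_upwards [uf_pos, uf_lt (show 0 < ε / 2 by positivity)] with r hr hr2
    unfold ratio
    rw [← add_div, Compacts.coe_sup]
    congr 1
    have := le_antisymm (covNum_disj K.isCompact L.isCompact hr (fun x hx y hy => by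
      have := h x hx y hy; linarith)) (covNum_union K.isCompact L.isCompact hr)
    exact_mod_cast this
  sup_le' K L := by
    refine le_of_tendsto_of_tendsto (c.hh_spec (K ⊔ L)) ((c.hh_spec K).add (c.hh_spec L)) ?_
    filter_upwards [uf_pos] with r hr
    unfold ratio
    rw [← add_div, Compacts.coe_sup]
    gcongr
    exact_mod_cast covNum_union K.isCompact L.isCompact hr

theorem exists_measure (c : Ctx X) [MeasurableSpace X] [BorelSpace X] : ∃ μ : Measure X,
    IsFiniteMeasureOnCompacts μ ∧ (∀ g : X ≃ᵢ X, MeasurePreserving g μ μ) ∧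
    ∀ (x : X) (r : ℝ), 0 < r → 0 < μ (ball x r) := by
  have hinv : ∀ g : X ≃ᵢ X, MeasurePreserving g c.content.measure c.content.measure := by
    intro g
    refine ⟨g.continuous.measurable, ?_⟩
    ext s hs
    rw [Measure.map_apply g.continuous.measurable hs, c.content.measure_apply hs,
      c.content.measure_apply (g.continuous.measurable hs)]
    refine c.content.outerMeasure_preimage g.toHomeomorph ?_ s
    intro K
    have : c.hh (K.map g.toHomeomorph g.toHomeomorph.continuous) = c.hh K := by
      refine tendsto_nhds_unique (c.hh_spec _) ((c.hh_spec K).congr' ?_)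
      filter_upwards [uf_pos] with r hr
      unfold ratio
      congr 2
      exact (covNum_image_eq K.isCompact hr g).symm
    exact congrArg ENNReal.ofNNReal this
  refine ⟨c.content.measure, ⟨fun K hK => ?_⟩, hinv, fun x r hr => ?_⟩
  · rw [c.content.measure_apply hK.measurableSet]
    exact c.content.outerMeasure_lt_top_of_isCompact hK
  · rw [pos_iff_ne_zero]
    intro h0
    have h1 : ∀ y, c.content.measure (ball y r) = 0 := by
      intro y
      obtain ⟨g, rfl⟩ := c.tr y x
      rw [← (hinv g).measure_preimage measurableSet_ball.nullMeasurableSet, g.preimage_ball,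
        g.symm_apply_apply] at h0
      exact h0
    obtain ⟨t, -, ht⟩ := (isCompact_closedBall c.o 1).elim_nhds_subcover (fun x => ball x r)
      (fun x _ => ball_mem_nhds x hr)
    have h2 : c.content.measure (closedBall c.o 1) = 0 := by
      refine measure_mono_null ht ?_
      exact (measure_biUnion_null_iff t.countable_toSet).2 fun y _ => h1 y
    have h3 : (1 : ℝ≥0∞) ≤ c.content.measure (closedBall c.o 1) := by
      rw [c.content.measure_apply measurableSet_closedBall]
      refine le_trans ?_ (c.content.le_outerMeasure_compacts ⟨closedBall c.o 1, isCompact_closedBall _ _⟩)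
      have : c.hh ⟨closedBall c.o 1, isCompact_closedBall _ _⟩ = 1 := by
        refine tendsto_nhds_unique (c.hh_spec _) (tendsto_const_nhds.congr' ?_)
        filter_upwards [uf_pos] with r hr
        unfold ratio
        have : (covNum (closedBall c.o 1) r : ℝ≥0) ≠ 0 := by exact_mod_cast (c.covNum_pos hr).ne'
        exact (div_self this).symm
      have h4 : c.content ⟨closedBall c.o 1, isCompact_closedBall _ _⟩ = ENNReal.ofNNReal 1 :=
        congrArg ENNReal.ofNNReal this
      rw [h4]; simp
    rw [h2] at h3
    simp at h3
end Ctx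
end CarnotHomeo

set_option linter.all false
set_option linter.deprecated false
namespace CarnotHomeo
open Filter Topology Set Metric MeasureTheory TopologicalSpace

variable {X : Type*} [MetricSpace X]

noncomputable def kk (x y : X) : ℝ := max 0 (1 - dist x y)

theorem kk_nonneg (x y : X) : 0 ≤ kk x y := le_max_left _ _
theorem kk_cont (x : X) : Continuous (kk x) := by unfold kk; fun_prop
theorem kk_zero {x y : X} (h : 1 ≤ dist x y) : kk x y = 0 := max_eq_left (by linarith)
theorem kk_lip (x x' y : X) : |kk x y - kk x' y| ≤ dist x x' := by
  unfold kk
  have h := abs_max_sub_max_le_abs (1 - dist x y) (1 - dist x' y) 0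
  rw [max_comm, max_comm 0]
  refine h.trans ?_
  rw [show 1 - dist x y - (1 - dist x' y) = dist x' y - dist x y by ring, dist_comm x x']
  exact abs_dist_sub_le _ _ _
theorem kk_iso (g : X ≃ᵢ X) (x y : X) : kk (g x) (g y) = kk x y := by
  unfold kk; rw [g.dist_eq]

theorem Ctx.exists_P (c : Ctx X) [ProperSpace X] : ∃ P : (X → ℂ) → X → ℂ,
    (∀ u v, Continuous u → Continuous v → P (u + v) = P u + P v) ∧
    (∀ (a : ℂ) u, P (a • u) = a • P u) ∧
    (∀ u, Continuous u → ∀ x a, (∀ y ∈ closedBall x 1, ‖u y‖ ≤ a) → ‖P u x‖ ≤ a) ∧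
    (∀ u (g : X ≃ᵢ X), P (u ∘ g) = P u ∘ g) ∧
    (P 1 = 1) ∧
    (∀ x, ∃ E : ℝ, 0 ≤ E ∧ ∀ u, Continuous u → ∀ a, (∀ y ∈ closedBall x 2, ‖u y‖ ≤ a) →
      ∀ x', dist x x' ≤ 1 → ‖P u x - P u x'‖ ≤ E * dist x x' * a) := by
  letI : MeasurableSpace X := borel X
  haveI : BorelSpace X := ⟨rfl⟩
  obtain ⟨μ, hfin, hinv, hpos⟩ := c.exists_measure
  have hcs : ∀ x : X, HasCompactSupport (kk x) := fun x =>
    HasCompactSupport.intro (isCompact_closedBall x 1) fun y hy => kk_zero (by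
      rw [mem_closedBall, dist_comm] at hy; linarith)
  have hintg : ∀ (x : X), Integrable (kk x) μ := fun x =>
    (kk_cont x).integrable_of_hasCompactSupport (hcs x)
  have hintu : ∀ (x : X) (u : X → ℂ), Continuous u → Integrable (fun y => (kk x y : ℂ) * u y) μ := by
    intro x u hu
    refine Continuous.integrable_of_hasCompactSupport
      ((Complex.continuous_ofReal.comp (kk_cont x)).mul hu) ?_
    exact HasCompactSupport.intro (isCompact_closedBall x 1) fun y hy => by
      rw [kk_zero (by rw [mem_closedBall, dist_comm] at hy; linarith)]; simp
  have hch : ∀ (g : X ≃ᵢ X) (F : X → ℂ), ∫ y, F (g y) ∂μ = ∫ y, F y ∂μ := fun g F =>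
    (hinv g).integral_comp g.toHomeomorph.measurableEmbedding F
  have hch' : ∀ (g : X ≃ᵢ X) (F : X → ℝ), ∫ y, F (g y) ∂μ = ∫ y, F y ∂μ := fun g F =>
    (hinv g).integral_comp g.toHomeomorph.measurableEmbedding F
  obtain ⟨A, hA⟩ : ∃ A : ℝ, A = ∫ y, kk c.o y ∂μ := ⟨_, rfl⟩
  have hAx : ∀ x, ∫ y, kk x y ∂μ = A := by
    intro x
    obtain ⟨g, rfl⟩ := c.tr c.o x
    rw [hA, ← hch' g]
    simp_rw [kk_iso]
  have hApos : 0 < A := by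
    rw [hA, integral_pos_iff_support_of_nonneg (fun y => kk_nonneg c.o y) (hintg c.o)]
    refine (hpos c.o 1 one_pos).trans_le (measure_mono ?_)
    intro y hy
    rw [mem_ball, dist_comm] at hy
    have : 0 < kk c.o y := lt_max_of_lt_right (by linarith)
    exact this.ne'
  refine ⟨fun u x => (A : ℂ)⁻¹ * ∫ y, (kk x y : ℂ) * u y ∂μ, ?_, ?_, ?_, ?_, ?_, ?_⟩
  · intro u v hu hv
    ext x
    simp only [Pi.add_apply, mul_add]
    rw [integral_add (hintu x u hu) (hintu x v hv), mul_add]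
  · intro a u
    ext x
    simp only [Pi.smul_apply, smul_eq_mul]
    simp_rw [mul_left_comm _ a]
    rw [integral_const_mul, mul_left_comm]
  · intro u hu x a ha
    rw [norm_mul, norm_inv, Complex.norm_real, Real.norm_of_nonneg hApos.le,
      inv_mul_le_iff₀ hApos, ← hAx x, ← integral_mul_const]
    refine norm_integral_le_of_norm_le ((hintg x).mul_const a) (Eventually.of_forall fun y => ?_)
    rw [norm_mul, Complex.norm_real, Real.norm_of_nonneg (kk_nonneg _ _)]
    by_cases hy : y ∈ closedBall x 1
    · exact mul_le_mul_of_nonneg_left (ha y hy) (kk_nonneg _ _)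
    · rw [kk_zero (by rw [mem_closedBall, dist_comm] at hy; linarith)]; simp
  · intro u g
    ext x
    simp only [Function.comp]
    rw [← hch g (fun y => (kk (g x) y : ℂ) * u y)]
    simp_rw [kk_iso]
  · ext x
    simp only [Pi.one_apply, mul_one]
    rw [integral_complex_ofReal, hAx]
    exact inv_mul_cancel₀ (by exact_mod_cast hApos.ne')
  · intro x
    refine ⟨A⁻¹ * μ.real (closedBall x 2), by positivity, fun u hu a ha x' hx' => ?_⟩
    rw [← mul_sub, ← integral_sub (hintu x u hu) (hintu x' u hu), norm_mul, norm_inv,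
      Complex.norm_real, Real.norm_of_nonneg hApos.le, mul_assoc, mul_assoc]
    refine mul_le_mul_of_nonneg_left ?_ (inv_nonneg.2 hApos.le)
    have ha0 : 0 ≤ a := (norm_nonneg _).trans (ha x (mem_closedBall_self (by norm_num)))
    have hz : ∀ y ∉ closedBall x 2, (kk x y : ℂ) * u y - (kk x' y : ℂ) * u y = 0 := by
      intro y hy
      rw [mem_closedBall, not_le] at hy
      have := dist_triangle y x' x
      rw [dist_comm x' x] at this
      rw [kk_zero (by rw [dist_comm]; linarith), kk_zero (by rw [dist_comm]; linarith)]
      simp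
    rw [← setIntegral_eq_integral_of_forall_compl_eq_zero hz]
    have := norm_setIntegral_le_of_norm_le_const (μ := μ) (s := closedBall x 2)
      (f := fun y => (kk x y : ℂ) * u y - (kk x' y : ℂ) * u y) (C := dist x x' * a)
      (isCompact_closedBall x 2).measure_lt_top (fun y hy => by
        rw [← sub_mul, norm_mul, ← Complex.ofReal_sub, Complex.norm_real, Real.norm_eq_abs]
        exact mul_le_mul (kk_lip _ _ _) (ha y hy) (norm_nonneg _) dist_nonneg)
    linarith
end CarnotHomeo

set_option linter.all false
set_option linter.deprecated false
namespace CarnotHomeo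
open Filter Topology Set Metric BoundedContinuousFunction

variable {X : Type*} [MetricSpace X]

namespace Ctx
variable (c : Ctx X)

noncomputable def W (x : X) : ℝ := Real.exp (dist x c.o)
theorem W_pos (x : X) : 0 < c.W x := Real.exp_pos _
theorem W_o : c.W c.o = 1 := by simp [W]
theorem W_cont : Continuous c.W := by unfold W; fun_prop
theorem one_le_W (x : X) : 1 ≤ c.W x := Real.one_le_exp dist_nonneg
theorem W_ne (x : X) : (c.W x : ℂ) ≠ 0 := by exact_mod_cast (c.W_pos x).ne'

/-- the unweighted function -/
noncomputable def J (b : X →ᵇ ℂ) : X → ℂ := fun x => (c.W x : ℂ) * b x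

theorem J_cont (b : X →ᵇ ℂ) : Continuous (c.J b) :=
  (Complex.continuous_ofReal.comp c.W_cont).mul b.continuous
theorem J_add (a b : X →ᵇ ℂ) : c.J (a + b) = c.J a + c.J b := by ext x; simp [J, mul_add]
theorem J_sub (a b : X →ᵇ ℂ) : c.J (a - b) = c.J a - c.J b := by ext x; simp [J, mul_sub]
theorem J_smul (k : ℂ) (b : X →ᵇ ℂ) : c.J (k • b) = k • c.J b := by
  ext x; simp [J, mul_left_comm]
theorem J_inj {a b : X →ᵇ ℂ} (h : c.J a = c.J b) : a = b := by
  ext x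
  exact mul_left_cancel₀ (c.W_ne x) (congrFun h x)
theorem J_norm (b : X →ᵇ ℂ) (x : X) : ‖c.J b x‖ ≤ c.W x * ‖b‖ := by
  rw [J, norm_mul, Complex.norm_real, Real.norm_of_nonneg (c.W_pos x).le]
  exact mul_le_mul_of_nonneg_left (b.norm_coe_le_norm x) (c.W_pos x).le
theorem J_o (b : X →ᵇ ℂ) : c.J b c.o = b c.o := by simp [J, W_o]
theorem val_eq (b : X →ᵇ ℂ) (x : X) : b x = (c.W x : ℂ)⁻¹ * c.J b x := by
  rw [J, ← mul_assoc, inv_mul_cancel₀ (c.W_ne x), one_mul]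

theorem exists_J (u : X → ℂ) (hu : Continuous u) (C : ℝ) (h : ∀ x, ‖u x‖ ≤ C * c.W x) :
    ∃ b : X →ᵇ ℂ, c.J b = u := by
  refine ⟨BoundedContinuousFunction.ofNormedAddCommGroup (fun x => (c.W x : ℂ)⁻¹ * u x) ?_ C ?_, ?_⟩
  · exact ((Complex.continuous_ofReal.comp c.W_cont).inv₀ c.W_ne).mul hu
  · intro x
    rw [norm_mul, norm_inv, Complex.norm_real, Real.norm_of_nonneg (c.W_pos x).le,
      inv_mul_le_iff₀ (c.W_pos x), mul_comm]
    exact h x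
  · ext x
    simp [J, ← mul_assoc, mul_inv_cancel₀ (c.W_ne x)]

theorem norm_le_of_J (b : X →ᵇ ℂ) (C : ℝ) (hC : 0 ≤ C) (h : ∀ x, ‖c.J b x‖ ≤ C * c.W x) : ‖b‖ ≤ C := by
  rw [BoundedContinuousFunction.norm_le hC]
  intro x
  rw [c.val_eq, norm_mul, norm_inv, Complex.norm_real, Real.norm_of_nonneg (c.W_pos x).le,
      inv_mul_le_iff₀ (c.W_pos x), mul_comm]
  exact h x

theorem exists_op (A : (X → ℂ) → X → ℂ)
    (hadd : ∀ u v, Continuous u → Continuous v → A (u + v) = A u + A v)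
    (hsmul : ∀ (a : ℂ) u, A (a • u) = a • A u)
    (hcont : ∀ b, Continuous (A (c.J b))) (C : ℝ) (hC : 0 ≤ C)
    (hbd : ∀ b x, ‖A (c.J b) x‖ ≤ C * ‖b‖ * c.W x) :
    ∃ T : (X →ᵇ ℂ) →L[ℂ] (X →ᵇ ℂ), (∀ b, c.J (T b) = A (c.J b)) ∧ ‖T‖ ≤ C := by
  choose T hT using fun b => c.exists_J (A (c.J b)) (hcont b) _ (hbd b)
  refine ⟨LinearMap.mkContinuous (⟨⟨T, ?_⟩, ?_⟩ : (X →ᵇ ℂ) →ₗ[ℂ] (X →ᵇ ℂ)) C ?_, hT, ?_⟩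
  · intro a b
    apply c.J_inj
    rw [c.J_add, hT, hT, hT, c.J_add, hadd _ _ (c.J_cont a) (c.J_cont b)]
  · intro k b
    apply c.J_inj
    simp only [RingHom.id_apply]
    rw [c.J_smul, hT, hT, c.J_smul, hsmul]
  · intro b
    refine c.norm_le_of_J _ _ (by positivity) fun x => ?_
    have := hbd b x
    rw [← hT] at this
    exact this
  · exact LinearMap.mkContinuous_norm_le _ hC _

theorem exists_rho : ∃ ρ : (X ≃ᵢ X) → (X →ᵇ ℂ) →L[ℂ] (X →ᵇ ℂ),
    (∀ g b, c.J (ρ g b) = c.J b ∘ g) ∧ ∀ g, ‖ρ g‖ ≤ Real.exp (dist (g c.o) c.o) := by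
  choose ρ h1 h2 using fun g : X ≃ᵢ X => c.exists_op (fun u => u ∘ g) (fun u v _ _ => rfl)
    (fun a u => rfl) (fun b => (c.J_cont b).comp g.continuous) (Real.exp (dist (g c.o) c.o))
    (Real.exp_pos _).le (fun b x => by
      refine (c.J_norm b (g x)).trans ?_
      have : c.W (g x) ≤ Real.exp (dist (g c.o) c.o) * c.W x := by
        unfold W
        rw [← Real.exp_add]
        apply Real.exp_le_exp.2
        have := dist_triangle (g x) (g c.o) c.o
        rw [g.dist_eq] at this
        linarith
      have := mul_le_mul_of_nonneg_right this (norm_nonneg b)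
      linarith)
  exact ⟨ρ, h1, h2⟩

theorem exists_M (c : Ctx X) [ProperSpace X] : ∃ (P : (X → ℂ) → X → ℂ)
    (M : (X →ᵇ ℂ) →L[ℂ] (X →ᵇ ℂ)),
    (∀ u, Continuous u → ∀ x a, (∀ y ∈ closedBall x 1, ‖u y‖ ≤ a) → ‖P u x‖ ≤ a) ∧
    (∀ u (g : X ≃ᵢ X), P (u ∘ g) = P u ∘ g) ∧
    (P 1 = 1) ∧ (∀ b, c.J (M b) = P (c.J b) ∘ c.σ) ∧ IsCompactOperator M := by
  obtain ⟨P, hadd, hsmul, hbd, heq, hone, hlip⟩ := c.exists_P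
  have hPc : ∀ u, Continuous u → Continuous (P u) := by
    intro u hu
    rw [continuous_iff_continuousAt]
    intro x
    obtain ⟨E, hE, h⟩ := hlip x
    obtain ⟨a, ha⟩ := (isCompact_closedBall x 2).exists_bound_of_continuousOn hu.continuousOn
    have h2 := h u hu a ha
    rw [ContinuousAt, tendsto_iff_norm_sub_tendsto_zero]
    have h3 : Tendsto (fun x' => E * dist x x' * a) (𝓝 x) (𝓝 0) := by
      have : Continuous fun x' => E * dist x x' * a := by fun_prop
      simpa using this.tendsto x
    refine squeeze_zero' (Eventually.of_forall fun _ => norm_nonneg _) ?_ h3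
    filter_upwards [closedBall_mem_nhds x one_pos] with x' hx'
    rw [norm_sub_rev]
    exact h2 x' (by rw [dist_comm]; exact hx')
  have hWb : ∀ (b : X →ᵇ ℂ) (x : X) (s : ℝ), ∀ y ∈ closedBall x s,
      ‖c.J b y‖ ≤ Real.exp (dist x c.o + s) * ‖b‖ := by
    intro b x s y hy
    refine (c.J_norm b y).trans (mul_le_mul_of_nonneg_right ?_ (norm_nonneg _))
    apply Real.exp_le_exp.2
    have := dist_triangle y x c.o
    rw [mem_closedBall] at hy
    linarith
  have hl1 : c.lam⁻¹ < 1 := inv_lt_one_of_one_lt₀ c.hlam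
  have hσd : ∀ x, dist (c.σ x) c.o = c.lam⁻¹ * dist x c.o := by
    intro x
    conv_lhs => rw [← c.hσo]
    exact c.hσ x c.o
  have hMb : ∀ (b : X →ᵇ ℂ) x, ‖P (c.J b) (c.σ x)‖ ≤ Real.exp (c.lam⁻¹ * dist x c.o + 1) * ‖b‖ := by
    intro b x
    rw [← hσd]
    exact hbd _ (c.J_cont b) _ _ (hWb b (c.σ x) 1)
  obtain ⟨M, hM, -⟩ := c.exists_op (fun u => P u ∘ c.σ)
    (fun u v hu hv => by rw [hadd u v hu hv]; rfl)
    (fun a u => by rw [hsmul]; rfl) (fun b => (hPc _ (c.J_cont b)).comp c.σ.continuous)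
    (Real.exp 1) (Real.exp_pos _).le (fun b x => by
      refine (hMb b x).trans ?_
      rw [Real.exp_add]
      have : Real.exp (c.lam⁻¹ * dist x c.o) ≤ c.W x := Real.exp_le_exp.2 (by
        have := dist_nonneg (x := x) (y := c.o); nlinarith)
      have h1 : 0 ≤ Real.exp 1 * ‖b‖ := by positivity
      nlinarith)
  refine ⟨P, M, hbd, heq, hone, hM, compact_criterion M ?_ ?_⟩
  · intro x ε hε
    obtain ⟨E, hE, h⟩ := hlip (c.σ x)
    set D := Real.exp (dist (c.σ x) c.o + 1)
    set D2 := Real.exp (dist (c.σ x) c.o + 2)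
    have hf : Continuous fun x' => E * dist (c.σ x) (c.σ x') * D2 + |(c.W x')⁻¹ - (c.W x)⁻¹| * D := by
      have h1 := c.σ.continuous
      have h2 : Continuous fun x' => (c.W x')⁻¹ := c.W_cont.inv₀ fun x => (c.W_pos x).ne'
      fun_prop
    have h1 : ∀ᶠ x' in 𝓝 x, E * dist (c.σ x) (c.σ x') * D2 + |(c.W x')⁻¹ - (c.W x)⁻¹| * D < ε := by
      refine hf.continuousAt.eventually_lt continuousAt_const ?_
      simpa using hε
    have h2 : ∀ᶠ x' in 𝓝 x, dist (c.σ x) (c.σ x') < 1 := by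
      have hf2 : Continuous fun x' => dist (c.σ x) (c.σ x') := by
        have h1 := c.σ.continuous
        fun_prop
      refine hf2.continuousAt.eventually_lt continuousAt_const ?_
      simp
    refine ⟨_, h1.and h2, ?_⟩
    rintro x' ⟨hx1, hx2⟩ b
    have e1 := h _ (c.J_cont b) _ (hWb b (c.σ x) 2) (c.σ x') hx2.le
    have e2 := hbd _ (c.J_cont b) _ _ (hWb b (c.σ x) 1)
    rw [c.val_eq (M b) x', c.val_eq (M b) x, hM]
    simp only [Function.comp]
    set p := P (c.J b) (c.σ x)
    set p' := P (c.J b) (c.σ x')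
    have e3 : (c.W x' : ℂ)⁻¹ * p' - (c.W x : ℂ)⁻¹ * p =
        (c.W x' : ℂ)⁻¹ * (p' - p) + (((c.W x')⁻¹ - (c.W x)⁻¹ : ℝ) : ℂ) * p := by
      push_cast; ring
    rw [e3]
    have e4 : ‖(c.W x' : ℂ)⁻¹‖ ≤ 1 := by
      rw [norm_inv, Complex.norm_real, Real.norm_of_nonneg (c.W_pos x').le]
      exact inv_le_one_of_one_le₀ (c.one_le_W x')
    calc _ ≤ ‖(c.W x' : ℂ)⁻¹‖ * ‖p' - p‖ + |(c.W x')⁻¹ - (c.W x)⁻¹| * ‖p‖ := by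
          refine (norm_add_le _ _).trans ?_
          rw [norm_mul, norm_mul, Complex.norm_real, Real.norm_eq_abs]
      _ ≤ 1 * (E * dist (c.σ x) (c.σ x') * (D2 * ‖b‖)) + |(c.W x')⁻¹ - (c.W x)⁻¹| * (D * ‖b‖) := by
          rw [norm_sub_rev] at e1
          gcongr
      _ = (E * dist (c.σ x) (c.σ x') * D2 + |(c.W x')⁻¹ - (c.W x)⁻¹| * D) * ‖b‖ := by ring
      _ ≤ ε * ‖b‖ := by gcongr
  · intro ε hε
    have h1 : 0 < 1 - c.lam⁻¹ := by linarith
    refine ⟨closedBall c.o ((1 - Real.log ε) / (1 - c.lam⁻¹)), isCompact_closedBall _ _, ?_⟩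
    intro x hx b
    rw [mem_closedBall, not_le, div_lt_iff₀ h1] at hx
    rw [c.val_eq (M b) x, hM, norm_mul, norm_inv, Complex.norm_real,
      Real.norm_of_nonneg (c.W_pos x).le, inv_mul_le_iff₀ (c.W_pos x)]
    refine (hMb b x).trans ?_
    rw [← mul_assoc]
    refine mul_le_mul_of_nonneg_right ?_ (norm_nonneg _)
    have e9 : c.W x * ε = Real.exp (dist x c.o + Real.log ε) := by rw [Real.exp_add, Real.exp_log hε, W]
    rw [e9]
    apply Real.exp_le_exp.2
    nlinarith
end Ctx
end CarnotHomeo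

set_option linter.all false
set_option linter.deprecated false
namespace CarnotHomeo
open Filter Topology Set Metric BoundedContinuousFunction

variable {X : Type*} [MetricSpace X]

namespace Ctx
variable (c : Ctx X)

theorem exists_nu (c : Ctx X) [ProperSpace X] : ∃ (R : ℝ) (M : (X →ᵇ ℂ) →L[ℂ] (X →ᵇ ℂ))
    (ρ : (X ≃ᵢ X) → (X →ᵇ ℂ) →L[ℂ] (X →ᵇ ℂ)) (ν : (X →ᵇ ℂ) →ₗ[ℂ] ℂ),
    0 < R ∧ IsCompactOperator M ∧ (∀ g b, c.J (ρ g b) = c.J b ∘ g) ∧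
    (∀ g, ‖ρ g‖ ≤ Real.exp (dist (g c.o) c.o)) ∧
    (∀ g b, M (ρ (c.th g) b) = ρ g (M b)) ∧
    (∀ b a, (∀ x ∈ closedBall c.o R, ‖c.J b x‖ ≤ a) → ‖ν b‖ ≤ a) ∧
    (∀ b, (∀ x ∈ closedBall c.o R, c.J b x = 1) → ν b = 1) ∧
    (∀ b, ν (M b) = ν b) ∧ (∀ k, k c.o = c.o → ∀ b, ν (ρ k b) = ν b) := by
  obtain ⟨P, M, hbd, heq, hone, hM, hMc⟩ := c.exists_M
  obtain ⟨ρ, hρ, hρn⟩ := c.exists_rho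
  have hl := c.hlam
  set R := c.lam / (c.lam - 1) with hR
  have hR0 : 0 < R := div_pos c.lam_pos (by linarith)
  have hRe : c.lam⁻¹ * R + 1 = R := by
    have : c.lam - 1 ≠ 0 := by linarith
    have := c.lam_pos.ne'
    rw [hR]; field_simp; ring
  have hMρ : ∀ g b, M (ρ (c.th g) b) = ρ g (M b) := by
    intro g b
    apply c.J_inj
    rw [hM, hρ, heq, hρ, hM]
    ext x
    simp [c.th_σ]
  have hstep : ∀ b a, (∀ x ∈ closedBall c.o R, ‖c.J b x‖ ≤ a) →
      ∀ x ∈ closedBall c.o R, ‖c.J (M b) x‖ ≤ a := by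
    intro b a h x hx
    rw [hM]
    refine hbd _ (c.J_cont b) _ _ fun y hy => h y ?_
    rw [mem_closedBall] at *
    have e1 := dist_triangle y (c.σ x) c.o
    have e2 := c.hσ x c.o
    rw [c.hσo] at e2
    have : c.lam⁻¹ * dist x c.o ≤ c.lam⁻¹ * R :=
      mul_le_mul_of_nonneg_left hx (inv_nonneg.2 c.lam_pos.le)
    linarith
  have hit : ∀ b a, (∀ x ∈ closedBall c.o R, ‖c.J b x‖ ≤ a) → ∀ k : ℕ,
      ∀ x ∈ closedBall c.o R, ‖c.J ((M ^ k) b) x‖ ≤ a := by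
    intro b a h k
    induction k with
    | zero => simpa using h
    | succ k ih =>
      rw [pow_succ']
      exact hstep _ _ ih
  have ho : c.o ∈ closedBall c.o R := mem_closedBall_self hR0.le
  set s : (X →ᵇ ℂ) → ℕ → ℂ := fun b n => (n : ℂ)⁻¹ * ∑ k ∈ Finset.range n, c.J ((M ^ k) b) c.o with hs
  have hsb : ∀ b a, (∀ x ∈ closedBall c.o R, ‖c.J b x‖ ≤ a) → ∀ n, ‖s b n‖ ≤ a := by
    intro b a h n
    have ha : 0 ≤ a := (norm_nonneg _).trans (h c.o ho)
    simp only [hs]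
    rw [norm_mul, norm_inv, Complex.norm_natCast]
    rcases Nat.eq_zero_or_pos n with rfl | hn
    · simpa using ha
    have hn' : (0:ℝ) < n := by exact_mod_cast hn
    rw [inv_mul_le_iff₀ hn']
    refine (norm_sum_le _ _).trans ?_
    refine (Finset.sum_le_card_nsmul _ _ a fun k _ => hit b a h k c.o ho).trans ?_
    simp
  have hex : ∀ b, ∃ a, ∀ x ∈ closedBall c.o R, ‖c.J b x‖ ≤ a := fun b =>
    (isCompact_closedBall c.o R).exists_bound_of_continuousOn (c.J_cont b).continuousOn
  set U : Ultrafilter ℕ := hyperfilter ℕ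
  have hU : (U : Filter ℕ) ≤ atTop := Nat.hyperfilter_le_atTop
  have hlim : ∀ b, ∃ l, Tendsto (s b) U (𝓝 l) := by
    intro b
    obtain ⟨a, ha⟩ := hex b
    obtain ⟨l, -, hl⟩ := (isCompact_closedBall (0:ℂ) a).ultrafilter_le_nhds (U.map (s b)) (by
      rw [le_principal_iff, Ultrafilter.mem_coe, Ultrafilter.mem_map]
      refine Filter.univ_mem' fun n => ?_
      show s b n ∈ closedBall (0:ℂ) a
      rw [mem_closedBall_zero_iff]; exact hsb b a ha n)
    exact ⟨l, hl⟩
  choose ν hν using hlim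
  have hM1 : ∀ k : ℕ, ∀ b, (∀ x ∈ closedBall c.o R, c.J b x = 1) → c.J ((M ^ k) b) c.o = 1 := by
    intro k b hb
    obtain ⟨b1, hb1⟩ := c.exists_J 1 continuous_one 1 (fun x => by
      simpa using c.one_le_W x)
    have hMb1 : M b1 = b1 := by
      apply c.J_inj
      rw [hM, hb1, hone]; rfl
    have hMk : ∀ k : ℕ, (M ^ k) b1 = b1 := by
      intro k
      induction k with
      | zero => rfl
      | succ k ih => rw [pow_succ']; show M ((M ^ k) b1) = b1; rw [ih, hMb1]
    have h0 := hit (b - b1) 0 (fun x hx => by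
      rw [c.J_sub, Pi.sub_apply, hb x hx, hb1]; simp) k c.o ho
    rw [map_sub, hMk, c.J_sub, Pi.sub_apply, hb1, norm_le_zero_iff, sub_eq_zero] at h0
    simpa using h0
  refine ⟨R, M, ρ, ⟨⟨ν, ?_⟩, ?_⟩, hR0, hMc, hρ, hρn, hMρ, ?_, ?_, ?_, ?_⟩
  · intro a b
    refine tendsto_nhds_unique (hν _) (((hν a).add (hν b)).congr fun n => ?_)
    simp only [hs, map_add, c.J_add, Pi.add_apply, Finset.sum_add_distrib, mul_add]
  · intro k b
    refine tendsto_nhds_unique (hν _) (((hν b).const_mul k).congr fun n => ?_)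
    simp only [hs, map_smul, c.J_smul, Pi.smul_apply, smul_eq_mul, ← Finset.mul_sum]
    ring
  · intro b a h
    exact le_of_tendsto (hν b).norm (Eventually.of_forall (hsb b a h))
  · intro b hb
    refine tendsto_nhds_unique (hν b) ?_
    have : ∀ᶠ n : ℕ in (U : Filter ℕ), (1:ℂ) = s b n := by
      filter_upwards [hU (eventually_gt_atTop 0)] with n hn
      simp only [hs, hM1 _ b hb]
      have : (n:ℂ) ≠ 0 := by exact_mod_cast hn.ne'
      simp [this]
    exact Tendsto.congr' this tendsto_const_nhds
  · intro b
    obtain ⟨a, ha⟩ := hex b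
    have h1 : Tendsto (fun n => s (M b) n - s b n) U (𝓝 0) := by
      have h2 : Tendsto (fun n : ℕ => ((n:ℝ)⁻¹ * (a + a))) U (𝓝 0) := by
        have := (tendsto_inv_atTop_nhds_zero_nat (𝕜 := ℝ)).mul_const (a + a)
        rw [zero_mul] at this
        exact this.mono_left hU
      refine squeeze_zero_norm (fun n => ?_) h2
      have : s (M b) n - s b n = (n:ℂ)⁻¹ * (c.J ((M ^ n) b) c.o - c.J b c.o) := by
        simp only [hs]
        rw [← mul_sub, ← Finset.sum_sub_distrib]
        congr 1
        have := Finset.sum_range_sub (fun k => c.J ((M ^ k) b) c.o) n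
        simp only [pow_zero, ContinuousLinearMap.one_apply] at this
        rw [← this]
        refine Finset.sum_congr rfl fun k _ => ?_
        rw [pow_succ]; rfl
      rw [this, norm_mul, norm_inv, Complex.norm_natCast]
      refine mul_le_mul_of_nonneg_left ?_ (by positivity)
      exact (norm_sub_le _ _).trans (add_le_add (hit b a ha n c.o ho) (ha c.o ho))
    have := tendsto_nhds_unique h1 ((hν (M b)).sub (hν b))
    exact (sub_eq_zero.1 this.symm)
  · intro k hk b
    refine tendsto_nhds_unique (hν _) ((hν b).congr fun n => ?_)
    simp only [hs]
    congr 1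
    refine Finset.sum_congr rfl fun i _ => ?_
    have : ∀ i : ℕ, ∀ k : X ≃ᵢ X, k c.o = c.o → ∃ k' : X ≃ᵢ X, k' c.o = c.o ∧
        (M ^ i) (ρ k b) = ρ k' ((M ^ i) b) := by
      intro i k hk
      induction i with
      | zero => exact ⟨k, hk, rfl⟩
      | succ i ih =>
        obtain ⟨k', h1, h2⟩ := ih
        refine ⟨c.ti k', by rw [c.ti_apply, c.hσo, h1, c.hσso], ?_⟩
        rw [pow_succ']
        show M ((M ^ i) (ρ k b)) = ρ (c.ti k') (M ((M ^ i) b))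
        rw [h2, ← hMρ, c.th_ti]
    obtain ⟨k', h1, h2⟩ := this i k hk
    rw [h2, hρ, Function.comp_apply, h1]

theorem exists_ops (c : Ctx X) [ProperSpace X] : ∃ (M : (X →ᵇ ℂ) →L[ℂ] (X →ᵇ ℂ))
    (ρ : (X ≃ᵢ X) → (X →ᵇ ℂ) →L[ℂ] (X →ᵇ ℂ)) (Φ : X → (X →ᵇ ℂ) →L[ℂ] ℂ),
    IsCompactOperator M ∧
    (∀ g, ‖ρ g‖ ≤ Real.exp (dist (g c.o) c.o)) ∧
    (∀ g b, M (ρ (c.th g) b) = ρ g (M b)) ∧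
    (∀ g x u, Φ (g x) u = Φ x (ρ g u)) ∧
    (∀ x u, Φ (c.σ x) u = Φ x (M u)) ∧
    (∀ u, Continuous fun x => Φ x u) ∧
    (∃ u₀ R, 0 < R ∧ Φ c.o u₀ = 1 ∧ ∀ x, R < dist x c.o → Φ x u₀ = 0) ∧
    ∃ C, 0 < C ∧ ∀ x u, ‖Φ x u‖ ≤ C * Real.exp (dist x c.o) * ‖u‖ := by
  obtain ⟨R, M, ρ, ν, hR0, hMc, hρ, hρn, hMρ, hν, hν1, hνM, hνk⟩ := c.exists_nu
  choose h hh using c.tr c.o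
  have hνb : ∀ b, ‖ν b‖ ≤ Real.exp R * ‖b‖ := by
    intro b
    refine hν _ _ fun x hx => (c.J_norm b x).trans ?_
    exact mul_le_mul_of_nonneg_right (Real.exp_le_exp.2 hx) (norm_nonneg _)
  set N : (X →ᵇ ℂ) →L[ℂ] ℂ := ν.mkContinuous _ hνb with hN
  have hNν : ∀ b, N b = ν b := fun b => rfl
  have hρmul : ∀ g g' b, ρ (g * g') b = ρ g' (ρ g b) := by
    intro g g' b
    apply c.J_inj
    rw [hρ, hρ, hρ]; rfl
  set Φ : X → (X →ᵇ ℂ) →L[ℂ] ℂ := fun x => N.comp (ρ (h x)) with hΦ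
  have key : ∀ (g : X ≃ᵢ X) u, Φ (g c.o) u = ν (ρ g u) := by
    intro g u
    have e : h (g c.o) = g * (g⁻¹ * h (g c.o)) := by group
    show ν (ρ (h (g c.o)) u) = _
    rw [e, hρmul, hνk]
    show g.symm (h (g c.o) c.o) = c.o
    rw [hh]; simp
  have hg : ∀ g x u, Φ (g x) u = Φ x (ρ g u) := by
    intro g x u
    have := key (g * h x) u
    rw [IsometryEquiv.mul_apply, hh] at this
    rw [this, hρmul]
    rfl
  refine ⟨M, ρ, Φ, hMc, hρn, hMρ, hg, ?_, ?_, ?_, ?_⟩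
  · intro x u
    have := key (c.th (h x)) u
    have e : c.th (h x) c.o = c.σ x := by
      conv_lhs => rw [← c.hσo, c.th_σ, hh]
    rw [e] at this
    rw [this, ← hνM, hMρ]; rfl
  · have h0 : ∀ u, ContinuousAt (fun x => Φ x u) c.o := by
      intro u
      rw [Metric.continuousAt_iff]
      intro ε hε
      have huc := (isCompact_closedBall c.o (R+1)).uniformContinuousOn_of_continuous
        (c.J_cont u).continuousOn
      rw [Metric.uniformContinuousOn_iff] at huc
      obtain ⟨δ, hδ, hd⟩ := huc (ε/2) (by positivity)
      obtain ⟨r, hr, hr'⟩ := c.om' R (min δ 1) (by positivity)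
      refine ⟨r, hr, fun {x} hx => ?_⟩
      obtain ⟨w, rfl, hw⟩ := hr' x hx
      have e1 : Φ c.o u = ν u := by
        have := key 1 u
        rw [show (1 : X ≃ᵢ X) c.o = c.o from rfl] at this
        rw [this]; congr 1
        apply c.J_inj; rw [hρ]; rfl
      rw [key, e1, dist_eq_norm, ← map_sub]
      refine (hν _ (ε/2) fun z hz => ?_).trans_lt (by linarith)
      rw [c.J_sub, Pi.sub_apply, hρ, ← dist_eq_norm]
      have h1 := hw z hz
      rw [mem_closedBall] at hz
      have h2 := lt_min_iff.1 h1
      refine (hd _ ?_ _ ?_ h2.1).le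
      · rw [mem_closedBall]
        have := dist_triangle (w z) z c.o
        linarith [h2.2]
      · rw [mem_closedBall]; linarith
    intro u
    rw [continuous_iff_continuousAt]
    intro x
    have h1 := h0 (ρ (h x) u)
    have e : (fun y => Φ y u) = (fun y => Φ y (ρ (h x) u)) ∘ (h x).symm := by
      funext y
      simp only [Function.comp]
      rw [← hg]; simp
    rw [e]
    refine ContinuousAt.comp ?_ (h x).symm.continuous.continuousAt
    have : (h x).symm x = c.o := by
      rw [IsometryEquiv.symm_apply_eq, hh]
    rw [this]; exact h1
  · obtain ⟨u₀, hu₀⟩ := c.exists_J (fun x => ((max 0 (min 1 (R + 1 - dist x c.o)) : ℝ) : ℂ))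
      (by fun_prop) 1 (fun x => by
        rw [Complex.norm_real, Real.norm_of_nonneg (le_max_left _ _), one_mul]
        exact (max_le zero_le_one (min_le_left _ _)).trans (c.one_le_W x))
    refine ⟨u₀, 2 * R + 1, by linarith, ?_, ?_⟩
    · have := key 1 u₀
      rw [show (1 : X ≃ᵢ X) c.o = c.o from rfl] at this
      rw [this]
      refine hν1 _ fun x hx => ?_
      rw [hρ, hu₀]
      rw [mem_closedBall] at hx
      show ((max 0 (min 1 (R + 1 - dist x c.o)) : ℝ) : ℂ) = 1
      rw [min_eq_left (by linarith), max_eq_right zero_le_one]; simp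
    · intro x hx
      rw [← norm_le_zero_iff]
      refine hν _ 0 fun z hz => ?_
      show ‖c.J (ρ (h x) u₀) z‖ ≤ 0
      rw [hρ, hu₀]
      rw [mem_closedBall] at hz
      have e1 := dist_triangle (h x c.o) (h x z) c.o
      rw [(h x).dist_eq, hh, dist_comm c.o z] at e1
      show ‖((max 0 (min 1 (R + 1 - dist (h x z) c.o)) : ℝ) : ℂ)‖ ≤ 0
      rw [max_eq_left ((min_le_right _ _).trans (by linarith))]; simp
  · refine ⟨Real.exp R, Real.exp_pos _, fun x u => ?_⟩
    have h1 := hρn (h x)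
    rw [hh] at h1
    calc ‖Φ x u‖ ≤ Real.exp R * ‖ρ (h x) u‖ := hνb _
      _ ≤ Real.exp R * (Real.exp (dist x c.o) * ‖u‖) := by
          gcongr
          exact ((ρ (h x)).le_opNorm u).trans (by gcongr)
      _ = _ := by ring
end Ctx
end CarnotHomeo

set_option linter.all false
set_option linter.deprecated false
namespace CarnotHomeo
open Filter Topology Set Metric BoundedContinuousFunction

theorem last_visit {X : Type*} (r : X → X → Prop) (P : X → Prop) (x z : X) (hx : P x)
    (h : Relation.ReflTransGen r x z) : ∃ w, P w ∧ (w = z ∨ ∃ w', r w w' ∧ ¬ P w' ∧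
      Relation.ReflTransGen (fun a b => r a b ∧ ¬ P b) w' z) := by
  induction h with
  | refl => exact ⟨x, hx, Or.inl rfl⟩
  | @tail y z h1 h2 ih =>
    by_cases hz : P z
    · exact ⟨z, hz, Or.inl rfl⟩
    · obtain ⟨w, hw, rfl | ⟨w', h3, h4, h5⟩⟩ := ih
      · exact ⟨w, hw, Or.inr ⟨z, h2, hz, Relation.ReflTransGen.refl⟩⟩
      · exact ⟨w, hw, Or.inr ⟨w', h3, h4, h5.tail ⟨h2, hz⟩⟩⟩

theorem chain_cover {X ι : Type*} [DecidableEq ι] (φ : X → ℂ) (δ : ℝ) (T : ι → Set X) (n : ℕ) :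
    ∀ (t : Finset ι) (r : X → X → Prop) (x z : X), t.card = n →
    (∀ a b, r a b → ‖φ a - φ b‖ ≤ δ) → (∀ i ∈ t, ∀ a ∈ T i, ∀ b ∈ T i, ‖φ a - φ b‖ ≤ δ) →
    (∀ a b, r a b → ∃ i ∈ t, b ∈ T i) → (∃ i ∈ t, x ∈ T i) → Relation.ReflTransGen r x z →
    ‖φ x - φ z‖ ≤ 2 * n * δ := by
  induction n with
  | zero =>
    intro t r x z ht _ _ _ ⟨i, hi, _⟩
    rw [Finset.card_eq_zero] at ht
    simp [ht] at hi
  | succ n ih =>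
    intro t r x z ht hr hT hc ⟨i, hi, hix⟩ h
    obtain ⟨w, hw, hh⟩ := last_visit r (fun y => y ∈ T i) x z hix h
    have e1 := hT i hi x hix w hw
    have hδ : 0 ≤ δ := (norm_nonneg _).trans e1
    rcases hh with rfl | ⟨w', h1, h2, h3⟩
    · push_cast
      have : 0 ≤ (n:ℝ) * δ := by positivity
      nlinarith
    · have e2 := hr w w' h1
      have hc' : ∀ b, b ∉ T i → (∃ j ∈ t, b ∈ T j) → ∃ j ∈ t.erase i, b ∈ T j := by
        rintro b hb ⟨j, hj, hjb⟩
        exact ⟨j, Finset.mem_erase.2 ⟨fun e => hb (e ▸ hjb), hj⟩, hjb⟩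
      have e3 := ih (t.erase i) _ w' z (by rw [Finset.card_erase_of_mem hi, ht]; rfl)
        (fun a b hab => hr a b hab.1) (fun j hj => hT j (Finset.mem_of_mem_erase hj))
        (fun a b hab => hc' b hab.2 (hc a b hab.1)) (hc' w' h2 (hc w w' h1)) h3
      have : φ x - φ z = (φ x - φ w) + (φ w - φ w') + (φ w' - φ z) := by ring
      rw [this]
      refine (norm_add₃_le).trans ?_
      push_cast
      linarith

variable {X : Type*} [MetricSpace X]

namespace Ctx
variable (c : Ctx X)

theorem covering (c : Ctx X) [ProperSpace X] (R : ℝ) (hR : 0 < R) : ∃ q : ℕ, 0 < q ∧ ∀ (m : ℕ) (x : X),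
    ∃ t : Finset X, t.card ≤ q ^ m ∧ ∀ y ∈ closedBall x R, ∃ z ∈ t, dist y z ≤ R * (c.lam⁻¹) ^ m := by
  classical
  have hl := c.lam_pos
  obtain ⟨t, -, htf, ht⟩ := (isCompact_closedBall c.o R).finite_cover_balls
    (e := R * c.lam⁻¹) (by positivity)
  lift t to Finset X using htf
  have hone : ∀ (m : ℕ) (x : X), ∃ t' : Finset X, t'.card ≤ t.card ∧
      ∀ y ∈ closedBall x (R * (c.lam⁻¹) ^ m), ∃ z ∈ t', dist y z ≤ R * (c.lam⁻¹) ^ (m+1) := by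
    intro m x
    obtain ⟨g, rfl⟩ := c.tr c.o x
    refine ⟨t.image fun z => g (c.σ^[m] z), Finset.card_image_le, fun y hy => ?_⟩
    set y' := c.σ.symm^[m] (g.symm y) with hy'
    have e : y = g (c.σ^[m] y') := by rw [hy', c.iter_symm]; simp
    have h1 : y' ∈ closedBall c.o R := by
      rw [mem_closedBall, e, g.dist_eq, c.dist_iter_o] at hy
      rw [mem_closedBall]
      have hp : 0 < (c.lam⁻¹)^m := by positivity
      rw [mul_comm] at hy
      exact le_of_mul_le_mul_right hy hp
    have h2 := ht h1
    simp only [mem_iUnion, mem_ball] at h2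
    obtain ⟨z, hz, hyz⟩ := h2
    refine ⟨g (c.σ^[m] z), Finset.mem_image_of_mem _ hz, ?_⟩
    rw [e, g.dist_eq, c.dist_iter, pow_succ]
    have hp : 0 < (c.lam⁻¹)^m := by positivity
    nlinarith
  refine ⟨t.card + 1, by omega, fun m => ?_⟩
  induction m with
  | zero => exact fun x => ⟨{x}, by simp, fun y hy => ⟨x, by simp, by simpa using hy⟩⟩
  | succ m ih =>
    intro x
    obtain ⟨s, hs, hs'⟩ := ih x
    choose T hT hT' using hone m
    refine ⟨s.biUnion T, ?_, fun y hy => ?_⟩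
    · refine (Finset.card_biUnion_le_card_mul _ _ (t.card+1) fun a _ => (hT a).trans (by omega)).trans ?_
      rw [pow_succ]
      exact Nat.mul_le_mul_right _ hs
    · obtain ⟨z, hz, hyz⟩ := hs' y hy
      obtain ⟨w, hw, hyw⟩ := hT' z y hyz
      exact ⟨w, Finset.mem_biUnion.2 ⟨z, hz, hw⟩, hyw⟩
end Ctx
end CarnotHomeo

set_option linter.all false
set_option linter.deprecated false
namespace CarnotHomeo
open Filter Topology Set Metric BoundedContinuousFunction

variable {X : Type*} [MetricSpace X]

namespace Ctx
variable (c : Ctx X)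

theorem exists_V {B : Type*} [NormedAddCommGroup B] [NormedSpace ℂ B] [CompleteSpace B]
    (c : Ctx X) [ProperSpace X] (M : B →L[ℂ] B)
    (ρ : (X ≃ᵢ X) → B →L[ℂ] B) (Φ : X → B →L[ℂ] ℂ)
    (hM : IsCompactOperator M)
    (hρ : ∀ g, ‖ρ g‖ ≤ Real.exp (dist (g c.o) c.o))
    (hMρ : ∀ g b, M (ρ (c.th g) b) = ρ g (M b))
    (hg : ∀ g x u, Φ (g x) u = Φ x (ρ g u))
    (hσ : ∀ x u, Φ (c.σ x) u = Φ x (M u))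
    (u₀ : B) (R : ℝ) (hR : 0 < R) (hu₀ : Φ c.o u₀ = 1) (hu₀' : ∀ x, R < dist x c.o → Φ x u₀ = 0)
    (C : ℝ) (hC : 0 < C) (hbd : ∀ x u, ‖Φ x u‖ ≤ C * Real.exp (dist x c.o) * ‖u‖) :
    ∃ V : Submodule ℂ B, FiniteDimensional ℂ V ∧ (∀ x ∈ V, M x ∈ V) ∧ (∀ g, ∀ x ∈ V, ρ g x ∈ V) ∧
    (∀ n : ℕ, ∃ D, 0 < D ∧ ∀ u ∈ V, ∃ v ∈ V, (M ^ n) v = u ∧ ‖v‖ ≤ D * ‖u‖) ∧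
    ∃ ε, 0 < ε ∧ ∀ x, Relation.ReflTransGen (fun a b => dist a b ≤ ε ∧ ∀ v ∈ V, Φ b v = Φ c.o v) c.o x →
      dist x c.o ≤ R := by
  classical
  obtain ⟨q, hq, hcov⟩ := c.covering (R+1) (by linarith)
  have hq' : (0:ℝ) < q := by exact_mod_cast hq
  have hl := c.lam_pos
  have hl1 : c.lam⁻¹ < 1 := inv_lt_one_of_one_lt₀ c.hlam
  obtain ⟨V, hfin, hMV, α, β, C', hα, hαβ, hβ, hC', happ, hsurj⟩ :=
    spectral_lemma M hM (1 / (2 * q)) (by positivity)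
  have hβ0 : 0 < β := hα.trans hαβ
  have hσn : ∀ (n : ℕ) x u, Φ (c.σ^[n] x) u = Φ x ((M ^ n) u) := by
    intro n
    induction n with
    | zero => intro x u; rfl
    | succ n ih =>
      intro x u
      rw [Function.iterate_succ_apply, ih, hσ, pow_succ']; rfl
  have hMρn : ∀ (n : ℕ) g b, (M ^ n) (ρ ((c.th)^[n] g) b) = ρ g ((M ^ n) b) := by
    intro n
    induction n with
    | zero => intro g b; rfl
    | succ n ih =>
      intro g b
      rw [Function.iterate_succ_apply, pow_succ', ContinuousLinearMap.mul_apply, ih, hMρ]; rfl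
  have hVcl : IsClosed (V : Set B) := V.closed_of_finiteDimensional
  have hVρ : ∀ g, ∀ x ∈ V, ρ g x ∈ V := by
    intro g u hu
    have : ρ g u ∈ closure (V : Set B) := by
      rw [Metric.mem_closure_iff]
      intro ε hε
      have ht : Tendsto (fun n : ℕ => (C' * Real.exp (dist (g c.o) c.o) * (C' * ‖u‖)) * (α * β⁻¹)^n)
          atTop (𝓝 0) := by
        have := (tendsto_pow_atTop_nhds_zero_of_lt_one (r := α * β⁻¹) (by positivity)
          (by rw [← div_eq_mul_inv, div_lt_one hβ0]; exact hαβ)).const_mul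
          (C' * Real.exp (dist (g c.o) c.o) * (C' * ‖u‖))
        simpa using this
      obtain ⟨n, hn⟩ := (ht.eventually (gt_mem_nhds hε)).exists
      obtain ⟨v, hv, hvu, hvn⟩ := hsurj n u hu
      obtain ⟨w, hw, hwn⟩ := happ n (ρ ((c.th)^[n] g) v)
      rw [hMρn, hvu] at hwn
      refine ⟨w, hw, ?_⟩
      rw [dist_eq_norm]
      refine (hwn.trans ?_).trans_lt hn
      have h1 : ‖ρ ((c.th)^[n] g) v‖ ≤ Real.exp (dist (g c.o) c.o) * (C' * (β⁻¹)^n * ‖u‖) := by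
        refine ((ρ _).le_opNorm v).trans ?_
        gcongr
        refine (hρ _).trans (Real.exp_le_exp.2 ?_)
        rw [c.th_iter_o]
        exact mul_le_of_le_one_left dist_nonneg (pow_le_one₀ (by positivity) hl1.le)
      calc C' * α ^ n * ‖ρ ((c.th)^[n] g) v‖ ≤
          C' * α ^ n * (Real.exp (dist (g c.o) c.o) * (C' * (β⁻¹)^n * ‖u‖)) := by gcongr
        _ = _ := by rw [mul_pow]; ring
    rwa [hVcl.closure_eq] at this
  have taylor : ∀ D : ℝ, ∃ K, 0 < K ∧ ∀ (m : ℕ) x y u, (∀ v ∈ V, Φ x v = Φ y v) →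
      dist x y ≤ D * (c.lam⁻¹) ^ m → ‖Φ x u - Φ y u‖ ≤ K * α ^ m * Real.exp (dist x c.o) * ‖u‖ := by
    intro D
    refine ⟨(C * 1 + C * Real.exp D) * C', by positivity, fun m x y u hxy hd => ?_⟩
    obtain ⟨g, rfl⟩ := c.tr c.o x
    obtain ⟨z, rfl⟩ := g.surjective y
    rw [g.dist_eq] at hd
    set z' := c.σ.symm^[m] z with hz'
    have hz : z = c.σ^[m] z' := by rw [hz', c.iter_symm]
    have hz'd : dist z' c.o ≤ D := by
      rw [hz, dist_comm, c.dist_iter_o, mul_comm] at hd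
      exact le_of_mul_le_mul_right hd (by positivity)
    have hkill : ∀ v ∈ V, Φ c.o v = Φ z' v := by
      intro v hv
      obtain ⟨v', hv', rfl, -⟩ := hsurj m v hv
      rw [← hσn, ← hσn, ← hz, c.iter_o]
      have h1 := hxy _ (hVρ g⁻¹ v' hv')
      rw [← hg, ← hg] at h1
      have e1 : ∀ x, g⁻¹ (g x) = x := g.symm_apply_apply
      rwa [e1, e1] at h1
    obtain ⟨v, hv, hvn⟩ := happ m (ρ g u)
    have hw : ‖ρ g u‖ ≤ Real.exp (dist (g c.o) c.o) * ‖u‖ :=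
      ((ρ _).le_opNorm u).trans (by gcongr; exact hρ g)
    have e : Φ (g c.o) u - Φ (g z) u = Φ c.o ((M^m) (ρ g u) - v) - Φ z' ((M^m) (ρ g u) - v) := by
      rw [hg, hg, map_sub, map_sub, hkill v hv, ← hσn, ← hσn, ← hz, c.iter_o]; ring
    rw [e]
    have b1 := hbd c.o ((M^m) (ρ g u) - v)
    have b2 := hbd z' ((M^m) (ρ g u) - v)
    rw [dist_self, Real.exp_zero] at b1
    calc _ ≤ C * 1 * ‖(M^m) (ρ g u) - v‖ + C * Real.exp D * ‖(M^m) (ρ g u) - v‖ := by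
            refine (norm_sub_le _ _).trans (add_le_add b1 (b2.trans ?_))
            gcongr
      _ ≤ C * 1 * (C' * α ^ m * (Real.exp (dist (g c.o) c.o) * ‖u‖)) +
          C * Real.exp D * (C' * α ^ m * (Real.exp (dist (g c.o) c.o) * ‖u‖)) := by
            have := hvn.trans (mul_le_mul_of_nonneg_left hw (by positivity))
            gcongr
      _ = _ := by ring
  refine ⟨V, hfin, hMV, hVρ, fun n => ⟨C' * (β⁻¹)^n, by positivity, hsurj n⟩, ?_⟩
  obtain ⟨K, hK, hT⟩ := taylor (2 * (R+1))
  have hαq : α * q ≤ 1/2 := by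
    have : α ≤ 1 / (2 * q) := (hαβ.trans hβ).le
    calc α * q ≤ 1 / (2*q) * q := by gcongr
      _ = 1/2 := by field_simp
  have ht1 : Tendsto (fun m : ℕ => 2 * K * Real.exp (R+1) * ‖u₀‖ * (α * q)^m) atTop (𝓝 0) := by
    have := (tendsto_pow_atTop_nhds_zero_of_lt_one (r := α * q) (by positivity)
          (by linarith)).const_mul (2 * K * Real.exp (R+1) * ‖u₀‖)
    simpa using this
  have ht2 : Tendsto (fun m : ℕ => (R+1) * (c.lam⁻¹)^m) atTop (𝓝 0) := by
    simpa using c.tendsto_lam.const_mul (R+1)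
  obtain ⟨m, hm1, hm2⟩ := ((ht1.eventually (gt_mem_nhds one_pos)).and
    (ht2.eventually (gt_mem_nhds one_pos))).exists
  refine ⟨(R+1) * (c.lam⁻¹)^m, by positivity, ?_⟩
  obtain ⟨t, htc, ht⟩ := hcov m c.o
  set F : X → Prop := fun a => (∀ v ∈ V, Φ a v = Φ c.o v) ∧ dist a c.o ≤ R + 1 with hF
  set r : X → X → Prop := fun a b => dist a b ≤ (R+1) * (c.lam⁻¹)^m ∧ F a ∧ F b with hr
  have hjump : ∀ a b, F a → F b → dist a b ≤ 2 * (R+1) * (c.lam⁻¹)^m →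
      ‖Φ a u₀ - Φ b u₀‖ ≤ K * α ^ m * Real.exp (R+1) * ‖u₀‖ := by
    intro a b ha hb hab
    refine (hT m a b u₀ (fun v hv => (ha.1 v hv).trans (hb.1 v hv).symm) hab).trans ?_
    have := ha.2
    gcongr
  have hp : 0 < (R+1) * (c.lam⁻¹)^m := by positivity
  have hFcov : ∀ b, F b → ∃ i ∈ t, b ∈ {a | F a ∧ dist a i ≤ (R+1) * (c.lam⁻¹)^m} := by
    intro b hb
    obtain ⟨i, hi, hbi⟩ := ht b hb.2
    exact ⟨i, hi, hb, hbi⟩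
  have hFo : F c.o := ⟨fun v _ => rfl, by rw [dist_self]; linarith⟩
  have main : ∀ x, Relation.ReflTransGen r c.o x → dist x c.o ≤ R := by
    intro x hx
    by_contra hcon
    rw [not_le] at hcon
    have h1 := chain_cover (fun x => Φ x u₀) (K * α ^ m * Real.exp (R+1) * ‖u₀‖)
      (fun i => {a | F a ∧ dist a i ≤ (R+1) * (c.lam⁻¹)^m}) t.card t r c.o x rfl
      (fun a b hab => hjump a b hab.2.1 hab.2.2 (by linarith [hab.1]))
      (fun i hi a ha b hb => hjump a b ha.1 hb.1 (by
        have := dist_triangle_right a b i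
        linarith [ha.2, hb.2]))
      (fun a b hab => hFcov b hab.2.2) (hFcov _ hFo) hx
    simp only [hu₀, hu₀' x hcon, sub_zero, norm_one] at h1
    have h2 : (t.card : ℝ) ≤ (q:ℝ)^m := by exact_mod_cast htc
    have h3 : 2 * (t.card:ℝ) * (K * α ^ m * Real.exp (R+1) * ‖u₀‖) ≤
        2 * (q:ℝ)^m * (K * α ^ m * Real.exp (R+1) * ‖u₀‖) := by gcongr
    rw [mul_pow] at hm1
    nlinarith
  intro x hx
  have : Relation.ReflTransGen r c.o x ∧ F x := by
    induction hx with
    | refl => exact ⟨Relation.ReflTransGen.refl, hFo⟩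
    | @tail y z h1 h2 ih =>
      have hy := main y ih.1
      have hFz : F z := ⟨h2.2, by
        have := dist_triangle z y c.o
        rw [dist_comm z y] at this
        linarith [h2.1]⟩
      exact ⟨ih.1.tail ⟨h2.1, ih.2, hFz⟩, hFz⟩
  exact main x this.1
end Ctx
end CarnotHomeo

set_option linter.all false
set_option linter.deprecated false
namespace CarnotHomeo
open Filter Topology Set Metric BoundedContinuousFunction

variable {X : Type*} [MetricSpace X]

/-- a finite dimensional equivariant map with the trapping property -/
structure Rep (c : Ctx X) (E : Type*) [NormedAddCommGroup E] [NormedSpace ℂ E] where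
  Φ : X → E
  cont : Continuous Φ
  span : Submodule.span ℂ (range Φ) = ⊤
  act : ∀ g : X ≃ᵢ X, ∃ h : E →L[ℂ] E, ∀ x, Φ (g x) = h (Φ x)
  dil : ∃ A : E →L[ℂ] E, ∀ x, Φ (c.σ x) = A (Φ x)
  trap : ∀ r, 0 < r → ∃ ε, 0 < ε ∧ ∃ s, 0 < s ∧ ∀ x,
    Relation.ReflTransGen (fun a b => dist a b < s ∧ ‖Φ b - Φ c.o‖ < ε) c.o x → dist x c.o < r

theorem trap_of (c : Ctx X) [ProperSpace X] {E : Type*} [NormedAddCommGroup E] (Φ : X → E)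
    (hc : Continuous Φ) (R ε : ℝ) (hR : 0 < R) (hε : 0 < ε)
    (hch : ∀ x, Relation.ReflTransGen (fun a b => dist a b ≤ ε ∧ Φ b = Φ c.o) c.o x → dist x c.o ≤ R)
    (hA : ∀ n : ℕ, ∃ D, 0 < D ∧ ∀ x, ‖Φ x - Φ c.o‖ ≤ D * ‖Φ (c.σ^[n] x) - Φ c.o‖) :
    ∀ r, 0 < r → ∃ ε, 0 < ε ∧ ∃ s, 0 < s ∧ ∀ x,
    Relation.ReflTransGen (fun a b => dist a b < s ∧ ‖Φ b - Φ c.o‖ < ε) c.o x → dist x c.o < r := by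
  have h1 : ∃ δ, 0 < δ ∧ ∃ s, 0 < s ∧ ∀ x,
      Relation.ReflTransGen (fun a b => dist a b < s ∧ ‖Φ b - Φ c.o‖ < δ) c.o x →
      dist x c.o < R + ε := by
    have h2 : ∃ δ, 0 < δ ∧ ∀ y, dist y c.o ≤ R + 2 * ε → ‖Φ y - Φ c.o‖ < δ →
        ∃ y', Φ y' = Φ c.o ∧ dist y y' < ε / 3 := by
      set S := closedBall c.o (R + 2 * ε) ∩ (thickening (ε/3) {y | Φ y = Φ c.o})ᶜ with hS
      have hSc : IsCompact S := (isCompact_closedBall _ _).inter_right isOpen_thickening.isClosed_compl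
      have hout : ∀ y, dist y c.o ≤ R + 2 * ε → y ∉ S → ∃ y', Φ y' = Φ c.o ∧ dist y y' < ε / 3 := by
        intro y hy hyS
        have : y ∈ thickening (ε/3) {y | Φ y = Φ c.o} := by
          by_contra hcon; exact hyS ⟨hy, hcon⟩
        rw [mem_thickening_iff] at this
        exact this
      have hpos : ∀ y ∈ S, 0 < ‖Φ y - Φ c.o‖ := by
        intro y hy
        rw [norm_pos_iff, sub_ne_zero]
        intro h
        exact hy.2 (self_subset_thickening (by positivity) _ h)
      rcases S.eq_empty_or_nonempty with h0 | h0
      · exact ⟨1, one_pos, fun y hy _ => hout y hy (by rw [h0]; simp)⟩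
      · obtain ⟨y0, hy0, hmin⟩ := hSc.exists_isMinOn h0
          (f := fun y => ‖Φ y - Φ c.o‖) (by fun_prop)
        refine ⟨_, hpos y0 hy0, fun y hy hlt => hout y hy fun hyS => ?_⟩
        exact absurd (hmin hyS) (not_le.2 hlt)
    obtain ⟨δ, hδ, hδ'⟩ := h2
    refine ⟨δ, hδ, ε/3, by positivity, fun x hx => ?_⟩
    have : dist x c.o < R + ε ∧ ∃ x', dist x x' < ε/3 ∧
      Relation.ReflTransGen (fun a b => dist a b ≤ ε ∧ Φ b = Φ c.o) c.o x' := by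
      induction hx with
      | refl => exact ⟨by rw [dist_self]; positivity, c.o, by rw [dist_self]; positivity,
          Relation.ReflTransGen.refl⟩
      | @tail y z h3 h4 ih =>
        obtain ⟨hy, y', hyy, hch'⟩ := ih
        have e1 := dist_triangle z y c.o
        have e0 := h4.1
        rw [dist_comm] at e0
        obtain ⟨z', hz', hzz⟩ := hδ' z (by linarith) h4.2
        have e2 := dist_triangle4 y' y z z'
        rw [dist_comm y' y] at e2
        have h5 := hch'.tail (c := z') ⟨by linarith [h4.1], hz'⟩
        have h6 := hch z' h5
        have e3 := dist_triangle z z' c.o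
        exact ⟨by linarith, z', hzz, h5⟩
    exact this.1
  intro r hr
  obtain ⟨δ, hδ, s, hs, h⟩ := h1
  have ht : Tendsto (fun n : ℕ => (c.lam⁻¹)^n * (R + ε)) atTop (𝓝 0) := by
    simpa using c.tendsto_lam.mul_const (R + ε)
  obtain ⟨n, hn⟩ := (ht.eventually (gt_mem_nhds hr)).exists
  obtain ⟨D, hD, hDn⟩ := hA n
  have hl := c.lam_pos
  refine ⟨δ / D, by positivity, (c.lam⁻¹)^n * s, by positivity, fun x hx => ?_⟩
  have h2 : Relation.ReflTransGen (fun a b => dist a b < s ∧ ‖Φ b - Φ c.o‖ < δ)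
      (c.σ.symm^[n] c.o) (c.σ.symm^[n] x) := by
    refine Relation.ReflTransGen.lift (c.σ.symm^[n]) ?_ _ _ hx
    rintro a b ⟨hab, hb⟩
    refine ⟨?_, ?_⟩
    · have := c.dist_iter n (c.σ.symm^[n] a) (c.σ.symm^[n] b)
      rw [c.iter_symm, c.iter_symm] at this
      rw [this] at hab
      exact lt_of_mul_lt_mul_left hab (by positivity)
    · have := hDn (c.σ.symm^[n] b)
      rw [c.iter_symm] at this
      rw [lt_div_iff₀ hD] at hb
      linarith
  rw [c.iter_o'] at h2
  have h3 := h _ h2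
  have h4 := c.dist_iter_o n (c.σ.symm^[n] x)
  rw [c.iter_symm] at h4
  rw [h4]
  refine lt_of_le_of_lt ?_ hn
  gcongr

theorem rep_of_span.{u} {X : Type u} [MetricSpace X] (c : Ctx X) {D : Type u}
    [NormedAddCommGroup D] [NormedSpace ℂ D] [FiniteDimensional ℂ D] (Ψ : X → D) (hΨc : Continuous Ψ)
    (hact : ∀ g : X ≃ᵢ X, ∃ L : D →ₗ[ℂ] D, ∀ x, L (Ψ x) = Ψ (g x))
    (hdil : ∃ L : D →ₗ[ℂ] D, ∀ x, L (Ψ x) = Ψ (c.σ x))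
    (htrap : ∀ r, 0 < r → ∃ ε, 0 < ε ∧ ∃ s, 0 < s ∧ ∀ x,
    Relation.ReflTransGen (fun a b => dist a b < s ∧ ‖Ψ b - Ψ c.o‖ < ε) c.o x → dist x c.o < r) :
    ∃ (E : Type u) (_ : NormedAddCommGroup E) (_ : NormedSpace ℂ E) (_ : FiniteDimensional ℂ E),
    Nonempty (Rep c E) := by
  have gen : ∀ (L : D →ₗ[ℂ] D) (τ : X → X), (∀ x, L (Ψ x) = Ψ (τ x)) →
      ∃ h : (Submodule.span ℂ (range Ψ)) →L[ℂ] (Submodule.span ℂ (range Ψ)),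
      ∀ x, (⟨Ψ (τ x), Submodule.subset_span ⟨_, rfl⟩⟩ : Submodule.span ℂ (range Ψ)) =
        h ⟨Ψ x, Submodule.subset_span ⟨x, rfl⟩⟩ := by
    intro L τ hLx
    have hmap : ∀ l ∈ Submodule.span ℂ (range Ψ), L l ∈ Submodule.span ℂ (range Ψ) := by
      intro l hl
      have : Submodule.span ℂ (range Ψ) ≤ (Submodule.span ℂ (range Ψ)).comap L := by
        rw [Submodule.span_le]
        rintro _ ⟨x, rfl⟩
        show L (Ψ x) ∈ Submodule.span ℂ (range Ψ)
        rw [hLx]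
        exact Submodule.subset_span ⟨_, rfl⟩
      exact this hl
    refine ⟨LinearMap.toContinuousLinearMap (L.restrict hmap), fun x => ?_⟩
    apply Subtype.ext
    exact (hLx x).symm
  refine ⟨Submodule.span ℂ (range Ψ), inferInstance, inferInstance, inferInstance, ⟨
    { Φ := fun x => ⟨Ψ x, Submodule.subset_span ⟨x, rfl⟩⟩
      cont := hΨc.subtype_mk _
      span := ?_
      act := fun g => ?_
      dil := ?_
      trap := htrap }⟩⟩
  · have := Submodule.span_span_coe_preimage (R := ℂ) (s := range Ψ)
    rw [← this]
    congr 1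
    ext ⟨y, hy⟩
    constructor
    · rintro ⟨x, hx⟩
      exact ⟨x, congrArg Subtype.val hx⟩
    · rintro ⟨x, hx⟩
      exact ⟨x, Subtype.ext hx⟩
  · obtain ⟨L, hL⟩ := hact g
    exact gen L g hL
  · obtain ⟨L, hL⟩ := hdil
    exact gen L c.σ hL

theorem exists_rep.{u} {X : Type u} [MetricSpace X] (c : Ctx X) [ProperSpace X] :
    ∃ (E : Type u) (_ : NormedAddCommGroup E) (_ : NormedSpace ℂ E) (_ : FiniteDimensional ℂ E),
    Nonempty (Rep c E) := by
  obtain ⟨M, ρ, Φ, hM, hρ, hMρ, hg, hσ, hcont, ⟨u₀, R, hR, hu₀, hu₀'⟩, C, hC, hbd⟩ := c.exists_ops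
  obtain ⟨V, hfin, hMV, hVρ, hsurj, ε, hε, hch⟩ :=
    c.exists_V M ρ Φ hM hρ hMρ hg hσ u₀ R hR hu₀ hu₀' C hC hbd
  set Ψ : X → V →L[ℂ] ℂ := fun x => (Φ x).comp V.subtypeL with hΨ
  have hΨa : ∀ x (v : V), Ψ x v = Φ x v := fun x v => rfl
  have hΨc : Continuous Ψ := by
    rw [continuous_clm_apply]
    intro v
    exact hcont v
  have hσn : ∀ (n : ℕ) x u, Φ (c.σ^[n] x) u = Φ x ((M ^ n) u) := by
    intro n
    induction n with
    | zero => intro x u; rfl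
    | succ n ih =>
      intro x u
      rw [Function.iterate_succ_apply, ih, hσ, pow_succ']; rfl
  have htrap := trap_of c Ψ hΨc R ε hR hε (fun x hx => hch x (by
      refine Relation.ReflTransGen.mono ?_ _ _ hx
      rintro a b ⟨h1, h2⟩
      refine ⟨h1, fun v hv => ?_⟩
      have := congrArg (fun L => L ⟨v, hv⟩) h2
      exact this)) (fun n => by
    obtain ⟨D, hD, h⟩ := hsurj n
    refine ⟨D, hD, fun x => ContinuousLinearMap.opNorm_le_bound _ (by positivity) fun v => ?_⟩
    obtain ⟨w, hw, hwv, hwn⟩ := h v v.2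
    have e : (Ψ x - Ψ c.o) v = (Ψ (c.σ^[n] x) - Ψ c.o) ⟨w, hw⟩ := by
      rw [ContinuousLinearMap.sub_apply, ContinuousLinearMap.sub_apply, hΨa, hΨa, hΨa, hΨa, hσn,
        ← hwv]
      congr 1
      rw [← hσn, c.iter_o]
    rw [e]
    refine ((Ψ (c.σ^[n] x) - Ψ c.o).le_opNorm _).trans ?_
    have : ‖(⟨w, hw⟩ : V)‖ ≤ D * ‖v‖ := hwn
    calc _ ≤ ‖Ψ (c.σ^[n] x) - Ψ c.o‖ * (D * ‖v‖) := by gcongr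
      _ = _ := by ring)
  refine rep_of_span c Ψ hΨc ?_ ?_ htrap
  · intro g
    set T : V →L[ℂ] V := ((ρ g).comp V.subtypeL).codRestrict V fun v => hVρ g v v.2
    exact ⟨((ContinuousLinearMap.compL ℂ V V ℂ).flip T).toLinearMap, fun x => by
      ext v; exact (hg g x v).symm⟩
  · set T : V →L[ℂ] V := (M.comp V.subtypeL).codRestrict V fun v => hMV v v.2
    exact ⟨((ContinuousLinearMap.compL ℂ V V ℂ).flip T).toLinearMap, fun x => by
      ext v; exact (hσ x v).symm⟩
end CarnotHomeo

set_option linter.all false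
set_option linter.deprecated false
namespace CarnotHomeo
open Filter Topology Set Metric NormedSpace

section Exp
variable {𝒜 : Type*} [NormedRing 𝒜] [NormedAlgebra ℝ 𝒜] [CompleteSpace 𝒜]

theorem ex_cont : Continuous (exp : 𝒜 → 𝒜) := by
  letI : NormedAlgebra ℚ 𝒜 := NormedAlgebra.restrictScalars ℚ ℝ 𝒜
  exact NormedSpace.exp_continuous

theorem ex_add (a b : ℝ) (ξ : 𝒜) : exp ((a + b) • ξ) = exp (a • ξ) * exp (b • ξ) := by
  letI : NormedAlgebra ℚ 𝒜 := NormedAlgebra.restrictScalars ℚ ℝ 𝒜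
  rw [add_smul]
  exact NormedSpace.exp_add_of_commute (((Commute.refl ξ).smul_left a).smul_right b)

theorem ex_pow (n : ℕ) (ξ : 𝒜) : exp ξ ^ n = exp ((n:ℝ) • ξ) := by
  letI : NormedAlgebra ℚ 𝒜 := NormedAlgebra.restrictScalars ℚ ℝ 𝒜
  rw [Nat.cast_smul_eq_nsmul]
  exact (NormedSpace.exp_nsmul n ξ).symm

theorem ex_neg (ξ : 𝒜) : exp ξ * exp (-ξ) = 1 := by
  have := ex_add 1 (-1) ξ
  simpa using this.symm

theorem ex_neg' (ξ : 𝒜) : exp (-ξ) * exp ξ = 1 := by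
  have := ex_neg (-ξ)
  simpa using this

theorem ex_conj (a b : 𝒜) (h1 : a * b = 1) (h2 : b * a = 1) (ξ : 𝒜) :
    exp (a * ξ * b) = a * exp ξ * b := by
  letI : NormedAlgebra ℚ 𝒜 := NormedAlgebra.restrictScalars ℚ ℝ 𝒜
  exact NormedSpace.exp_units_conj (⟨a, b, h1, h2⟩ : 𝒜ˣ) ξ

theorem ex_log : ∃ L : 𝒜 → 𝒜, L 1 = 0 ∧ (∀ᶠ h in 𝓝 1, exp (L h) = h) ∧
    HasFDerivAt L (1 : 𝒜 →L[ℝ] 𝒜) 1 := by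
  have h0 : HasStrictFDerivAt (exp : 𝒜 → 𝒜)
      ((ContinuousLinearEquiv.refl ℝ 𝒜 : 𝒜 ≃L[ℝ] 𝒜) : 𝒜 →L[ℝ] 𝒜) 0 :=
    hasStrictFDerivAt_exp_zero (𝕂 := ℝ)
  have e0 : (exp (0:𝒜)) = 1 := NormedSpace.exp_zero
  refine ⟨h0.localInverse _ _ _, ?_, ?_, ?_⟩
  · have := h0.localInverse_apply_image
    rwa [e0] at this
  · have := h0.eventually_right_inverse
    rwa [e0] at this
  · have := h0.to_localInverse.hasFDerivAt
    rw [e0] at this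
    exact this

theorem ex_deriv (ξ : 𝒜) : HasDerivAt (fun t : ℝ => exp (t • ξ)) ξ 0 := by
  have := hasDerivAt_exp_smul_const (𝕂 := ℝ) ξ 0
  simpa using this

/-- rescaled logarithms -/
theorem log_lim {ι : Type*} (l : Filter ι) (L : 𝒜 → 𝒜) (h1 : L 1 = 0)
    (hd : HasFDerivAt L (1 : 𝒜 →L[ℝ] 𝒜) 1) (h : ι → 𝒜) (t : ι → ℝ) (ht : Tendsto t l atTop) (ξ : 𝒜)
    (hξ : Tendsto (fun i => t i • (h i - 1)) l (𝓝 ξ)) :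
    Tendsto h l (𝓝 1) ∧ Tendsto (fun i => t i • L (h i)) l (𝓝 ξ) := by
  have h2 : Tendsto (fun i => h i - 1) l (𝓝 0) := by
    have := (tendsto_inv_atTop_zero.comp ht).smul hξ
    rw [zero_smul] at this
    refine this.congr' ?_
    filter_upwards [ht.eventually_gt_atTop 0] with i hi
    simp [smul_smul, inv_mul_cancel₀ hi.ne']
  refine ⟨?_, ?_⟩
  · simpa using h2.add_const 1
  · have := hd.hasFDerivWithinAt (s := univ) |>.lim h2 (by simp) hξ
    simpa [h1] using this
end Exp

theorem clm_tendsto {E : Type*} [NormedAddCommGroup E] [NormedSpace ℂ E] [FiniteDimensional ℂ E]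
    {ι : Type*} (l : Filter ι) (h : ι → E →L[ℂ] E) (H : E →L[ℂ] E) (S : Set E)
    (hS : Submodule.span ℂ S = ⊤) (hh : ∀ x ∈ S, Tendsto (fun i => h i x) l (𝓝 (H x))) :
    Tendsto h l (𝓝 H) := by
  have h1 : ∀ x, Tendsto (fun i => h i x) l (𝓝 (H x)) := by
    intro x
    have hx : x ∈ Submodule.span ℂ S := by rw [hS]; trivial
    induction hx using Submodule.span_induction with
    | mem x hx => exact hh x hx
    | zero => simp only [map_zero]; exact tendsto_const_nhds
    | add x y _ _ hx hy => simpa using hx.add hy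
    | smul a x _ hx => simpa using hx.const_smul a
  let d := Module.finrank ℂ E
  let e₁ : E ≃L[ℂ] (Fin d → ℂ) := ContinuousLinearEquiv.ofFinrankEq (by simp [d])
  let e₂ : (E →L[ℂ] E) ≃L[ℂ] Fin d → E :=
    (e₁.arrowCongr (1 : E ≃L[ℂ] E)).trans (ContinuousLinearEquiv.piRing (Fin d))
  have h2 : Tendsto (fun i => e₂ (h i)) l (𝓝 (e₂ H)) := by
    rw [tendsto_pi_nhds]
    intro j
    exact h1 _
  have := (e₂.symm.continuous.tendsto _).comp h2
  simpa [Function.comp_def] using this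
end CarnotHomeo

set_option linter.all false
set_option linter.deprecated false
namespace CarnotHomeo
open Filter Topology Set Metric NormedSpace

variable {X : Type*} [MetricSpace X] {c : Ctx X} {E : Type*} [NormedAddCommGroup E] [NormedSpace ℂ E]

namespace Rep
variable (r : Rep c E)

theorem ext_Φ {h k : E →L[ℂ] E} (H : ∀ x, h (r.Φ x) = k (r.Φ x)) : h = k := by
  apply ContinuousLinearMap.ext_on (s := range r.Φ)
  · rw [r.span]; simp
  · rintro _ ⟨x, rfl⟩; exact H x

/-- the representation of the isometry group -/
noncomputable def π (g : X ≃ᵢ X) : E →L[ℂ] E := (r.act g).choose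
theorem π_Φ (g : X ≃ᵢ X) (x : X) : r.π g (r.Φ x) = r.Φ (g x) := ((r.act g).choose_spec x).symm
theorem π_eq {g : X ≃ᵢ X} {h : E →L[ℂ] E} (H : ∀ x, r.Φ (g x) = h (r.Φ x)) : r.π g = h :=
  r.ext_Φ fun x => by rw [π_Φ, H]
theorem π_one : r.π 1 = 1 := r.π_eq fun x => rfl
theorem π_mul (g h : X ≃ᵢ X) : r.π (g * h) = r.π g * r.π h := r.π_eq fun x => by
  show r.Φ (g (h x)) = r.π g (r.π h (r.Φ x))
  rw [π_Φ, π_Φ]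
theorem π_inv (g : X ≃ᵢ X) : r.π g * r.π g⁻¹ = 1 := by rw [← π_mul, mul_inv_cancel, π_one]
theorem π_inv' (g : X ≃ᵢ X) : r.π g⁻¹ * r.π g = 1 := by rw [← π_mul, inv_mul_cancel, π_one]
theorem π_pow (g : X ≃ᵢ X) (n : ℕ) : r.π (g ^ n) = r.π g ^ n := by
  induction n with
  | zero => simp [π_one]
  | succ n ih => rw [pow_succ, π_mul, ih, pow_succ]

/-- the base vector -/
noncomputable def ν : E := r.Φ c.o
theorem π_ν (g : X ≃ᵢ X) : r.π g r.ν = r.Φ (g c.o) := r.π_Φ g c.o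

/-- the linear dilation -/
noncomputable def A : E →L[ℂ] E := r.dil.choose
theorem A_Φ (x : X) : r.A (r.Φ x) = r.Φ (c.σ x) := (r.dil.choose_spec x).symm
theorem A_ν : r.A r.ν = r.ν := by rw [ν, A_Φ, c.hσo]
theorem A_π (g : X ≃ᵢ X) : r.A * r.π g = r.π (c.th g) * r.A := r.ext_Φ fun x => by
  show r.A (r.π g (r.Φ x)) = r.π (c.th g) (r.A (r.Φ x))
  rw [π_Φ, A_Φ, A_Φ, π_Φ, c.th_σ]
theorem A_pow (n : ℕ) (x : X) : (r.A ^ n) (r.Φ x) = r.Φ (c.σ^[n] x) := by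
  induction n with
  | zero => rfl
  | succ n ih => 
    rw [pow_succ']
    show r.A ((r.A ^ n) (r.Φ x)) = _
    rw [ih, A_Φ, Function.iterate_succ_apply']

theorem A_surj : Function.Surjective r.A := by
  have : r.A.toLinearMap.range = ⊤ := by
    rw [eq_top_iff, ← r.span, Submodule.span_le]
    rintro _ ⟨x, rfl⟩
    exact ⟨r.Φ (c.σ.symm x), by
      show r.A _ = _
      rw [r.A_Φ, c.σ.apply_symm_apply]⟩
  exact LinearMap.range_eq_top.1 this

variable [FiniteDimensional ℂ E]

theorem exists_B : ∃ B : E →L[ℂ] E, r.A * B = 1 ∧ B * r.A = 1 := by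
  have hinj : Function.Injective r.A :=
    (LinearMap.injective_iff_surjective (f := r.A.toLinearMap)).2 r.A_surj
  set e := LinearEquiv.ofBijective r.A.toLinearMap ⟨hinj, r.A_surj⟩ with he
  refine ⟨LinearMap.toContinuousLinearMap e.symm.toLinearMap, ?_, ?_⟩
  · ext x
    exact e.apply_symm_apply x
  · ext x
    exact e.symm_apply_apply x

noncomputable def B : E →L[ℂ] E := r.exists_B.choose
theorem A_B : r.A * r.B = 1 := r.exists_B.choose_spec.1
theorem B_A : r.B * r.A = 1 := r.exists_B.choose_spec.2
theorem B_ν : r.B r.ν = r.ν := by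
  conv_lhs => rw [← r.A_ν]
  show (r.B * r.A) r.ν = r.ν
  rw [B_A]; rfl
theorem AπB (g : X ≃ᵢ X) : r.A * r.π g * r.B = r.π (c.th g) := by
  rw [A_π, mul_assoc, A_B, mul_one]
theorem BπA (g : X ≃ᵢ X) : r.B * r.π g * r.A = r.π (c.ti g) := by
  rw [mul_assoc]
  conv_lhs => rw [← c.th_ti g]
  rw [← r.A_π, ← mul_assoc, B_A, one_mul]

/-- the filtration of the image of the representation -/
def Q (s : ℝ) (h : E →L[ℂ] E) : Prop := ∃ g, r.π g = h ∧ dist (g c.o) c.o ≤ s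

theorem Q_mono {s t : ℝ} (hst : s ≤ t) {h : E →L[ℂ] E} : r.Q s h → r.Q t h
  | ⟨g, h1, h2⟩ => ⟨g, h1, h2.trans hst⟩
theorem Q_one {s : ℝ} (hs : 0 ≤ s) : r.Q s 1 := ⟨1, r.π_one, by
  show dist c.o c.o ≤ s
  rw [dist_self]; exact hs⟩
theorem dist_mul_o (g h : X ≃ᵢ X) : dist ((g * h) c.o) c.o ≤ dist (g c.o) c.o + dist (h c.o) c.o := by
  have := dist_triangle (g (h c.o)) (g c.o) c.o
  rw [g.dist_eq] at this
  rw [IsometryEquiv.mul_apply]; linarith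
theorem dist_inv_o (g : X ≃ᵢ X) : dist (g⁻¹ c.o) c.o = dist (g c.o) c.o := by
  rw [← g.dist_eq]
  have : g (g⁻¹ c.o) = c.o := g.apply_symm_apply _
  rw [this, dist_comm]
theorem Q_mul {s t : ℝ} {h k : E →L[ℂ] E} : r.Q s h → r.Q t k → r.Q (s + t) (h * k)
  | ⟨g, h1, h2⟩, ⟨g', h1', h2'⟩ => ⟨g * g', by rw [π_mul, h1, h1'],
      (dist_mul_o g g').trans (add_le_add h2 h2')⟩
theorem Q_inv {s : ℝ} {h k : E →L[ℂ] E} (hk : h * k = 1) : r.Q s h → r.Q s k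
  | ⟨g, h1, h2⟩ => ⟨g⁻¹, by
      have := r.π_inv' g
      rw [h1] at this
      exact left_inv_eq_right_inv this hk, by rw [dist_inv_o]; exact h2⟩

variable [ProperSpace X]

theorem π_lim {ι : Type*} (U : Ultrafilter ι) (g : ι → X ≃ᵢ X) (s : ℝ)
    (h : ∀ᶠ i in (U : Filter ι), dist (g i c.o) c.o ≤ s) :
    ∃ G : X ≃ᵢ X, (∀ y, Tendsto (fun i => g i y) U (𝓝 (G y))) ∧
      Tendsto (fun i => r.π (g i)) U (𝓝 (r.π G)) ∧ dist (G c.o) c.o ≤ s := by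
  obtain ⟨G, hG, -⟩ := c.lim U g s h
  refine ⟨G, hG, ?_, ?_⟩
  · refine clm_tendsto _ _ _ (range r.Φ) r.span ?_
    rintro _ ⟨x, rfl⟩
    simp_rw [r.π_Φ]
    exact (r.cont.tendsto _).comp (hG x)
  · exact le_of_tendsto ((hG c.o).dist tendsto_const_nhds) h

theorem Q_closed {ι : Type*} (l : Filter ι) [l.NeBot] (h : ι → E →L[ℂ] E) (H : E →L[ℂ] E)
    (hl : Tendsto h l (𝓝 H)) (s : ℝ) (hQ : ∀ᶠ i in l, r.Q s (h i)) : r.Q s H := by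
  classical
  have hU := Ultrafilter.of_le l
  set U := Ultrafilter.of l
  set g : ι → X ≃ᵢ X := fun i => if hi : r.Q s (h i) then hi.choose else 1 with hg
  have hQ' := hU hQ
  obtain ⟨G, -, h2, h3⟩ := r.π_lim U g s (by
    filter_upwards [hQ'] with i hi
    simp only [hg]
    rw [dif_pos hi]; exact hi.choose_spec.2)
  refine ⟨G, tendsto_nhds_unique h2 ((hl.mono_left hU).congr' ?_), h3⟩
  filter_upwards [hQ'] with i hi
  simp only [hg]
  rw [dif_pos hi]; exact hi.choose_spec.1.symm

theorem Q_bdd (s : ℝ) : ∃ K, ∀ h, r.Q s h → ‖h‖ ≤ K := by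
  by_contra hcon
  push Not at hcon
  choose h hQ hn using fun n : ℕ => hcon n
  choose g hg hs using hQ
  set U : Ultrafilter ℕ := hyperfilter ℕ
  obtain ⟨G, -, h2, h3⟩ := r.π_lim U g s (Eventually.of_forall hs)
  have h4 : ∀ᶠ n in (U : Filter ℕ), ‖r.π (g n)‖ < ‖r.π G‖ + 1 :=
    h2.norm.eventually (gt_mem_nhds (by linarith))
  have h5 : ∀ᶠ n : ℕ in (U : Filter ℕ), ‖r.π G‖ + 1 < n :=
    Nat.hyperfilter_le_atTop ((tendsto_natCast_atTop_atTop (R := ℝ)).eventually_gt_atTop _)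
  obtain ⟨n, h6, h7⟩ := (h4.and h5).exists
  have := hn n
  rw [← hg] at this
  linarith

theorem lemC (N : Set (E →L[ℂ] E)) (hN : N ∈ 𝓝 1) : ∃ R κ : ℝ, 0 < κ ∧ ∀ u : X ≃ᵢ X,
    (∀ z ∈ closedBall c.o R, dist (u z) z < κ) → r.π u ∈ N := by
  by_contra hcon
  push Not at hcon
  choose u hu hu' using fun n : ℕ => hcon n (1 / ((n:ℝ) + 1)) (by positivity)
  have : Tendsto (fun n => r.π (u n)) atTop (𝓝 1) := by
    refine clm_tendsto _ _ _ (range r.Φ) r.span ?_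
    rintro _ ⟨x, rfl⟩
    simp_rw [r.π_Φ]
    refine (r.cont.tendsto x).comp ?_
    rw [tendsto_iff_dist_tendsto_zero]
    refine squeeze_zero' (Eventually.of_forall fun _ => dist_nonneg) ?_
      (tendsto_one_div_add_atTop_nhds_zero_nat (𝕜 := ℝ))
    filter_upwards [(tendsto_natCast_atTop_atTop (R := ℝ)).eventually_ge_atTop (dist x c.o)] with n hn
    exact (hu n x hn).le
  obtain ⟨n, hn⟩ := (this.eventually hN).exists
  exact hu' n hn

theorem power_trap (s : ℝ) (hs : 0 < s) : ∃ ε, 0 < ε ∧ ∃ s1, 0 < s1 ∧ ∀ (g : X ≃ᵢ X) (m : ℕ),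
    dist (g c.o) c.o < s1 → (∀ j ≤ m, ‖(r.π g ^ j) r.ν - r.ν‖ < ε) → 
    ∀ j ≤ m, r.Q s (r.π g ^ j) := by
  obtain ⟨ε, hε, s1, hs1, h⟩ := r.trap s hs
  refine ⟨ε, hε, s1, hs1, fun g m hg hj j hjm => ⟨g ^ j, r.π_pow g j, (h _ ?_).le⟩⟩
  induction j with
  | zero => exact Relation.ReflTransGen.refl
  | succ j ih =>
    refine (ih (by omega)).tail ⟨?_, ?_⟩
    · have e : (g ^ (j+1)) c.o = (g ^ j) (g c.o) := by rw [pow_succ]; rfl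
      rw [e, (g ^ j).dist_eq, dist_comm]; exact hg
    · have := hj (j+1) hjm
      rwa [← π_pow, π_ν] at this
end Rep
end CarnotHomeo

set_option linter.all false
set_option linter.deprecated false
namespace CarnotHomeo
open Filter Topology Set Metric NormedSpace

variable {X : Type*} [MetricSpace X] {c : Ctx X} {E : Type*} [NormedAddCommGroup E] [NormedSpace ℂ E]

namespace Rep
variable (r : Rep c E) [FiniteDimensional ℂ E] [ProperSpace X]

theorem exp_trap (s : ℝ) (hs : 0 < s) : ∃ δ, 0 < δ ∧ ∃ s1, 0 < s1 ∧ ∀ (ζ : E →L[ℂ] E) (m : ℕ),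
    r.Q s1 (exp ζ) → ‖(m:ℝ) • ζ‖ < δ → r.Q s (exp ((m:ℝ) • ζ)) := by
  obtain ⟨ε, hε, s1, hs1, h⟩ := r.power_trap s hs
  have hc : Continuous (fun x : E →L[ℂ] E => (exp x) r.ν - r.ν) := by
    have := ex_cont (𝒜 := E →L[ℂ] E)
    fun_prop
  have h0 : (exp (0 : E →L[ℂ] E)) r.ν - r.ν = 0 := by
    rw [NormedSpace.exp_zero]; exact sub_self _
  have := (hc.tendsto 0)
  rw [h0] at this
  obtain ⟨δ, hδ, hd⟩ := Metric.eventually_nhds_iff.1 (this.eventually (ball_mem_nhds _ hε))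
  refine ⟨δ, hδ, s1 / 2, by linarith, ?_⟩
  rintro ζ m ⟨g, hg, hgo⟩ hm
  have := h g m (by linarith) ?_ m le_rfl
  · rwa [hg, ex_pow] at this
  · intro j hj
    rw [hg, ex_pow]
    have := hd (y := (j:ℝ) • ζ) (by
      rw [dist_zero_right]
      refine lt_of_le_of_lt ?_ hm
      rw [norm_smul, norm_smul]
      gcongr
      simpa using hj)
    simpa using this

/-- Lie algebra of the image group -/
def inh (ξ : E →L[ℂ] E) : Prop := ∀ s, 0 < s → ∃ t0, 0 < t0 ∧ ∀ t : ℝ, |t| ≤ t0 → r.Q s (exp (t • ξ))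

theorem key {ι : Type*} (l : Filter ι) [l.NeBot] (h : ι → E →L[ℂ] E) (t : ι → ℝ)
    (hQ : ∀ s, 0 < s → ∀ᶠ i in l, r.Q s (h i)) (ht : Tendsto t l atTop) (ξ : E →L[ℂ] E)
    (hξ : Tendsto (fun i => t i • (h i - 1)) l (𝓝 ξ)) : r.inh ξ := by
  intro s hs
  obtain ⟨L, L1, L2, L3⟩ := ex_log (𝒜 := E →L[ℂ] E)
  obtain ⟨h1, h2⟩ := log_lim l L L1 L3 h t ht ξ hξ
  obtain ⟨δ, hδ, s1, hs1, H⟩ := r.exp_trap s hs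
  have hpos : ∀ a : ℝ, 0 ≤ a → a ≤ δ / (2 * (‖ξ‖ + 1)) → r.Q s (exp (a • ξ)) := by
    intro a ha ha'
    have hlim : Tendsto (fun i => ((⌊a * t i⌋₊ : ℕ) : ℝ) • L (h i)) l (𝓝 (a • ξ)) := by
      have h3 := ((tendsto_nat_floor_mul_div_atTop (R := ℝ) ha).comp ht).smul h2
      refine h3.congr' ?_
      filter_upwards [ht.eventually_gt_atTop 0] with i hi
      simp only [Function.comp_apply]
      rw [smul_smul, div_mul_cancel₀ _ hi.ne']
    refine r.Q_closed l _ _ ((ex_cont.tendsto _).comp hlim) s ?_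
    have hn : ‖a • ξ‖ < δ := by
      rw [norm_smul, Real.norm_of_nonneg ha]
      have : 0 < ‖ξ‖ + 1 := by positivity
      calc a * ‖ξ‖ ≤ δ / (2 * (‖ξ‖ + 1)) * (‖ξ‖ + 1) := by
            gcongr; linarith
        _ = δ / 2 := by field_simp
        _ < δ := by linarith
    filter_upwards [hQ s1 hs1, h1.eventually L2, hlim.norm.eventually (gt_mem_nhds hn)] with i i1 i2 i3
    exact H _ _ (by rw [i2]; exact i1) i3
  refine ⟨δ / (2 * (‖ξ‖ + 1)), by positivity, fun a ha => ?_⟩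
  rcases le_total 0 a with h0 | h0
  · exact hpos a h0 (by rwa [abs_of_nonneg h0] at ha)
  · have := hpos (-a) (by linarith) (by rwa [abs_of_nonpos h0] at ha)
    refine r.Q_inv ?_ this
    rw [neg_smul]; exact ex_neg' _

theorem slope {F : ℝ → E →L[ℂ] E} {ξ : E →L[ℂ] E} (h : HasDerivAt F ξ 0) (h0 : F 0 = 1) :
    Tendsto (fun k : ℕ => (k : ℝ) • (F ((k:ℝ)⁻¹) - 1)) atTop (𝓝 ξ) := by
  have h1 := hasDerivAt_iff_tendsto_slope_zero.1 h
  have h2 : Tendsto (fun k : ℕ => (k:ℝ)⁻¹) atTop (𝓝[≠] 0) := by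
    rw [tendsto_nhdsWithin_iff]
    refine ⟨tendsto_inv_atTop_nhds_zero_nat, ?_⟩
    filter_upwards [eventually_gt_atTop 0] with k hk
    simp; omega
  have := h1.comp h2
  simpa [Function.comp_def, h0] using this

theorem inh_ev {ξ : E →L[ℂ] E} (h : r.inh ξ) (s : ℝ) (hs : 0 < s) :
    ∀ᶠ k : ℕ in atTop, r.Q s (exp ((k:ℝ)⁻¹ • ξ)) := by
  obtain ⟨t0, ht0, H⟩ := h s hs
  filter_upwards [(tendsto_inv_atTop_nhds_zero_nat (𝕜 := ℝ)).eventually (gt_mem_nhds ht0)] with k hk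
  exact H _ (by rw [abs_of_nonneg (by positivity)]; exact hk.le)

/-- the Lie algebra as a real subspace -/
def H : Submodule ℝ (E →L[ℂ] E) where
  carrier := {ξ | r.inh ξ}
  zero_mem' := fun s hs => ⟨1, one_pos, fun t _ => by
    rw [smul_zero, NormedSpace.exp_zero]; exact r.Q_one hs.le⟩
  smul_mem' := by
    intro a ξ hξ s hs
    obtain ⟨t0, ht0, H⟩ := hξ s hs
    refine ⟨t0 / (|a| + 1), by positivity, fun t ht => ?_⟩
    rw [smul_smul]
    apply H
    rw [abs_mul]
    calc |t| * |a| ≤ t0 / (|a| + 1) * (|a| + 1) := by gcongr; linarith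
      _ = t0 := by field_simp
  add_mem' := by
    intro ξ η hξ hη
    refine r.key atTop (fun k : ℕ => exp ((k:ℝ)⁻¹ • ξ) * exp ((k:ℝ)⁻¹ • η)) (fun k => (k:ℝ)) ?_
      tendsto_natCast_atTop_atTop _ ?_
    · intro s hs
      filter_upwards [r.inh_ev hξ (s/2) (by linarith), r.inh_ev hη (s/2) (by linarith)] with k h1 h2
      have := r.Q_mul h1 h2
      rwa [add_halves] at this
    · have := (ex_deriv ξ).mul (ex_deriv η)
      refine slope (F := fun t => exp (t • ξ) * exp (t • η)) ?_ ?_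
      · simp only [zero_smul, NormedSpace.exp_zero, mul_one, one_mul] at this
        exact this
      · simp [NormedSpace.exp_zero]

theorem mem_H {ξ : E →L[ℂ] E} : ξ ∈ r.H ↔ r.inh ξ := Iff.rfl

theorem smul_inv_nat (ξ : E →L[ℂ] E) {k : ℕ} (hk : 0 < k) : (k:ℝ) • ((k:ℝ)⁻¹ • ξ) = ξ := by
  rw [smul_smul, mul_inv_cancel₀ (by positivity), one_smul]

theorem H_small (s : ℝ) (hs : 0 < s) : ∃ η, 0 < η ∧ ∀ ξ ∈ r.H, ‖ξ‖ < η → r.Q s (exp ξ) := by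
  obtain ⟨δ, hδ, s1, hs1, h⟩ := r.exp_trap s hs
  refine ⟨δ, hδ, fun ξ hξ hn => ?_⟩
  obtain ⟨k, hk, hk0⟩ := ((r.inh_ev hξ s1 hs1).and (eventually_gt_atTop 0)).exists
  have := h _ k hk (by rwa [smul_inv_nat ξ hk0])
  rwa [smul_inv_nat ξ hk0] at this

theorem H_exp {ξ : E →L[ℂ] E} (hξ : ξ ∈ r.H) : ∃ g, r.π g = exp ξ := by
  obtain ⟨k, ⟨g, hg, -⟩, hk0⟩ := ((r.inh_ev hξ 1 one_pos).and (eventually_gt_atTop 0)).exists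
  exact ⟨g ^ k, by rw [π_pow, hg, ex_pow, smul_inv_nat ξ hk0]⟩

theorem H_of_exp {ξ : E →L[ℂ] E} (hξ : ξ ∈ r.H) (s : ℝ) (hs : 0 < s)
    (hν : ∀ t : ℝ, (exp (t • ξ)) r.ν = r.ν) (t : ℝ) : r.Q s (exp (t • ξ)) := by
  obtain ⟨ε, hε, s1, hs1, h⟩ := r.power_trap s hs
  obtain ⟨k, ⟨g, hg, hgo⟩, hk0⟩ := ((r.inh_ev (r.H.smul_mem t hξ) (s1/2) (by linarith)).and (eventually_gt_atTop 0)).exists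
  have := h g k (by linarith) ?_ k le_rfl
  · rwa [hg, ex_pow, smul_inv_nat _ hk0] at this
  · intro j hj
    rw [hg, ex_pow, smul_smul, smul_smul, hν, sub_self, norm_zero]; exact hε

/-- elements of a complement are not in the group -/
theorem compl_small (C : Submodule ℝ (E →L[ℂ] E)) (hC : Disjoint r.H C) :
    ∃ s, 0 < s ∧ ∃ η, 0 < η ∧ ∀ x ∈ C, ‖x‖ < η → r.Q s (exp x) → x = 0 := by
  by_contra hcon
  push Not at hcon
  choose x hxC hxn hxQ hx0 using fun n : ℕ => hcon (1 / ((n:ℝ) + 1)) (by positivity) (1 / ((n:ℝ) + 1)) (by positivity)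
  have hz := tendsto_one_div_add_atTop_nhds_zero_nat (𝕜 := ℝ)
  set U : Ultrafilter ℕ := hyperfilter ℕ
  have hU : (U : Filter ℕ) ≤ atTop := Nat.hyperfilter_le_atTop
  have hsph : IsCompact (sphere (0 : E →L[ℂ] E) 1) := isCompact_sphere _ _
  obtain ⟨ξ, hξ1, hξ⟩ := hsph.ultrafilter_le_nhds' (U.map fun n => ‖x n‖⁻¹ • x n) (by
    refine Filter.Eventually.of_forall (p := fun n => ‖x n‖⁻¹ • x n ∈ sphere (0 : E →L[ℂ] E) 1) fun n => ?_
    rw [mem_sphere_zero_iff_norm, norm_smul, norm_inv, norm_norm, inv_mul_cancel₀ (norm_ne_zero_iff.2 (hx0 n))])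
  have hξ' : Tendsto (fun n => ‖x n‖⁻¹ • x n) U (𝓝 ξ) := hξ
  have hxt : Tendsto x U (𝓝 0) := by
    rw [tendsto_zero_iff_norm_tendsto_zero]
    exact squeeze_zero (fun _ => norm_nonneg _) (fun n => (hxn n).le) (hz.mono_left hU)
  have hH : r.inh ξ := by
    refine r.key (U : Filter ℕ) (fun n => exp (x n)) (fun n => ‖x n‖⁻¹) ?_ ?_ ξ ?_
    · intro s hs
      filter_upwards [(hz.mono_left hU).eventually (gt_mem_nhds hs)] with n hn
      exact r.Q_mono hn.le (hxQ n)
    · refine tendsto_inv_nhdsGT_zero.comp (tendsto_nhdsWithin_iff.2 ⟨?_, ?_⟩)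
      · simpa using hxt.norm
      · exact Eventually.of_forall fun n => norm_pos_iff.2 (hx0 n)
    · have hd : HasFDerivAt (exp : (E →L[ℂ] E) → (E →L[ℂ] E)) (1 : (E →L[ℂ] E) →L[ℝ] (E →L[ℂ] E)) 0 :=
        (hasStrictFDerivAt_exp_zero (𝕂 := ℝ)).hasFDerivAt
      have := hd.hasFDerivWithinAt (s := univ) |>.lim hxt (by simp) hξ'
      simpa [NormedSpace.exp_zero] using this
  have hC' : ξ ∈ C := by
    have : IsClosed (C : Set (E →L[ℂ] E)) := C.closed_of_finiteDimensional
    exact this.mem_of_tendsto hξ' (Eventually.of_forall fun n => C.smul_mem _ (hxC n))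
  have : ξ = 0 := by
    have := hC.le_bot ⟨hH, hC'⟩
    simpa using this
  rw [this] at hξ1
  simp at hξ1
end Rep
end CarnotHomeo

set_option linter.all false
set_option linter.deprecated false
namespace CarnotHomeo
open Filter Topology Set Metric NormedSpace

variable {E : Type*} [NormedAddCommGroup E] [NormedSpace ℂ E] [FiniteDimensional ℂ E]

theorem exp_nil (N : E →L[ℂ] E) (v : E) (h : N (N v) = 0) : (exp N) v = v + N v := by
  have hs : HasSum (fun n : ℕ => ((n.factorial : ℂ)⁻¹) • N ^ n) (exp N) :=
    NormedSpace.exp_series_hasSum_exp' (𝕂 := ℂ) N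
  have h1 := hs.mapL (ContinuousLinearMap.apply ℂ E v)
  have h2 : HasSum (fun n : ℕ => (ContinuousLinearMap.apply ℂ E v) (((n.factorial : ℂ)⁻¹) • N ^ n))
      (∑ n ∈ Finset.range 2, (ContinuousLinearMap.apply ℂ E v) (((n.factorial : ℂ)⁻¹) • N ^ n)) := by
    refine hasSum_sum_of_ne_finset_zero ?_
    intro n hn
    obtain ⟨k, rfl⟩ : ∃ k, n = k + 2 := ⟨n - 2, by simp at hn; omega⟩
    have : (N ^ (k + 2)) v = 0 := by
      rw [pow_add]
      show (N ^ k) ((N ^ 2) v) = 0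
      have : (N ^ 2) v = N (N v) := by rw [pow_two]; rfl
      rw [this, h, map_zero]
    simp [this]
  have := h1.unique h2
  simpa [Finset.sum_range_succ] using this

theorem exp_gen (T : E →L[ℂ] E) (μ : ℂ) (v w : E) (hv : T v = μ • v + w) (hw : T w = μ • w) (t : ℝ) :
    (exp (t • T)) v = Complex.exp (t * μ) • (v + (t : ℂ) • w) := by
  letI : NormedAlgebra ℚ (E →L[ℂ] E) := NormedAlgebra.restrictScalars ℚ ℂ _
  set N : E →L[ℂ] E := (t:ℂ) • (T - algebraMap ℂ (E →L[ℂ] E) μ) with hN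
  have e1 : t • T = algebraMap ℂ (E →L[ℂ] E) (t * μ) + N := by
    rw [hN, smul_sub, map_mul, ← Algebra.smul_def]
    rw [← Complex.coe_smul]; abel
  have hNv : N v = (t:ℂ) • w := by
    rw [hN, Algebra.algebraMap_eq_smul_one]
    simp [hv]
  have hNw : N w = 0 := by
    rw [hN, Algebra.algebraMap_eq_smul_one]
    simp [hw]
  rw [e1, NormedSpace.exp_add_of_commute (Algebra.commutes _ _), ← algebraMap_exp_comm,
    Algebra.algebraMap_eq_smul_one, ← Complex.exp_eq_exp_ℂ]
  show Complex.exp (t * μ) • ((exp N) v) = _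
  rw [exp_nil N v (by rw [hNv, map_smul, hNw, smul_zero]), hNv]

theorem bdd_lin {v w : E} {K : ℝ} (h : ∀ t : ℝ, ‖v + (t:ℂ) • w‖ ≤ K) : w = 0 := by
  by_contra hw
  have hw' : 0 < ‖w‖ := norm_pos_iff.2 hw
  have hK : 0 ≤ K := (norm_nonneg _).trans (h 0)
  have h1 := h ((K + ‖v‖ + 1) / ‖w‖)
  have h2 : ‖(((K + ‖v‖ + 1) / ‖w‖ : ℝ) : ℂ) • w‖ = K + ‖v‖ + 1 := by
    rw [norm_smul, Complex.norm_real, Real.norm_of_nonneg (by positivity)]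
    field_simp
  have h3 := norm_sub_le (v + (((K + ‖v‖ + 1) / ‖w‖ : ℝ) : ℂ) • w) v
  rw [add_sub_cancel_left, h2] at h3
  linarith

theorem eig_re (T : E →L[ℂ] E) (K : ℝ) (hK : ∀ t : ℝ, ‖exp (t • T)‖ ≤ K) (μ : ℂ) (w : E)
    (hw : T w = μ • w) (h0 : w ≠ 0) : μ.re = 0 := by
  by_contra hre
  have hw' : 0 < ‖w‖ := norm_pos_iff.2 h0
  have hK' : ∀ t : ℝ, Real.exp (t * μ.re) ≤ K := by
    intro t
    have h1 := exp_gen T μ w 0 (by simpa using hw) (by simp) t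
    have h2 := (exp (t • T)).le_of_opNorm_le (hK t) w
    rw [h1] at h2
    simp [norm_smul, Complex.norm_exp] at h2
    exact le_of_mul_le_mul_right h2 hw'
  have h3 := hK' (K / μ.re)
  rw [div_mul_cancel₀ _ hre] at h3
  have := Real.add_one_le_exp K
  linarith

theorem eig_ss (T : E →L[ℂ] E) (K : ℝ) (hK : ∀ t : ℝ, ‖exp (t • T)‖ ≤ K) (μ : ℂ) (v w : E)
    (hv : T v = μ • v + w) (hw : T w = μ • w) : w = 0 := by
  by_contra h0
  have hre := eig_re T K hK μ w hw h0
  refine h0 (bdd_lin (v := v) (K := K * ‖v‖) fun t => ?_)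
  have h1 := exp_gen T μ v w hv hw t
  have h2 := (exp (t • T)).le_of_opNorm_le (hK t) v
  rw [h1, norm_smul, Complex.norm_exp] at h2
  simpa [hre] using h2

/-- real part of the trace form -/
theorem trace_neg (T : E →L[ℂ] E) (K : ℝ) (hK : ∀ t : ℝ, ‖exp (t • T)‖ ≤ K) (hT : T ≠ 0) :
    (LinearMap.trace ℂ E (T * T : E →L[ℂ] E).toLinearMap).re < 0 := by
  classical
  set f : Module.End ℂ E := T.toLinearMap with hf
  have hgen : ∀ μ, f.maxGenEigenspace μ ≤ f.eigenspace μ := by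
    intro μ v hv
    rw [Module.End.mem_maxGenEigenspace] at hv
    obtain ⟨k, hk⟩ := hv
    rw [Module.End.mem_eigenspace_iff]
    induction k generalizing v with
    | zero =>
      have : v = 0 := hk
      rw [this]; simp
    | succ k ih =>
      rw [pow_succ] at hk
      have h1 := ih (v := (f - μ • 1) v) hk
      have h2 := eig_ss T K hK μ v ((f - μ • (1 : Module.End ℂ E)) v)
        (by simp [hf]) h1
      simpa [sub_eq_zero] using h2
  have htop : ⨆ μ, f.eigenspace μ = ⊤ :=
    top_le_iff.1 ((Module.End.iSup_maxGenEigenspace_eq_top f).symm.le.trans (iSup_mono hgen))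
  have hintg := DirectSum.isInternal_submodule_of_iSupIndep_of_iSup_eq_top f.eigenspaces_iSupIndep htop
  have hfin : {μ | f.eigenspace μ ≠ ⊥}.Finite := WellFoundedGT.finite_ne_bot_of_iSupIndep f.eigenspaces_iSupIndep
  have hm : ∀ μ, MapsTo (T * T : E →L[ℂ] E).toLinearMap (f.eigenspace μ) (f.eigenspace μ) := by
    intro μ v hv
    have h1 : T v = μ • v := Module.End.mem_eigenspace_iff.1 hv
    refine Module.End.mem_eigenspace_iff.2 ?_
    show T (T (T v)) = μ • T (T v)
    simp [h1]
  have htr := LinearMap.trace_eq_sum_trace_restrict' hintg hfin hm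
  have hone : ∀ μ, LinearMap.trace ℂ (f.eigenspace μ) ((T * T : E →L[ℂ] E).toLinearMap.restrict (hm μ))
      = μ ^ 2 * Module.finrank ℂ (f.eigenspace μ) := by
    intro μ
    have : (T * T : E →L[ℂ] E).toLinearMap.restrict (hm μ) = (μ ^ 2) • LinearMap.id := by
      ext ⟨v, hv⟩
      have h1 : T v = μ • v := Module.End.mem_eigenspace_iff.1 hv
      show T (T v) = (μ ^ 2) • v
      rw [h1, map_smul, h1, smul_smul, pow_two]
    rw [this, map_smul, LinearMap.trace_id]; rfl
  rw [htr]
  simp_rw [hone]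
  rw [Complex.re_sum]
  have hre : ∀ μ ∈ hfin.toFinset, (μ ^ 2 * (Module.finrank ℂ (f.eigenspace μ) : ℂ)).re
      = - (μ.im ^ 2 * Module.finrank ℂ (f.eigenspace μ)) ∧ μ.re = 0 := by
    intro μ hμ
    obtain ⟨w, hw, hw0⟩ := (Submodule.ne_bot_iff _).1 (hfin.mem_toFinset.1 hμ)
    have := eig_re T K hK μ w (Module.End.mem_eigenspace_iff.1 hw) hw0
    refine ⟨?_, this⟩
    simp [pow_two, this]
  obtain ⟨μ, hμ, hμ0⟩ : ∃ μ ∈ hfin.toFinset, μ ≠ 0 := by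
    by_contra hcon
    push Not at hcon
    have : ⨆ μ, f.eigenspace μ ≤ f.eigenspace 0 := by
      refine iSup_le fun μ => ?_
      by_cases h : f.eigenspace μ = ⊥
      · rw [h]; exact bot_le
      · rw [hcon μ (hfin.mem_toFinset.2 h)]
    rw [htop] at this
    apply hT
    ext v
    have := Module.End.mem_eigenspace_iff.1 (this (Submodule.mem_top (x := v)))
    simpa [hf] using this
  refine Finset.sum_neg' ?_ ⟨μ, hμ, ?_⟩
  · intro μ hμ
    rw [(hre μ hμ).1]
    have : 0 ≤ μ.im ^ 2 * (Module.finrank ℂ (f.eigenspace μ) : ℝ) := by positivity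
    linarith
  · rw [(hre μ hμ).1]
    have h1 : μ.im ≠ 0 := fun h => hμ0 (Complex.ext (hre μ hμ).2 h)
    have h2 : 0 < Module.finrank ℂ (f.eigenspace μ) :=
      Submodule.one_le_finrank_iff.2 (hfin.mem_toFinset.1 hμ)
    have : 0 < μ.im ^ 2 * (Module.finrank ℂ (f.eigenspace μ) : ℝ) := by positivity
    linarith
end CarnotHomeo

set_option linter.all false
set_option linter.deprecated false
namespace CarnotHomeo
open Filter Topology Set Metric NormedSpace

variable {X : Type*} [MetricSpace X] {c : Ctx X} {E : Type*} [NormedAddCommGroup E] [NormedSpace ℂ E]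

/-- real trace form -/
noncomputable def trf (E : Type*) [NormedAddCommGroup E] [NormedSpace ℂ E] :
    LinearMap.BilinForm ℝ (E →L[ℂ] E) :=
  LinearMap.mk₂ ℝ (fun ξ η => (LinearMap.trace ℂ E (ξ * η : E →L[ℂ] E).toLinearMap).re)
    (fun a b d => by rw [add_mul]; simp)
    (fun t a b => by rw [smul_mul_assoc, ← Complex.coe_smul]; simp)
    (fun a b d => by rw [mul_add]; simp)
    (fun t a b => by rw [mul_smul_comm, ← Complex.coe_smul]; simp)

theorem trf_apply (ξ η : E →L[ℂ] E) :
    trf E ξ η = (LinearMap.trace ℂ E (ξ * η : E →L[ℂ] E).toLinearMap).re := rfl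

theorem trf_comm (ξ η : E →L[ℂ] E) : trf E ξ η = trf E η ξ := by
  rw [trf_apply, trf_apply]
  congr 1
  exact LinearMap.trace_mul_comm ℂ ξ.toLinearMap η.toLinearMap

theorem exp_fix (ξ : E →L[ℂ] E) [FiniteDimensional ℂ E] (v : E) (h : ξ v = 0) (t : ℝ) : (exp (t • ξ)) v = v := by
  have := exp_gen ξ 0 v 0 (by simpa using h) (by simp) t
  simpa using this

namespace Rep
variable (r : Rep c E) [FiniteDimensional ℂ E] [ProperSpace X]

/-- the isotropy algebra -/
noncomputable def H0 : Submodule ℝ (E →L[ℂ] E) where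
  carrier := {ξ | ξ ∈ r.H ∧ ξ r.ν = 0}
  zero_mem' := ⟨r.H.zero_mem, rfl⟩
  add_mem' := fun ha hb => ⟨r.H.add_mem ha.1 hb.1, by
    rw [ContinuousLinearMap.add_apply, ha.2, hb.2, add_zero]⟩
  smul_mem' := fun t a ha => ⟨r.H.smul_mem t ha.1, by
    rw [ContinuousLinearMap.smul_apply, ha.2, smul_zero]⟩

/-- the complement of the isotropy algebra -/
noncomputable def M : Submodule ℝ (E →L[ℂ] E) := r.H ⊓ (trf E).orthogonal r.H0

theorem H0_neg {ξ : E →L[ℂ] E} (h : ξ ∈ r.H0) (h0 : ξ ≠ 0) : trf E ξ ξ < 0 := by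
  obtain ⟨K, hK⟩ := r.Q_bdd 1
  exact trace_neg ξ K (fun t => hK _ (r.H_of_exp h.1 1 one_pos (exp_fix ξ r.ν h.2) t)) h0

theorem mem_M {ξ : E →L[ℂ] E} : ξ ∈ r.M ↔ ξ ∈ r.H ∧ ∀ k ∈ r.H0, trf E k ξ = 0 := Iff.rfl

theorem M_H {ξ : E →L[ℂ] E} (h : ξ ∈ r.M) : ξ ∈ r.H := h.1

theorem M_inj {ξ : E →L[ℂ] E} (h : ξ ∈ r.M) (h0 : ξ r.ν = 0) : ξ = 0 := by
  by_contra hne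
  have h1 : ξ ∈ r.H0 := ⟨h.1, h0⟩
  have := r.H0_neg h1 hne
  rw [(r.mem_M.1 h).2 ξ h1] at this
  exact lt_irrefl _ this

theorem H_decomp {ξ : E →L[ℂ] E} (h : ξ ∈ r.H) : ∃ m ∈ r.M, ∃ k ∈ r.H0, ξ = m + k := by
  have hrefl : (trf E).IsRefl := fun x y hxy => by rw [trf_comm]; exact hxy
  have hdis : Disjoint r.H0 ((trf E).orthogonal r.H0) := by
    rw [Submodule.disjoint_def]
    intro x hx hx'
    by_contra hne
    have := r.H0_neg hx hne
    have h0 : trf E x x = 0 := hx' x hx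
    linarith
  have hc := LinearMap.BilinForm.isCompl_orthogonal_of_restrict_nondegenerate hrefl
    (LinearMap.BilinForm.nondegenerate_restrict_of_disjoint_orthogonal (trf E) hrefl hdis)
  have : ξ ∈ r.H0 ⊔ (trf E).orthogonal r.H0 := by rw [hc.sup_eq_top]; trivial
  obtain ⟨k, hk, m, hm, hkm⟩ := Submodule.mem_sup.1 this
  refine ⟨m, ⟨?_, hm⟩, k, hk, by rw [← hkm]; abel⟩
  have e : m = ξ - k := by rw [← hkm]; abel
  show m ∈ r.H
  rw [e]; exact r.H.sub_mem h hk.1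

theorem conj_H {ξ : E →L[ℂ] E} (h : ξ ∈ r.H) : r.A * ξ * r.B ∈ r.H := by
  intro s hs
  obtain ⟨t0, ht0, H⟩ := h s hs
  refine ⟨t0, ht0, fun t ht => ?_⟩
  obtain ⟨g, hg, hgo⟩ := H t ht
  refine ⟨c.th g, ?_, ?_⟩
  · rw [← r.AπB, hg, ← ex_conj _ _ r.A_B r.B_A, mul_smul_comm, smul_mul_assoc]
  · rw [c.th_o]
    refine le_trans ?_ hgo
    have : c.lam⁻¹ ≤ 1 := (inv_lt_one_of_one_lt₀ c.hlam).le
    exact mul_le_of_le_one_left dist_nonneg this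

theorem conj_H' {ξ : E →L[ℂ] E} (h : ξ ∈ r.H) : r.B * ξ * r.A ∈ r.H := by
  intro s hs
  have hl := c.lam_pos
  obtain ⟨t0, ht0, H⟩ := h (c.lam⁻¹ * s) (by positivity)
  refine ⟨t0, ht0, fun t ht => ?_⟩
  obtain ⟨g, hg, hgo⟩ := H t ht
  refine ⟨c.ti g, ?_, ?_⟩
  · rw [← r.BπA, hg, ← ex_conj _ _ r.B_A r.A_B, mul_smul_comm, smul_mul_assoc]
  · have := c.th_o (c.ti g)
    rw [c.th_ti] at this
    rw [this] at hgo
    exact le_of_mul_le_mul_left hgo (by positivity)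

theorem conj_H0 {ξ : E →L[ℂ] E} (h : ξ ∈ r.H0) : r.A * ξ * r.B ∈ r.H0 := by
  refine ⟨r.conj_H h.1, ?_⟩
  show r.A (ξ (r.B r.ν)) = 0
  rw [B_ν, h.2, map_zero]
theorem conj_H0' {ξ : E →L[ℂ] E} (h : ξ ∈ r.H0) : r.B * ξ * r.A ∈ r.H0 := by
  refine ⟨r.conj_H' h.1, ?_⟩
  show r.B (ξ (r.A r.ν)) = 0
  rw [A_ν, h.2, map_zero]

theorem conj_M {ξ : E →L[ℂ] E} (h : ξ ∈ r.M) : r.A * ξ * r.B ∈ r.M := by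
  refine r.mem_M.2 ⟨r.conj_H h.1, fun k hk => ?_⟩
  have h1 := (r.mem_M.1 h).2 _ (r.conj_H0' hk)
  rw [trf_comm] at h1 ⊢
  have e : trf E (r.A * ξ * r.B) k = trf E (r.A * (ξ * r.B * k)) 1 := by
    rw [trf_apply, trf_apply, mul_one]; simp only [mul_assoc]
  have e2 : trf E (r.A * (ξ * r.B * k)) 1 = trf E r.A (ξ * r.B * k) := by
    rw [trf_apply, trf_apply, mul_one]
  rw [e, e2, trf_comm]
  rw [trf_apply] at h1 ⊢
  rw [← h1]; simp only [mul_assoc]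
theorem conj_M' {ξ : E →L[ℂ] E} (h : ξ ∈ r.M) : r.B * ξ * r.A ∈ r.M := by
  refine r.mem_M.2 ⟨r.conj_H' h.1, fun k hk => ?_⟩
  have h1 := (r.mem_M.1 h).2 _ (r.conj_H0 hk)
  rw [trf_comm] at h1 ⊢
  have e : trf E (r.B * ξ * r.A) k = trf E (r.B * (ξ * r.A * k)) 1 := by
    rw [trf_apply, trf_apply, mul_one]; simp only [mul_assoc]
  have e2 : trf E (r.B * (ξ * r.A * k)) 1 = trf E r.B (ξ * r.A * k) := by
    rw [trf_apply, trf_apply, mul_one]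
  rw [e, e2, trf_comm]
  rw [trf_apply] at h1 ⊢
  rw [← h1]; simp only [mul_assoc]

/-- powers of the dilation on operators -/
noncomputable def τ (n : ℕ) (ξ : E →L[ℂ] E) : E →L[ℂ] E := r.A ^ n * ξ * r.B ^ n
noncomputable def τ' (n : ℕ) (ξ : E →L[ℂ] E) : E →L[ℂ] E := r.B ^ n * ξ * r.A ^ n

theorem comm_AB : Commute r.A r.B := by
  show r.A * r.B = r.B * r.A
  rw [A_B, B_A]
theorem An_Bn (n : ℕ) : r.A ^ n * r.B ^ n = 1 := by
  rw [← r.comm_AB.mul_pow, A_B, one_pow]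
theorem Bn_An (n : ℕ) : r.B ^ n * r.A ^ n = 1 := by
  rw [← r.comm_AB.symm.mul_pow, B_A, one_pow]
theorem Bn_ν (n : ℕ) : (r.B ^ n) r.ν = r.ν := by
  induction n with
  | zero => rfl
  | succ n ih =>
    rw [pow_succ]
    show (r.B ^ n) (r.B r.ν) = _
    rw [B_ν, ih]
theorem An_ν (n : ℕ) : (r.A ^ n) r.ν = r.ν := by
  rw [ν, A_pow, c.iter_o]

theorem τ_M (n : ℕ) {ξ : E →L[ℂ] E} (h : ξ ∈ r.M) : r.τ n ξ ∈ r.M := by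
  induction n with
  | zero => simpa [τ] using h
  | succ n ih =>
    have := r.conj_M ih
    rw [τ] at this ⊢
    rw [pow_succ', pow_succ (r.B)]
    simpa only [mul_assoc] using this
theorem τ'_M (n : ℕ) {ξ : E →L[ℂ] E} (h : ξ ∈ r.M) : r.τ' n ξ ∈ r.M := by
  induction n with
  | zero => simpa [τ'] using h
  | succ n ih =>
    have := r.conj_M' ih
    rw [τ'] at this ⊢
    rw [pow_succ', pow_succ (r.A)]
    simpa only [mul_assoc] using this
theorem τ_τ' (n : ℕ) (ξ : E →L[ℂ] E) : r.τ n (r.τ' n ξ) = ξ := by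
  rw [τ, τ']
  calc _ = (r.A ^ n * r.B ^ n) * ξ * (r.A ^ n * r.B ^ n) := by simp only [mul_assoc]
    _ = ξ := by rw [An_Bn, one_mul, mul_one]
theorem τ'_τ (n : ℕ) (ξ : E →L[ℂ] E) : r.τ' n (r.τ n ξ) = ξ := by
  rw [τ, τ']
  calc _ = (r.B ^ n * r.A ^ n) * ξ * (r.B ^ n * r.A ^ n) := by simp only [mul_assoc]
    _ = ξ := by rw [Bn_An, one_mul, mul_one]
theorem τ_cont (n : ℕ) : Continuous (r.τ n) := by unfold τ; fun_prop
theorem τ'_cont (n : ℕ) : Continuous (r.τ' n) := by unfold τ'; fun_prop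
theorem τ_ν (n : ℕ) (ξ : E →L[ℂ] E) : (r.τ n ξ) r.ν = (r.A ^ n) (ξ r.ν) := by
  show (r.A ^ n) (ξ ((r.B ^ n) r.ν)) = _
  rw [Bn_ν]

/-- the parametrization -/
noncomputable def ψ (ξ : E →L[ℂ] E) : E := (exp ξ) r.ν

theorem ψ_cont : Continuous r.ψ := by
  have := ex_cont (𝒜 := E →L[ℂ] E)
  unfold ψ
  fun_prop
theorem ψ_zero : r.ψ 0 = r.ν := by
  rw [ψ, NormedSpace.exp_zero]; rfl
theorem ψ_τ (n : ℕ) (ξ : E →L[ℂ] E) : r.ψ (r.τ n ξ) = (r.A ^ n) (r.ψ ξ) := by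
  rw [ψ, τ, ex_conj _ _ (r.An_Bn n) (r.Bn_An n)]
  show (r.A ^ n) ((exp ξ) ((r.B ^ n) r.ν)) = _
  rw [Bn_ν]; rfl
theorem ψ_τ' (n : ℕ) (ξ : E →L[ℂ] E) : r.ψ (r.τ' n ξ) = (r.B ^ n) (r.ψ ξ) := by
  rw [ψ, τ', ex_conj _ _ (r.Bn_An n) (r.An_Bn n)]
  show (r.B ^ n) ((exp ξ) ((r.A ^ n) r.ν)) = _
  rw [An_ν]; rfl

theorem ψ_range {ξ : E →L[ℂ] E} (h : ξ ∈ r.H) : ∃ x, r.Φ x = r.ψ ξ := by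
  obtain ⟨g, hg⟩ := r.H_exp h
  exact ⟨g c.o, by rw [← r.π_ν, hg]; rfl⟩

/-- vectors contracted by the dilation -/
def E0 : Submodule ℂ E where
  carrier := {w | Tendsto (fun n : ℕ => (r.A ^ n) w) atTop (𝓝 0)}
  zero_mem' := by simp
  add_mem' := by
    intro a b ha hb
    simp only [mem_setOf_eq, map_add] at *
    simpa using ha.add hb
  smul_mem' := by
    intro t a ha
    simp only [mem_setOf_eq, map_smul] at *
    simpa using ha.const_smul t

theorem E0_Φ (x : X) : r.Φ x - r.ν ∈ r.E0 := by
  show Tendsto _ _ _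
  simp only [map_sub, r.A_pow, r.An_ν]
  have := ((r.cont.tendsto c.o).comp (c.tendsto_iter x)).sub_const r.ν
  simpa [ν] using this

theorem E0_H {ξ : E →L[ℂ] E} (h : ξ ∈ r.H) : ξ r.ν ∈ r.E0 := by
  have h1 : Tendsto (fun k : ℕ => (k : ℝ) • (exp ((k:ℝ)⁻¹ • ξ) - 1)) atTop (𝓝 ξ) :=
    slope (F := fun t => exp (t • ξ)) (ex_deriv ξ) (by simp [NormedSpace.exp_zero])
  have h2 : Tendsto (fun k : ℕ => ((k : ℝ) • (exp ((k:ℝ)⁻¹ • ξ) - 1)) r.ν) atTop (𝓝 (ξ r.ν)) :=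
    ((ContinuousLinearMap.apply ℂ E r.ν).continuous.tendsto _).comp h1
  have hcl : IsClosed (r.E0 : Set E) := r.E0.closed_of_finiteDimensional
  refine hcl.mem_of_tendsto h2 (Eventually.of_forall fun k => ?_)
  obtain ⟨x, hx⟩ := r.ψ_range (r.H.smul_mem ((k:ℝ)⁻¹) h)
  have := r.E0.smul_mem ((k:ℝ):ℂ) (r.E0_Φ x)
  rw [hx] at this
  exact this

theorem M_bound : ∃ K, 0 < K ∧ ∀ ξ ∈ r.M, ‖ξ‖ ≤ K * ‖ξ r.ν‖ := by
  let D : r.M →ₗ[ℝ] E :=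
    { toFun := fun ξ => ξ.1 r.ν
      map_add' := fun a b => rfl
      map_smul' := fun a b => rfl }
  have hk : LinearMap.ker D = ⊥ := by
    rw [LinearMap.ker_eq_bot']
    intro m hm
    exact Subtype.ext (r.M_inj m.2 hm)
  obtain ⟨K, hK, h⟩ := LinearMap.exists_antilipschitzWith (𝕜 := ℝ) (E := r.M) (F := E) D hk
  refine ⟨K, hK, fun ξ hξ => ?_⟩
  have := h.le_mul_dist ⟨ξ, hξ⟩ 0
  rw [map_zero, dist_zero_right, dist_zero_right] at this
  exact this

theorem τ_tendsto {ξ : E →L[ℂ] E} (h : ξ ∈ r.M) : Tendsto (fun n => r.τ n ξ) atTop (𝓝 0) := by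
  obtain ⟨K, hK, hb⟩ := r.M_bound
  rw [tendsto_zero_iff_norm_tendsto_zero]
  refine squeeze_zero (fun _ => norm_nonneg _) (fun n => hb _ (r.τ_M n h)) ?_
  have h1 : Tendsto (fun n : ℕ => (r.A ^ n) (ξ r.ν)) atTop (𝓝 0) := r.E0_H h.1
  simp_rw [r.τ_ν]
  simpa using (h1.norm).const_mul K

theorem ψ_local : ∃ η, 0 < η ∧ ∃ K, 0 < K ∧ ∀ x ∈ r.M, ∀ y ∈ r.M, ‖x‖ < η → ‖y‖ < η →
    ‖x - y‖ ≤ K * ‖r.ψ x - r.ψ y‖ := by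
  obtain ⟨K, hK, hb⟩ := r.M_bound
  have hd : HasStrictFDerivAt (exp : (E →L[ℂ] E) → (E →L[ℂ] E)) (1 : (E →L[ℂ] E) →L[ℝ] (E →L[ℂ] E)) 0 :=
    hasStrictFDerivAt_exp_zero (𝕂 := ℝ)
  have h1 := hd.isLittleO.def (c := 1 / (2 * K * (‖r.ν‖ + 1))) (by positivity)
  rw [Metric.eventually_nhds_iff] at h1
  obtain ⟨η, hη, H⟩ := h1
  refine ⟨η, hη, 2 * K, by positivity, fun x hx y hy hxn hyn => ?_⟩
  have h2 := H (y := (x, y)) (by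
    rw [Prod.dist_eq]
    simp only [dist_zero_right]
    exact max_lt hxn hyn)
  simp only [ContinuousLinearMap.one_apply] at h2
  have h3 := hb _ (r.M.sub_mem hx hy)
  have h4 : ‖(x - y) r.ν‖ ≤ ‖r.ψ x - r.ψ y‖ + ‖(exp x - exp y - (x - y)) r.ν‖ := by
    have e : (x - y) r.ν = (r.ψ x - r.ψ y) - (exp x - exp y - (x - y)) r.ν := by
      simp [ψ]
    conv_lhs => rw [e]
    exact norm_sub_le _ _
  have h5 : ‖(exp x - exp y - (x - y)) r.ν‖ ≤ 1 / (2 * K) * ‖x - y‖ := by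
    refine (ContinuousLinearMap.le_opNorm _ _).trans ?_
    calc _ ≤ (1 / (2 * K * (‖r.ν‖ + 1)) * ‖x - y‖) * (‖r.ν‖ + 1) := by
            gcongr; linarith
      _ = _ := by field_simp
  have h6 : ‖x - y‖ ≤ K * (‖r.ψ x - r.ψ y‖ + 1 / (2 * K) * ‖x - y‖) := by
    refine h3.trans ?_
    gcongr
    linarith
  have h7 : K * (1 / (2 * K) * ‖x - y‖) = ‖x - y‖ / 2 := by field_simp
  nlinarith

theorem ψ_inj {x y : E →L[ℂ] E} (hx : x ∈ r.M) (hy : y ∈ r.M) (h : r.ψ x = r.ψ y) : x = y := by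
  obtain ⟨η, hη, K, hK, H⟩ := r.ψ_local
  have h1 := (r.τ_tendsto hx).norm.eventually (gt_mem_nhds (by simpa using hη))
  have h2 := (r.τ_tendsto hy).norm.eventually (gt_mem_nhds (by simpa using hη))
  obtain ⟨n, h3, h4⟩ := (h1.and h2).exists
  have h5 := H _ (r.τ_M n hx) _ (r.τ_M n hy) h3 h4
  rw [ψ_τ, ψ_τ, h, sub_self, norm_zero, mul_zero] at h5
  have h6 : r.τ n x = r.τ n y := by
    rw [← sub_eq_zero]; exact norm_le_zero_iff.1 h5
  rw [← r.τ'_τ n x, h6, τ'_τ]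
end Rep
end CarnotHomeo

set_option linter.all false
set_option linter.deprecated false
namespace CarnotHomeo
open Filter Topology Set Metric NormedSpace

theorem prod_open {𝒜 : Type*} [NormedRing 𝒜] [NormedAlgebra ℝ 𝒜] [FiniteDimensional ℝ 𝒜]
    (U V W : Submodule ℝ 𝒜) (h : ∀ x, ∃ u ∈ U, ∃ v ∈ V, ∃ w ∈ W, x = u + v + w) (η : ℝ) (hη : 0 < η) :
    {x : 𝒜 | ∃ u ∈ U, ∃ v ∈ V, ∃ w ∈ W, ‖u‖ < η ∧ ‖v‖ < η ∧ ‖w‖ < η ∧ x = exp u * exp v * exp w} ∈ 𝓝 (1 : 𝒜) := by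
  haveI : CompleteSpace 𝒜 := FiniteDimensional.complete ℝ 𝒜
  have hd : HasStrictFDerivAt (exp : 𝒜 → 𝒜) (1 : 𝒜 →L[ℝ] 𝒜) 0 :=
    hasStrictFDerivAt_exp_zero (𝕂 := ℝ)
  let p1 : (U × V × W) →L[ℝ] 𝒜 := U.subtypeL.comp (ContinuousLinearMap.fst ℝ U (V × W))
  let p2 : (U × V × W) →L[ℝ] 𝒜 := V.subtypeL.comp ((ContinuousLinearMap.fst ℝ V W).comp (ContinuousLinearMap.snd ℝ U (V × W)))
  let p3 : (U × V × W) →L[ℝ] 𝒜 := W.subtypeL.comp ((ContinuousLinearMap.snd ℝ V W).comp (ContinuousLinearMap.snd ℝ U (V × W)))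
  have hp : ∀ p : (U × V × W) →L[ℝ] 𝒜, HasStrictFDerivAt (fun z => exp (p z)) p 0 := by
    intro p
    have h0 : HasStrictFDerivAt (exp : 𝒜 → 𝒜) (1 : 𝒜 →L[ℝ] 𝒜) (p 0) := by rw [map_zero]; exact hd
    exact h0.comp 0 p.hasStrictFDerivAt
  have hG := ((hp p1).mul' (hp p2)).mul' (hp p3)
  have hm := hG.map_nhds_eq_of_surj (by
    rw [LinearMap.range_eq_top]
    intro x
    obtain ⟨u, hu, v, hv, w, hw, rfl⟩ := h x
    refine ⟨(⟨u, hu⟩, ⟨v, hv⟩, ⟨w, hw⟩), ?_⟩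
    simp [p1, p2, p3, NormedSpace.exp_zero]
    abel)
  have hb : ball (0 : U × V × W) η ∈ 𝓝 0 := ball_mem_nhds _ hη
  have := image_mem_map (m := (((fun z => exp (p1 z)) * fun z => exp (p2 z)) * fun z => exp (p3 z))) hb
  rw [hm] at this
  have e : (((fun z => exp (p1 z)) * fun z => exp (p2 z)) * fun z => exp (p3 z)) 0 = (1 : 𝒜) := by
    simp [NormedSpace.exp_zero]
  rw [e] at this
  refine mem_of_superset this ?_
  rintro _ ⟨⟨u, v, w⟩, hz, rfl⟩
  rw [mem_ball_zero_iff, Prod.norm_def, max_lt_iff, Prod.norm_def, max_lt_iff] at hz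
  exact ⟨u, u.2, v, v.2, w, w.2, hz.1, hz.2.1, hz.2.2, rfl⟩

variable {X : Type*} [MetricSpace X] {c : Ctx X} {E : Type*} [NormedAddCommGroup E] [NormedSpace ℂ E]

namespace Rep
variable (r : Rep c E) [FiniteDimensional ℂ E] [ProperSpace X]

theorem ψ_onto (η : ℝ) (hη : 0 < η) : ∃ ρ, 0 < ρ ∧ ∀ x, dist x c.o < ρ →
    ∃ ξ ∈ r.M, ‖ξ‖ < η ∧ r.ψ ξ = r.Φ x := by
  obtain ⟨C, hC⟩ := r.H.exists_isCompl
  obtain ⟨s, hs, η0, hη0, hc0⟩ := r.compl_small C hC.disjoint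
  obtain ⟨η1, hη1, hH⟩ := r.H_small (s / 3) (by linarith)
  have hN := prod_open C r.M r.H0 (by
    intro x
    have : x ∈ r.H ⊔ C := by rw [hC.sup_eq_top]; trivial
    obtain ⟨y, hy, u, hu, rfl⟩ := Submodule.mem_sup.1 this
    obtain ⟨m, hm, k, hk, rfl⟩ := r.H_decomp hy
    exact ⟨u, hu, m, hm, k, hk, by abel⟩) (min η (min η0 η1)) (by positivity)
  obtain ⟨R, κ, hκ, hl⟩ := r.lemC _ hN
  obtain ⟨ρ, hρ, ho⟩ := c.om' R κ hκ
  refine ⟨min ρ (s / 3), by positivity, fun x hx => ?_⟩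
  obtain ⟨u, huo, hu⟩ := ho x (hx.trans_le (min_le_left _ _))
  obtain ⟨a, ha, m, hm, k, hk, ha', hm', hk', he⟩ := hl u hu
  have h1 : r.Q (s/3) (r.π u) := ⟨u, rfl, by rw [huo]; exact (hx.trans_le (min_le_right _ _)).le⟩
  have h2 : r.Q (s/3) (exp (-m)) := hH _ (r.H.neg_mem hm.1) (by
    rw [norm_neg]; exact hm'.trans_le ((min_le_right _ _).trans (min_le_right _ _)))
  have h3 : r.Q (s/3) (exp (-k)) := hH _ (r.H.neg_mem hk.1) (by
    rw [norm_neg]; exact hk'.trans_le ((min_le_right _ _).trans (min_le_right _ _)))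
  have h4 := r.Q_mul (r.Q_mul h1 h3) h2
  have e : r.π u * exp (-k) * exp (-m) = exp a := by
    rw [he]
    calc _ = exp a * (exp m * (exp k * exp (-k)) * exp (-m)) := by simp only [mul_assoc]
      _ = exp a := by rw [ex_neg, mul_one, ex_neg, mul_one]
  rw [e, show s/3 + s/3 + s/3 = s by ring] at h4
  have ha0 := hc0 a ha (ha'.trans_le ((min_le_right _ _).trans (min_le_left _ _))) h4
  refine ⟨m, hm, hm'.trans_le (min_le_left _ _), ?_⟩
  rw [ha0, NormedSpace.exp_zero, one_mul] at he
  rw [← huo, ← π_ν, he]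
  show (exp m) r.ν = (exp m) ((exp k) r.ν)
  have := exp_fix k r.ν hk.2 1
  rw [one_smul] at this
  rw [this]

theorem exists_f (x : X) : ∃ ξ ∈ r.M, r.ψ ξ = r.Φ x := by
  obtain ⟨ρ, hρ, h⟩ := r.ψ_onto 1 one_pos
  obtain ⟨n, hn⟩ := ((c.tendsto_iter x).eventually (ball_mem_nhds _ hρ)).exists
  obtain ⟨ξ, hξ, -, he⟩ := h _ hn
  refine ⟨r.τ' n ξ, r.τ'_M n hξ, ?_⟩
  rw [ψ_τ', he, ← A_pow]
  show (r.B ^ n * r.A ^ n) (r.Φ x) = r.Φ x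
  rw [Bn_An]; rfl

/-- coordinates -/
noncomputable def f (x : X) : E →L[ℂ] E := (r.exists_f x).choose
theorem f_M (x : X) : r.f x ∈ r.M := (r.exists_f x).choose_spec.1
theorem ψ_f (x : X) : r.ψ (r.f x) = r.Φ x := (r.exists_f x).choose_spec.2
theorem f_eq {x : X} {ξ : E →L[ℂ] E} (hξ : ξ ∈ r.M) (h : r.ψ ξ = r.Φ x) : r.f x = ξ :=
  r.ψ_inj (r.f_M x) hξ (by rw [ψ_f, h])
theorem f_o : r.f c.o = 0 := r.f_eq r.M.zero_mem r.ψ_zero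
theorem f_of_Φ {x y : X} (h : r.Φ x = r.Φ y) : r.f x = r.f y :=
  r.f_eq (r.f_M y) (by rw [ψ_f, h])
theorem f_σ (n : ℕ) (x : X) : r.f (c.σ^[n] x) = r.τ n (r.f x) :=
  r.f_eq (r.τ_M n (r.f_M x)) (by rw [ψ_τ, ψ_f, A_pow])
theorem f_surj {ξ : E →L[ℂ] E} (h : ξ ∈ r.M) : ∃ x, r.f x = ξ := by
  obtain ⟨x, hx⟩ := r.ψ_range h.1
  exact ⟨x, r.f_eq h hx.symm⟩

theorem f_cont : Continuous r.f := by
  obtain ⟨η, hη, K, hK, H⟩ := r.ψ_local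
  obtain ⟨ρ, hρ, h⟩ := r.ψ_onto η hη
  have h1 : ContinuousOn r.f (ball c.o ρ) := by
    intro y hy
    rw [ContinuousWithinAt, tendsto_iff_norm_sub_tendsto_zero]
    have hn : ∀ x ∈ ball c.o ρ, ‖r.f x‖ < η := by
      intro x hx
      obtain ⟨ξ, hξ, hn, he⟩ := h x hx
      rw [r.f_eq hξ he]; exact hn
    have h2 : Tendsto (fun x => K * ‖r.Φ x - r.Φ y‖) (𝓝[ball c.o ρ] y) (𝓝 0) := by
      have : Continuous (fun x => K * ‖r.Φ x - r.Φ y‖) := by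
        have := r.cont
        fun_prop
      have := this.tendsto y
      simp only [sub_self, norm_zero, mul_zero] at this
      exact this.mono_left nhdsWithin_le_nhds
    refine squeeze_zero' (Eventually.of_forall fun _ => norm_nonneg _) ?_ h2
    filter_upwards [self_mem_nhdsWithin] with x hx
    have := H _ (r.f_M x) _ (r.f_M y) (hn x hx) (hn y hy)
    rwa [ψ_f, ψ_f] at this
  rw [continuous_iff_continuousAt]
  intro x
  obtain ⟨n, hn⟩ := ((c.tendsto_iter x).eventually (ball_mem_nhds _ hρ)).exists
  have h3 : ContinuousAt (fun y => r.τ' n (r.f (c.σ^[n] y))) x :=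
    (r.τ'_cont n).continuousAt.comp (ContinuousAt.comp (g := r.f)
      (h1.continuousAt (isOpen_ball.mem_nhds hn)) (c.iter_cont n).continuousAt)
  refine h3.congr (Eventually.of_forall fun y => ?_)
  simp only [f_σ, τ'_τ]
end Rep
end CarnotHomeo

set_option linter.all false
set_option linter.deprecated false
namespace CarnotHomeo
open Filter Topology Set Metric NormedSpace

variable {X : Type*} [MetricSpace X] {c : Ctx X} {E : Type*} [NormedAddCommGroup E] [NormedSpace ℂ E]

theorem iso_ia (g : X ≃ᵢ X) (x : X) : g⁻¹ (g x) = x := g.symm_apply_apply x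
theorem iso_ai (g : X ≃ᵢ X) (x : X) : g (g⁻¹ x) = x := g.apply_symm_apply x
theorem iso_dist_i (g : X ≃ᵢ X) (x y : X) : dist (g⁻¹ x) y = dist x (g y) := by
  rw [← g.dist_eq, iso_ai]
theorem iso_mul (g h : X ≃ᵢ X) (x : X) : (g * h) x = g (h x) := rfl

theorem pow_tendsto {ι : Type*} (l : Filter ι) (g : ι → X ≃ᵢ X) (G : X ≃ᵢ X)
    (h : ∀ y, Tendsto (fun i => g i y) l (𝓝 (G y))) (j : ℕ) (y : X) :
    Tendsto (fun i => (g i ^ j) y) l (𝓝 ((G ^ j) y)) := by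
  induction j generalizing y with
  | zero => simp only [pow_zero]; exact tendsto_const_nhds
  | succ j ih =>
    rw [tendsto_iff_dist_tendsto_zero]
    have h1 := (tendsto_iff_dist_tendsto_zero.1 (h y)).add (tendsto_iff_dist_tendsto_zero.1 (ih (G y)))
    rw [add_zero] at h1
    refine squeeze_zero (fun _ => dist_nonneg) (fun i => ?_) h1
    rw [pow_succ, pow_succ, iso_mul, iso_mul]
    refine (dist_triangle _ ((g i ^ j) (G y)) _).trans ?_
    rw [(g i ^ j).dist_eq]

namespace Rep
variable (r : Rep c E)

theorem lemN [ProperSpace X] [PreconnectedSpace X] (s : ℝ) (hs : 0 < s) : ∃ η, 0 < η ∧ ∀ n : X ≃ᵢ X, r.π n = 1 →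
    dist (n c.o) c.o < η → ∀ x, dist (n x) x < s := by
  obtain ⟨ε, hε, s1, hs1, H⟩ := r.trap s hs
  obtain ⟨ρ, hρ, ho⟩ := c.om' s (s1 / 2) (by linarith)
  refine ⟨s1, hs1, fun n hn hno => ?_⟩
  set rel : X → X → Prop := fun a b => dist a b < s1 ∧ ‖r.Φ b - r.Φ c.o‖ < ε with hrel
  have hΦ : ∀ g : X ≃ᵢ X, r.Φ (g⁻¹ (n (g c.o))) = r.Φ c.o := by
    intro g
    rw [← π_Φ, ← r.π_Φ n, hn]
    show r.π g⁻¹ (r.Φ (g c.o)) = _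
    rw [π_Φ, iso_ia]
  set P : X → Prop := fun x => ∃ g : X ≃ᵢ X, g c.o = x ∧
    Relation.ReflTransGen rel c.o (g⁻¹ (n (g c.o))) with hP
  have hPo : P c.o := ⟨1, rfl, Relation.ReflTransGen.single ⟨by
    rw [dist_comm]; exact hno, by rw [hΦ, sub_self, norm_zero]; exact hε⟩⟩
  have step : ∀ x x', P x → dist x' x < ρ → P x' := by
    rintro x x' ⟨g, hg, hch⟩ hd
    obtain ⟨u, huo, hu⟩ := ho (g⁻¹ x') (by rw [iso_dist_i, hg]; exact hd)
    refine ⟨g * u, by rw [iso_mul, huo, iso_ai], hch.tail ⟨?_, by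
      rw [hΦ, sub_self, norm_zero]; exact hε⟩⟩
    have hp := H _ hch
    have e : (g * u)⁻¹ (n ((g * u) c.o)) = u⁻¹ (g⁻¹ (n (g (u c.o)))) := by
      rw [mul_inv_rev]; rfl
    rw [e, dist_comm, iso_dist_i, dist_comm]
    refine (dist_triangle _ (g⁻¹ (n (g c.o))) _).trans_lt ?_
    have h1 := hu _ (mem_closedBall.2 hp.le)
    have h2 := hu c.o (mem_closedBall_self hs.le)
    rw [(g⁻¹).dist_eq, n.dist_eq, g.dist_eq, dist_comm c.o]
    linarith
  have hopen : IsOpen {x | P x} := by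
    rw [Metric.isOpen_iff]
    exact fun x hx => ⟨ρ, hρ, fun x' hx' => step x x' hx hx'⟩
  have hclosed : IsClosed {x | P x} := by
    rw [← isOpen_compl_iff, Metric.isOpen_iff]
    refine fun x hx => ⟨ρ, hρ, fun x' hx' hP' => hx (step x' x hP' ?_)⟩
    rw [dist_comm]; exact hx'
  have huniv := IsClopen.eq_univ ⟨hclosed, hopen⟩ ⟨c.o, hPo⟩
  intro x
  obtain ⟨g, hg, hch⟩ : P x := by
    have : x ∈ {x | P x} := by rw [huniv]; trivial
    exact this
  have := H _ hch
  rwa [iso_dist_i, hg] at this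

theorem chain_pow (s1 : ℝ) (g G : X ≃ᵢ X) (hπ : r.π G = r.π g)
    (hd : ∀ p, dist (g⁻¹ p) (G⁻¹ p) < s1) (j : ℕ) (p : X)
    (hp : r.Φ ((g⁻¹ ^ j) p) = r.Φ c.o) :
    Relation.ReflTransGen (fun a b => dist a b < s1 ∧ r.Φ a = r.Φ c.o ∧ r.Φ b = r.Φ c.o)
      ((g⁻¹ ^ j) p) ((G⁻¹ ^ j) p) ∧ r.Φ ((G⁻¹ ^ j) p) = r.Φ c.o := by
  have hinv : r.π G⁻¹ = r.π g⁻¹ := by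
    have h1 := r.π_inv' g
    have h2 := r.π_inv G
    rw [hπ] at h2
    exact (left_inv_eq_right_inv h1 h2).symm
  have hΦ : ∀ j : ℕ, ∀ q, r.Φ ((G⁻¹ ^ j) q) = r.Φ ((g⁻¹ ^ j) q) := by
    intro j q
    rw [← π_Φ, ← π_Φ, π_pow, π_pow, hinv]
  refine ⟨?_, by rw [hΦ, hp]⟩
  induction j generalizing p with
  | zero => exact Relation.ReflTransGen.refl
  | succ j ih =>
    have hp' := hp
    rw [pow_succ, iso_mul] at hp
    have h1 := ih _ hp
    have e : (g⁻¹ ^ (j+1)) p = (g⁻¹ ^ j) (g⁻¹ p) := by rw [pow_succ, iso_mul]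
    have e' : (G⁻¹ ^ (j+1)) p = (G⁻¹ ^ j) (G⁻¹ p) := by rw [pow_succ, iso_mul]
    have h2 : r.Φ ((G⁻¹ ^ (j+1)) p) = r.Φ c.o := by rw [hΦ, hp']
    rw [e]
    refine h1.tail ⟨?_, ?_, h2⟩
    · rw [e', (G⁻¹ ^ j).dist_eq]; exact hd p
    · rw [hΦ, hp]

variable [FiniteDimensional ℂ E] [ProperSpace X]

theorem F_trivial [PathConnectedSpace X] (z : X) (hz : r.Φ z = r.Φ c.o) : z = c.o := by
  classical
  obtain ⟨γ⟩ := PathConnectedSpace.joined c.o z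
  by_contra hne
  have hr : 0 < dist z c.o := dist_pos.2 hne
  obtain ⟨ε, hε, s1, hs1, H⟩ := r.trap _ hr
  obtain ⟨ηN, hηN, hN⟩ := r.lemN s1 hs1
  obtain ⟨η, hη, hH⟩ := r.H_small (ηN / 4) (by linarith)
  have hcont : Continuous (fun s => r.f (γ s)) := r.f_cont.comp γ.continuous
  obtain ⟨S, hS⟩ := (isCompact_range hcont).isBounded.exists_norm_le
  obtain ⟨m, hm⟩ := exists_nat_gt (max S 0 / η)
  have hm0 : (0:ℝ) < m := lt_of_le_of_lt (by positivity) hm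
  have hm0' : 0 < m := by exact_mod_cast hm0
  have hex : ∀ s, ∃ g : X ≃ᵢ X, r.π g = exp ((m:ℝ)⁻¹ • r.f (γ s)) ∧ dist (g c.o) c.o ≤ ηN / 4 ∧
      (r.f (γ s) = 0 → g = 1) := by
    intro s
    by_cases h0 : r.f (γ s) = 0
    · refine ⟨1, ?_, ?_, fun _ => rfl⟩
      · rw [h0, smul_zero, NormedSpace.exp_zero, π_one]
      · show dist c.o c.o ≤ _
        rw [dist_self]; linarith
    · obtain ⟨g, h1, h2⟩ := hH ((m:ℝ)⁻¹ • r.f (γ s)) (r.H.smul_mem _ (r.f_M _).1) (by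
        rw [norm_smul, norm_inv, Real.norm_of_nonneg hm0.le]
        have h3 := hS _ ⟨s, rfl⟩
        rw [inv_mul_lt_iff₀ hm0]
        rw [div_lt_iff₀ hη] at hm
        exact (h3.trans (le_max_left _ _)).trans_lt hm)
      exact ⟨g, h1, h2, fun h => absurd h h0⟩
  choose g hg hgo hg1 using hex
  set e : unitInterval → X := fun s => ((g s)⁻¹ ^ m) (γ s) with he
  have hΦe : ∀ s, r.Φ (e s) = r.Φ c.o := by
    intro s
    have h1 : r.Φ ((g s ^ m) c.o) = r.Φ (γ s) := by
      rw [← π_ν, π_pow, hg, ex_pow, smul_inv_nat _ hm0', ← r.ψ_f (γ s)]; rfl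
    simp only [he]
    rw [← π_Φ, ← h1, π_Φ, inv_pow, iso_ia]
  set rel : X → X → Prop := fun a b => dist a b < s1 ∧ r.Φ a = r.Φ c.o ∧ r.Φ b = r.Φ c.o with hrel
  have hsymm : ∀ a b, Relation.ReflTransGen rel a b → Relation.ReflTransGen rel b a := by
    intro a b hab
    induction hab with
    | refl => exact Relation.ReflTransGen.refl
    | tail _ h ih =>
      exact Relation.ReflTransGen.head ⟨by rw [dist_comm]; exact h.1, h.2.2, h.2.1⟩ ih
  have hloc : ∀ s, ∀ᶠ s' in 𝓝 s, Relation.ReflTransGen rel (e s) (e s') := by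
    intro s
    by_contra hcon
    have hfr : ∃ᶠ s' in 𝓝 s, ¬ Relation.ReflTransGen rel (e s) (e s') := not_eventually.1 hcon
    rw [frequently_iff_neBot] at hfr
    have hU := Ultrafilter.of_le (𝓝 s ⊓ 𝓟 {s' | ¬ Relation.ReflTransGen rel (e s) (e s')})
    set U := Ultrafilter.of (𝓝 s ⊓ 𝓟 {s' | ¬ Relation.ReflTransGen rel (e s) (e s')})
    have hU1 : (U : Filter unitInterval) ≤ 𝓝 s := hU.trans inf_le_left
    have hU2 : ∀ᶠ s' in (U : Filter unitInterval), ¬ Relation.ReflTransGen rel (e s) (e s') :=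
      (hU.trans inf_le_right) (mem_principal_self _)
    obtain ⟨G, hG1, hG2, hG3⟩ := r.π_lim U g (ηN / 4) (Eventually.of_forall hgo)
    have hπ : r.π G = r.π (g s) := by
      refine tendsto_nhds_unique hG2 ?_
      simp_rw [hg]
      have : Continuous (fun s => exp ((m:ℝ)⁻¹ • r.f (γ s))) := ex_cont.comp ((continuous_const_smul ((m:ℝ)⁻¹)).comp hcont)
      exact (this.tendsto s).mono_left hU1
    have hn : r.π ((g s)⁻¹ * G) = 1 := by rw [π_mul, hπ, π_inv']
    have hno : dist (((g s)⁻¹ * G) c.o) c.o < ηN := by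
      have h1 := dist_mul_o (c := c) (g s)⁻¹ G
      rw [dist_inv_o] at h1
      have := hgo s
      linarith
    have hd : ∀ p, dist ((g s)⁻¹ p) (G⁻¹ p) < s1 := by
      intro p
      have := hN _ hn hno (G⁻¹ p)
      rwa [iso_mul, iso_ai] at this
    obtain ⟨hch, hch2⟩ := r.chain_pow s1 (g s) G hπ hd m (γ s) (hΦe s)
    have hlim : Tendsto (fun s' => dist ((G⁻¹ ^ m) (γ s)) (e s')) U (𝓝 0) := by
      have h1 := pow_tendsto (U : Filter unitInterval) g G hG1 m ((G⁻¹ ^ m) (γ s))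
      have h2 : (G ^ m) ((G⁻¹ ^ m) (γ s)) = γ s := by rw [inv_pow, iso_ai]
      rw [h2] at h1
      have h3 := h1.dist ((γ.continuous.tendsto s).mono_left hU1)
      rw [dist_self] at h3
      refine h3.congr fun s' => ?_
      simp only [he]
      rw [dist_comm _ (((g s')⁻¹ ^ m) (γ s')), inv_pow (g s'), iso_dist_i, dist_comm]
    obtain ⟨s', h1, h2⟩ := (hU2.and (hlim.eventually (gt_mem_nhds hs1))).exists
    exact h1 (hch.tail ⟨h2, hch2, hΦe s'⟩)
  have hopen : IsOpen {s | Relation.ReflTransGen rel c.o (e s)} := by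
    rw [isOpen_iff_mem_nhds]
    intro s hs
    filter_upwards [hloc s] with s' hs'
    exact Relation.ReflTransGen.trans hs hs'
  have hclosed : IsClosed {s | Relation.ReflTransGen rel c.o (e s)} := by
    rw [← isOpen_compl_iff, isOpen_iff_mem_nhds]
    intro s hs
    filter_upwards [hloc s] with s' hs'
    intro hs''
    exact hs (Relation.ReflTransGen.trans hs'' (hsymm _ _ hs'))
  have e0 : e 0 = c.o := by
    have : r.f (γ 0) = 0 := by rw [γ.source, f_o]
    simp only [he]
    rw [hg1 0 this, inv_one, one_pow, γ.source]; rfl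
  have e1 : e 1 = z := by
    have : r.f (γ 1) = 0 := by rw [γ.target, r.f_of_Φ hz, f_o]
    simp only [he]
    rw [hg1 1 this, inv_one, one_pow, γ.target]; rfl
  have huniv := IsClopen.eq_univ ⟨hclosed, hopen⟩ ⟨0, by
    show Relation.ReflTransGen rel c.o (e 0)
    rw [e0]⟩
  have h1 : Relation.ReflTransGen rel c.o (e 1) := by
    have : (1 : unitInterval) ∈ {s | Relation.ReflTransGen rel c.o (e s)} := by rw [huniv]; trivial
    exact this
  rw [e1] at h1
  refine lt_irrefl _ (H z ?_)
  refine Relation.ReflTransGen.mono ?_ _ _ h1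
  intro a b hab
  exact ⟨hab.1, by rw [hab.2.2, sub_self, norm_zero]; exact hε⟩

theorem f_inj [PathConnectedSpace X] : Function.Injective r.f := by
  intro x y hxy
  have h1 : r.Φ x = r.Φ y := by rw [← ψ_f, ← ψ_f, hxy]
  obtain ⟨g, hg⟩ := c.tr y c.o
  have : g x = c.o := r.F_trivial _ (by rw [← π_Φ, h1, π_Φ, hg])
  rw [← hg] at this
  exact g.injective this

/-- the space is homeomorphic to a finite dimensional real vector space -/
theorem homeo [PathConnectedSpace X] : Nonempty (X ≃ₜ r.M) := by
  set F : X → r.M := fun x => ⟨r.f x, r.f_M x⟩ with hF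
  have hFc : Continuous F := r.f_cont.subtype_mk _
  have hFi : Function.Injective F := fun x y h => r.f_inj (congrArg Subtype.val h)
  have hFs : Function.Surjective F := fun ξ => by
    obtain ⟨x, hx⟩ := r.f_surj ξ.2
    exact ⟨x, Subtype.ext hx⟩
  set e := Equiv.ofBijective F ⟨hFi, hFs⟩ with he
  have heF : ∀ x, e x = F x := fun _ => rfl
  obtain ⟨η, hη, hH⟩ := r.H_small 1 one_pos
  have hball : ∀ ξ : r.M, ‖ξ‖ < η → dist (e.symm ξ) c.o ≤ 1 := by
    intro ξ hξ
    obtain ⟨g, hg, hgo⟩ := hH ξ ξ.2.1 hξ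
    have : e (g c.o) = ξ := by
      refine Subtype.ext (r.f_eq ξ.2 ?_)
      rw [← π_ν, hg]; rfl
    rw [← this, e.symm_apply_apply]; exact hgo
  have hsc : ContinuousOn e.symm (ball 0 η) := by
    have hco : ContinuousOn e.symm (F '' closedBall c.o 1) := by
      have hK := isCompact_closedBall c.o (1:ℝ)
      rw [continuousOn_iff_isClosed]
      intro t ht
      refine ⟨F '' (closedBall c.o 1 ∩ t), ((hK.inter_right ht).image hFc).isClosed, ?_⟩
      ext ξ
      constructor
      · rintro ⟨h1, x, hx, rfl⟩
        refine ⟨⟨x, ⟨hx, ?_⟩, rfl⟩, x, hx, rfl⟩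
        have : e.symm (e x) ∈ t := h1
        rwa [e.symm_apply_apply] at this
      · rintro ⟨⟨x, hx, rfl⟩, h2⟩
        refine ⟨?_, h2⟩
        show e.symm (e x) ∈ t
        rw [e.symm_apply_apply]; exact hx.2
    refine hco.mono fun ξ hξ => ⟨e.symm ξ, ?_, e.apply_symm_apply ξ⟩
    exact hball ξ (by simpa using hξ)
  have hsymm : Continuous e.symm := by
    rw [continuous_iff_continuousAt]
    intro ξ
    set T : ℕ → r.M → r.M := fun n ζ => ⟨r.τ n ζ, r.τ_M n ζ.2⟩ with hT
    have hTc : ∀ n, Continuous (T n) := fun n => ((r.τ_cont n).comp continuous_subtype_val).subtype_mk _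
    have hTt : Tendsto (fun n => T n ξ) atTop (𝓝 0) := by
      rw [tendsto_subtype_rng]
      exact r.τ_tendsto ξ.2
    obtain ⟨n, hn⟩ := (hTt.eventually (ball_mem_nhds _ hη)).exists
    have h1 : ContinuousAt (fun ζ => c.σ.symm^[n] (e.symm (T n ζ))) ξ := by
      refine (c.σ.symm.continuous.iterate n).continuousAt.comp ?_
      exact ContinuousAt.comp (g := e.symm) (hsc.continuousAt (isOpen_ball.mem_nhds hn)) (hTc n).continuousAt
    refine h1.congr (Eventually.of_forall fun ζ => ?_)
    have h2 : T n ζ = e (c.σ^[n] (e.symm ζ)) := by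
      refine Subtype.ext ?_
      show r.τ n ζ = r.f _
      rw [f_σ]
      congr 1
      exact (congrArg Subtype.val (e.apply_symm_apply ζ)).symm
    simp only [h2, e.symm_apply_apply, c.iter_symm']
  exact ⟨⟨e, hFc, hsymm⟩⟩

end Rep
end CarnotHomeo

theorem homeomorphic_to_euclidean
    (X : Type*) [MetricSpace X] [Nonempty X] [LocallyCompactSpace X]
    (hgeo : IsGeodesicSpace X) (hhom : IsometricallyHomogeneous X)
    (lam : ℝ) (hlam : 1 < lam) (f : X ≃ₜ X) (hf : IsDilation f lam) :
    ∃ n : ℕ, Nonempty (X ≃ₜ (Fin n → ℝ)) := by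
  have hhom' : ∀ p q : X, ∃ g : X ≃ᵢ X, g p = q := by
    intro p q
    obtain ⟨g, hg, hs, hpq⟩ := hhom p q
    exact ⟨⟨Equiv.ofBijective g ⟨hg.injective, hs⟩, hg⟩, hpq⟩
  haveI : PathConnectedSpace X := by
    refine ⟨inferInstance, fun p q => ?_⟩
    obtain ⟨T, hT, ι, hι, h0, h1⟩ := hgeo p q
    have hm : ∀ t : unitInterval, T * (t : ℝ) ∈ Set.Icc (0 : ℝ) T := fun t =>
      ⟨mul_nonneg hT t.2.1, mul_le_of_le_one_right hT t.2.2⟩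
    have hc : Continuous (fun t : unitInterval => ι (T * (t : ℝ))) := by
      refine (LipschitzWith.of_dist_le_mul (K := ⟨T, hT⟩) fun s t => ?_).continuous
      rw [hι _ (hm s) _ (hm t), Real.dist_eq, ← mul_sub, abs_mul, abs_of_nonneg hT]
      exact le_of_eq rfl
    exact ⟨⟨⟨_, hc⟩, by simpa using h0, by simpa using h1⟩⟩
  haveI := CarnotHomeo.proper_of X hhom' lam hlam f hf
  obtain ⟨c⟩ := CarnotHomeo.exists_ctx X hhom' lam hlam f hf
  obtain ⟨E, _, _, _, ⟨r⟩⟩ := CarnotHomeo.exists_rep c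
  obtain ⟨h⟩ := r.homeo
  refine ⟨Module.finrank ℝ r.M, ⟨h.trans ?_⟩⟩
  exact (ContinuousLinearEquiv.ofFinrankEq (𝕜 := ℝ) (E := r.M)
    (F := Fin (Module.finrank ℝ r.M) → ℝ) (by simp)).toHomeomorph
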